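/- For every degree vector d̄ = (d_1,...,d_c) there exists a constant r(d̄) > 0 such that the following holds. Let k = F_q be a finite field, let D = Π_{i=1}^c d_i, let a < q/D, and let P̄ = (P_1,...,P_c) be a collection of polynomials P_i ∈ F_q[x_1,...,x_n] with deg P_i ≤ d_i and nc-rank ≥ r(d̄). Then any polynomial Q ∈ F_q[x_1,...,x_n] of degree a which vanishes at every point x ∈ F_q^n satisfying P_1(x) = ... = P_c(x) = 0 belongs to the ideal of F_q[x_1,...,x_n] generated by P_1,...,P_c. -/

import Mathlib

open MvPolynomial

/-- The Schmidt rank of `P` (as a polynomial of degree `d`) is at least `r`: every way of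
writing `P` as a sum of `m` products of two polynomials of total degree `< d` has `m ≥ r`. -/
def SchmidtRankGE {K : Type*} [CommRing K] {σ : Type*} (d : ℕ)
    (P : MvPolynomial σ K) (r : ℕ) : Prop :=
  ∀ (m : ℕ) (Q R : Fin m → MvPolynomial σ K),
    (∀ i, (Q i).totalDegree < d) → (∀ i, (R i).totalDegree < d) →
    P = ∑ i, Q i * R i → r ≤ m

/-- The symmetric multilinear form `P̃(h₁,…,h_d) = Δ_{h₁} ⋯ Δ_{h_d} P`, where
`Δ_h P(x) = P(x+h) - P(x)`, written as a polynomial in the variables `h₁,…,h_d` via the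
inclusion–exclusion formula `Δ_{h₁} ⋯ Δ_{h_d} P = ∑_{S ⊆ [d]} (-1)^{d-|S|} P(∑_{i∈S} hᵢ)`
(the result of `d` differencings of a polynomial of degree `≤ d` does not depend on the
base point `x`, so we evaluate at `x = 0`). -/
noncomputable def multiDiff {K : Type*} [CommRing K] {σ : Type*} (d : ℕ)
    (P : MvPolynomial σ K) : MvPolynomial (Fin d × σ) K :=
  ∑ S : Finset (Fin d), (-1 : K) ^ (d - S.card) •
    aeval (fun j : σ => ∑ i ∈ S, X (i, j)) P

/-- The non-classical rank (nc-rank) of `P` is at least `r`: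
the Schmidt rank of `P̃` is at least `r`. -/
def ncRankGE {K : Type*} [CommRing K] {σ : Type*} (P : MvPolynomial σ K) (r : ℕ) : Prop :=
  SchmidtRankGE P.totalDegree (multiDiff P.totalDegree P) r

/-- The nc-rank of the collection `P̄` is at least `r`: every nontrivial linear combination
`P_ā = ∑ i, a_i P_i` has nc-rank at least `r`. -/
def ncRankCollGE {K : Type*} [CommRing K] {σ : Type*} {c : ℕ}
    (P : Fin c → MvPolynomial σ K) (r : ℕ) : Prop :=
  ∀ a : Fin c → K, a ≠ 0 → ncRankGE (∑ i, C (a i) * P i) r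

open MvPolynomial
namespace HR

/-- first order Taylor expansion along `p + t z`. -/
noncomputable def psi {k : Type*} [Field k] {r : ℕ} (p : Fin r → k) :
    MvPolynomial (Fin r) k →ₐ[k] Polynomial (MvPolynomial (Fin r) k) :=
  aeval (fun j => Polynomial.C (C (p j)) + Polynomial.X * Polynomial.C (X j))

theorem psi_taylor {k : Type*} [Field k] {r : ℕ} (p : Fin r → k) (f : MvPolynomial (Fin r) k) :
    ∃ w, psi p f = Polynomial.C (C (eval p f)) + Polynomial.X *
      (Polynomial.C (∑ j, C (eval p (pderiv j f)) * X j) + Polynomial.X * w) := by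
  induction f using MvPolynomial.induction_on with
  | C a => 
    refine ⟨0, ?_⟩
    simp only [eval_C, pderiv_C, map_zero, zero_mul, Finset.sum_const_zero, add_zero, mul_zero]
    exact AlgHom.commutes _ a
  | add f g hf hg =>
    obtain ⟨w, hw⟩ := hf
    obtain ⟨w', hw'⟩ := hg
    refine ⟨w + w', ?_⟩
    rw [map_add, hw, hw']
    simp only [map_add, add_mul, Finset.sum_add_distrib]
    ring
  | mul_X f i hf =>
    obtain ⟨w, hw⟩ := hf
    have h1 : ∑ j, C (eval p (pderiv j (f * X i))) * X j
        = C (p i) * (∑ j, C (eval p (pderiv j f)) * X j) + C (eval p f) * X i := by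
      rw [Finset.mul_sum]
      have : ∀ j, C (eval p (pderiv j (f * X i))) * X j = 
         C (p i) * (C (eval p (pderiv j f)) * X j) + (if j = i then C (eval p f) * X i else 0) := by
        intro j
        rw [pderiv_mul, pderiv_X]
        by_cases h : j = i
        · subst h
          simp
          ring
        · simp [h, Ne.symm h]
          ring
      rw [Finset.sum_congr rfl (fun j _ => this j), Finset.sum_add_distrib]
      simp
    refine ⟨w * (Polynomial.C (C (p i)) + Polynomial.X * Polynomial.C (X i)) + 
      Polynomial.C (∑ j, C (eval p (pderiv j f)) * X j) * Polynomial.C (X i), ?_⟩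
    rw [map_mul, hw, h1]
    have : psi p (X i) = Polynomial.C (C (p i)) + Polynomial.X * Polynomial.C (X i) := by
      simp [psi]
    rw [this]
    simp only [map_mul, map_add, eval_X]
    ring

theorem indep {k : Type*} [Field k] [DecidableEq k] {r : ℕ} (g : Fin r → MvPolynomial (Fin r) k)
    (Z : Finset (Fin r → k)) (hz : ∀ p ∈ Z, ∀ i, eval p (g i) = 0)
    (hJ : ∀ p ∈ Z, (Matrix.of fun i j => eval p (pderiv j (g i))).det ≠ 0)
    (l : (Fin r → k) → MvPolynomial (Fin r) k)
    (hl : ∀ p ∈ Z, ∀ q ∈ Z, eval q (l p) = if p = q then 1 else 0) (E : ℕ)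
    (c : (Fin r → Fin E) → (Fin r → k) → k)
    (h : ∑ e, ∑ p ∈ Z, C (c e p) * ((∏ i, g i ^ (e i : ℕ)) * l p) = 0) :
    ∀ m : ℕ, ∀ e : Fin r → Fin E, ∑ i, (e i : ℕ) = m → ∀ p ∈ Z, c e p = 0 := by
  intro m
  induction m using Nat.strong_induction_on with
  | _ m ih =>
  intro e0 he0 q hq
  choose w hw using fun i => psi_taylor q (g i)
  set L : Fin r → MvPolynomial (Fin r) k := fun i => ∑ j, C (eval q (pderiv j (g i))) * X j with hL
  have hg : ∀ i, psi q (g i) = Polynomial.X * (Polynomial.C (L i) + Polynomial.X * w i) := by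
    intro i
    rw [hw i, hz q hq i, map_zero, map_zero, zero_add]
  have hlp : ∀ p ∈ Z, Polynomial.eval 0 (psi q (l p)) = if p = q then 1 else 0 := by
    intro p hp
    obtain ⟨u, hu⟩ := psi_taylor q (l p)
    rw [hu, hl p hp q hq]
    split_ifs <;> simp
  -- cancel the power of t
  have h2 : ∑ e : Fin r → Fin E, ∑ p ∈ Z, Polynomial.C (C (c e p)) *
      (if m ≤ ∑ i, (e i : ℕ) then Polynomial.X ^ (∑ i, (e i : ℕ) - m) *
        ((∏ i, (Polynomial.C (L i) + Polynomial.X * w i) ^ (e i : ℕ)) * psi q (l p)) else 0) = 0 := by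
    have hX : (Polynomial.X : Polynomial (MvPolynomial (Fin r) k)) ^ m ≠ 0 :=
      pow_ne_zero _ Polynomial.X_ne_zero
    apply mul_left_cancel₀ hX
    have h' := congrArg (psi q) h
    rw [map_zero] at h'
    rw [mul_zero, ← h', map_sum, Finset.mul_sum]
    refine Finset.sum_congr rfl fun e _ => ?_
    rw [map_sum, Finset.mul_sum]
    refine Finset.sum_congr rfl fun p hp => ?_
    have hC : psi q (C (c e p)) = Polynomial.C (C (c e p)) := AlgHom.commutes _ _
    by_cases hm : m ≤ ∑ i, (e i : ℕ)
    · rw [if_pos hm, map_mul, map_mul, map_prod, hC]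
      simp only [map_pow, hg, mul_pow, Finset.prod_mul_distrib]
      rw [Finset.prod_pow_eq_pow_sum]
      have : (Polynomial.X : Polynomial (MvPolynomial (Fin r) k)) ^ (∑ i, (e i : ℕ)) =
        Polynomial.X ^ m * Polynomial.X ^ (∑ i, (e i : ℕ) - m) := by
        rw [← pow_add, Nat.add_sub_cancel' hm]
      rw [this]
      ring
    · rw [if_neg hm, ih _ (not_le.mp hm) e rfl p hp]
      simp
  have h3 := congrArg (Polynomial.eval 0) h2
  have h4 : ∑ e : Fin r → Fin E, (if ∑ i, (e i : ℕ) = m then C (c e q) * ∏ i, L i ^ (e i : ℕ) else 0)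
      = 0 := by
    rw [Polynomial.eval_finsetSum, Polynomial.eval_zero] at h3
    refine Eq.trans ?_ h3
    refine Finset.sum_congr rfl fun e _ => ?_
    rw [Polynomial.eval_finsetSum]
    have : ∀ p ∈ Z, Polynomial.eval 0 (Polynomial.C (C (c e p)) *
      (if m ≤ ∑ i, (e i : ℕ) then Polynomial.X ^ (∑ i, (e i : ℕ) - m) *
        ((∏ i, (Polynomial.C (L i) + Polynomial.X * w i) ^ (e i : ℕ)) * psi q (l p)) else 0)) =
        if p = q then (if ∑ i, (e i : ℕ) = m then C (c e q) * ∏ i, L i ^ (e i : ℕ) else 0) else 0 := by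
      intro p hp
      rw [Polynomial.eval_mul, Polynomial.eval_C]
      by_cases hm : m ≤ ∑ i, (e i : ℕ)
      · rw [if_pos hm]
        rw [Polynomial.eval_mul, Polynomial.eval_mul, hlp p hp, Polynomial.eval_prod]
        simp only [Polynomial.eval_pow, Polynomial.eval_add, Polynomial.eval_C, Polynomial.eval_mul,
          Polynomial.eval_X, zero_mul, add_zero]
        by_cases hpq : p = q
        · subst hpq
          by_cases hm2 : ∑ i, (e i : ℕ) = m
          · simp [hm2]
          · have : ∑ i, (e i : ℕ) - m ≠ 0 := by omega
            simp [hm2, this]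
        · simp [hpq]
      · have : ¬ (∑ i, (e i : ℕ) = m) := by omega
        simp [hm, this]
    rw [Finset.sum_congr rfl this]
    simp [hq]
  -- invert the linear change of variables
  set J : Matrix (Fin r) (Fin r) k := Matrix.of fun i j => eval q (pderiv j (g i)) with hJd
  have hJu : IsUnit J.det := (hJ q hq).isUnit
  have hinv : J * J⁻¹ = 1 := Matrix.mul_nonsing_inv _ hJu
  have hLX : ∀ i, aeval (fun j => ∑ j', C (J⁻¹ j j') * X j') (L i) = (X i : MvPolynomial (Fin r) k) := by
    intro i
    simp only [hL, map_sum, map_mul, aeval_X, algHom_C, algebraMap_eq]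
    simp only [Finset.mul_sum]
    rw [Finset.sum_comm]
    have : ∀ j', ∑ j, C (eval q (pderiv j (g i))) * (C (J⁻¹ j j') * X j') = 
        C ((J * J⁻¹) i j') * (X j' : MvPolynomial (Fin r) k) := by
      intro j'
      rw [Matrix.mul_apply, map_sum, Finset.sum_mul]
      refine Finset.sum_congr rfl fun j _ => ?_
      rw [hJd, map_mul, mul_assoc]; rfl
    rw [Finset.sum_congr rfl fun j' _ => this j', hinv]
    simp [Matrix.one_apply]
  have h5 := congrArg (aeval (fun j => ∑ j', C (J⁻¹ j j') * (X j' : MvPolynomial (Fin r) k))) h4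
  rw [map_sum, map_zero] at h5
  have h6 := congrArg (coeff (Finsupp.equivFunOnFinite.symm fun i => (e0 i : ℕ))) h5
  rw [coeff_sum, coeff_zero] at h6
  have h7 : ∀ e : Fin r → Fin E, coeff (Finsupp.equivFunOnFinite.symm fun i => (e0 i : ℕ))
      (aeval (fun j => ∑ j', C (J⁻¹ j j') * (X j' : MvPolynomial (Fin r) k))
        (if ∑ i, (e i : ℕ) = m then C (c e q) * ∏ i, L i ^ (e i : ℕ) else 0)) =
        if e = e0 then c e0 q else 0 := by
    intro e
    have hmon : aeval (fun j => ∑ j', C (J⁻¹ j j') * (X j' : MvPolynomial (Fin r) k))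
        (C (c e q) * ∏ i, L i ^ (e i : ℕ)) =
        monomial (Finsupp.equivFunOnFinite.symm fun i => (e i : ℕ)) (c e q) := by
      rw [map_mul, map_prod]
      simp only [map_pow, hLX, algHom_C, algebraMap_eq]
      rw [monomial_eq, Finsupp.prod_fintype]
      · simp
      · simp
    by_cases he : e = e0
    · subst he
      rw [if_pos he0, if_pos rfl, hmon, coeff_monomial, if_pos rfl]
    · rw [if_neg he]
      split_ifs with hm
      · rw [hmon, coeff_monomial, if_neg]
        intro h
        apply he
        have := Finsupp.equivFunOnFinite.symm.injective h
        funext i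
        exact Fin.ext (congrFun this i)
      · simp
  rw [Finset.sum_congr rfl fun e _ => h7 e] at h6
  simpa using h6

end HR

open MvPolynomial
namespace HR

theorem bezout {k : Type*} [Field k] [Fintype k] {r : ℕ} (g : Fin r → MvPolynomial (Fin r) k)
    (B : ℕ) (hB : ∀ i, (g i).totalDegree ≤ B)
    (Z : Finset (Fin r → k)) (hz : ∀ p ∈ Z, ∀ i, eval p (g i) = 0)
    (hJ : ∀ p ∈ Z, (Matrix.of fun i j => eval p (pderiv j (g i))).det ≠ 0) :
    Z.card ≤ (r * B + 1) ^ r := by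
  classical
  let l : (Fin r → k) → MvPolynomial (Fin r) k := fun p => indicator p
  let b := Finset.univ.sup fun p => (l p).totalDegree
  have hb : ∀ p, (l p).totalDegree ≤ b := fun p => Finset.le_sup (f := fun p => (l p).totalDegree) (Finset.mem_univ p)
  have hl : ∀ p ∈ Z, ∀ q ∈ Z, eval q (l p) = if p = q then 1 else 0 := by
    intro p _ q _
    split_ifs with h
    · subst h; exact eval_indicator_apply_eq_one _
    · exact eval_indicator_apply_eq_zero _ _ (Ne.symm h)
  let M := r * B * b + b
  let F : (Fin r → Fin (b + 1)) × Z → ((Fin r → Fin (M + 1)) → k) := fun ep m =>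
    coeff (Finsupp.equivFunOnFinite.symm fun i => (m i : ℕ)) ((∏ i, g i ^ (ep.1 i : ℕ)) * l ep.2)
  have hdeg : ∀ (e : Fin r → Fin (b + 1)) p, ((∏ i, g i ^ (e i : ℕ)) * l p).totalDegree ≤ M := by
    intro e p
    refine (totalDegree_mul _ _).trans (add_le_add ?_ (hb p))
    refine (totalDegree_finsetProd _ _).trans ?_
    calc ∑ i, (g i ^ (e i : ℕ)).totalDegree ≤ ∑ i : Fin r, b * B := by
          refine Finset.sum_le_sum fun i _ => ?_
          refine (totalDegree_pow _ _).trans (Nat.mul_le_mul ?_ (hB i))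
          exact Nat.lt_succ_iff.mp (e i).2
      _ = r * B * b := by simp; ring
  have hF : LinearIndependent k F := by
    rw [Fintype.linearIndependent_iff]
    intro c hc
    have h0 : ∑ e, ∑ p ∈ Z, C (if h : p ∈ Z then c (e, ⟨p, h⟩) else 0) *
        ((∏ i, g i ^ (e i : ℕ)) * l p) = 0 := by
      have h1 : ∑ e, ∑ p ∈ Z, C (if h : p ∈ Z then c (e, ⟨p, h⟩) else 0) *
        ((∏ i, g i ^ (e i : ℕ)) * l p) = ∑ ep : (Fin r → Fin (b + 1)) × Z, C (c ep) *
          ((∏ i, g i ^ (ep.1 i : ℕ)) * l ep.2) := by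
        rw [Fintype.sum_prod_type]
        refine Finset.sum_congr rfl fun e _ => ?_
        rw [← Finset.sum_coe_sort]
        refine Finset.sum_congr rfl fun p _ => ?_
        simp
      rw [h1]
      ext m
      rw [coeff_sum, coeff_zero]
      by_cases hm : ∀ i, m i < M + 1
      · have := congrFun hc (fun i => ⟨m i, hm i⟩)
        simp only [Finset.sum_apply, Pi.smul_apply, smul_eq_mul, Pi.zero_apply, F] at this
        rw [← this]
        refine Finset.sum_congr rfl fun ep _ => ?_
        rw [coeff_C_mul]
        congr 3
        ext i
        simp
      · push Not at hm
        obtain ⟨i, hi⟩ := hm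
        refine Finset.sum_eq_zero fun ep _ => ?_
        rw [coeff_C_mul, coeff_eq_zero_of_totalDegree_lt, mul_zero]
        refine (hdeg ep.1 ep.2).trans_lt (lt_of_lt_of_le (Nat.lt_of_succ_le hi) ?_)
        by_cases h0 : i ∈ m.support
        · exact Finset.single_le_sum (f := fun i => m i) (fun _ _ => Nat.zero_le _) h0
        · rw [Finsupp.notMem_support_iff.mp h0]; exact Nat.zero_le _
    intro ep
    have := indep g Z hz hJ l hl (b + 1) _ h0 _ ep.1 rfl ep.2 ep.2.2
    simpa using this
  have hcard := hF.fintype_card_le_finrank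
  rw [Module.finrank_pi, Fintype.card_prod, Fintype.card_fun, Fintype.card_fun, Fintype.card_fin,
    Fintype.card_fin, Fintype.card_fin, Fintype.card_coe] at hcard
  have h2 : (M + 1) ^ r ≤ (b + 1) ^ r * (r * B + 1) ^ r := by
    rw [← mul_pow]
    refine Nat.pow_le_pow_left ?_ r
    simp only [M]; nlinarith [Nat.zero_le (r * B)]
  exact Nat.le_of_mul_le_mul_left (hcard.trans h2) (by positivity)

/-- derivative in direction `v` -/
noncomputable def dd {k : Type*} [CommSemiring k] {ι : Type*} [Fintype ι] (v : ι → k) :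
    Derivation k (MvPolynomial ι k) (MvPolynomial ι k) := 
  mkDerivation k (fun b => C (v b))

end HR

open MvPolynomial
namespace HR

theorem totalDegree_aeval_le {k S σ τ : Type*} [CommRing k] [CommRing S] [Algebra k S]
    (f : σ → MvPolynomial τ S) (B : ℕ) (hf : ∀ i, (f i).totalDegree ≤ B) (P : MvPolynomial σ k) :
    (aeval f P : MvPolynomial τ S).totalDegree ≤ P.totalDegree * B := by
  rw [aeval_def, eval₂_eq]
  refine totalDegree_finsetSum_le fun m hm => ?_
  refine (totalDegree_mul _ _).trans ?_
  have h0 : ((algebraMap k (MvPolynomial τ S)) (coeff m P)).totalDegree = 0 := by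
    rw [MvPolynomial.algebraMap_apply, totalDegree_C]
  rw [h0, zero_add]
  refine (totalDegree_finsetProd _ _).trans ?_
  calc ∑ i ∈ m.support, (f i ^ m i).totalDegree ≤ ∑ i ∈ m.support, m i * B :=
        Finset.sum_le_sum fun i _ => (totalDegree_pow _ _).trans (Nat.mul_le_mul_left _ (hf i))
    _ = (∑ i ∈ m.support, m i) * B := by rw [Finset.sum_mul]
    _ ≤ P.totalDegree * B := Nat.mul_le_mul_right _ (le_totalDegree hm)

theorem derivation_sum_apply {k A : Type*} [CommRing k] [CommRing A] [Algebra k A] {ι : Type*} 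
    (s : Finset ι) (D : ι → Derivation k A A) (f : A) : (∑ b ∈ s, D b) f = ∑ b ∈ s, D b f := by
  classical
  induction s using Finset.induction_on with
  | empty => simp
  | insert a s ha ih => rw [Finset.sum_insert ha, Finset.sum_insert ha, Derivation.add_apply, ih]

theorem dd_apply {k : Type*} [CommRing k] {ι : Type*} [Fintype ι] (v : ι → k)
    (f : MvPolynomial ι k) : dd v f = ∑ b, C (v b) * pderiv b f := by
  classical
  have : dd v = ∑ b : ι, (C (v b) : MvPolynomial ι k) • (pderiv b : Derivation k (MvPolynomial ι k) (MvPolynomial ι k)) := by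
    apply MvPolynomial.derivation_ext
    intro i
    rw [dd, mkDerivation_X, derivation_sum_apply]
    simp [pderiv_X, Pi.single_apply]
  rw [this, derivation_sum_apply]
  simp

theorem totalDegree_pderiv_le {k : Type*} [CommRing k] {ι : Type*} (b : ι)
    (f : MvPolynomial ι k) : (pderiv b f).totalDegree ≤ f.totalDegree := by
  classical
  conv_lhs => rw [f.as_sum, map_sum]
  refine totalDegree_finsetSum_le fun m hm => ?_
  rw [pderiv_monomial]
  refine (totalDegree_monomial_le _ _).trans (le_trans ?_ (le_totalDegree hm))
  exact Finsupp.degree_mono (tsub_le_self)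

theorem totalDegree_dd_le {k : Type*} [CommRing k] {ι : Type*} [Fintype ι] (v : ι → k)
    (f : MvPolynomial ι k) : (dd v f).totalDegree ≤ f.totalDegree := by
  rw [dd_apply]
  refine totalDegree_finsetSum_le fun b _ => (totalDegree_mul _ _).trans ?_
  rw [totalDegree_C, zero_add]
  exact totalDegree_pderiv_le b f

/-- restriction to an affine slice -/
noncomputable def slice {k : Type*} [CommRing k] {ι : Type*} {r : ℕ} (p : ι → k) (v : Fin r → ι → k) :
    MvPolynomial ι k →ₐ[k] MvPolynomial (Fin r) k :=
  aeval (fun b => C (p b) + ∑ j, C (v j b) * X j)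

theorem eval_slice {k : Type*} [CommRing k] {ι : Type*} {r : ℕ} (p : ι → k) (v : Fin r → ι → k)
    (x : Fin r → k) (f : MvPolynomial ι k) :
    eval x (slice p v f) = eval (p + ∑ j, x j • v j) f := by
  rw [slice, ← coe_aeval_eq_eval, ← coe_aeval_eq_eval]
  show (aeval x) _ = (aeval _) f
  rw [← AlgHom.comp_apply, comp_aeval]
  congr 2
  funext b
  simp [Finset.sum_apply, mul_comm]

theorem totalDegree_slice {k : Type*} [CommRing k] {ι : Type*} {r : ℕ} (p : ι → k)
    (v : Fin r → ι → k) (f : MvPolynomial ι k) : (slice p v f).totalDegree ≤ f.totalDegree := by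
  have := totalDegree_aeval_le (k := k) (S := k) (fun b => C (p b) + ∑ j, C (v j b) * X j) 1 (by
    intro b
    refine (totalDegree_add _ _).trans (max_le (by simp) ?_)
    refine totalDegree_finsetSum_le fun j _ => (totalDegree_mul _ _).trans ?_
    rw [totalDegree_C, zero_add]
    exact (totalDegree_monomial_le _ _).trans (by simp)) f
  rw [mul_one] at this
  exact this

theorem pderiv_slice {k : Type*} [CommRing k] {ι : Type*} [Fintype ι] {r : ℕ} (p : ι → k)
    (v : Fin r → ι → k) (f : MvPolynomial ι k) (j : Fin r) :
    pderiv j (slice p v f) = slice p v (dd (v j) f) := by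
  classical
  induction f using MvPolynomial.induction_on with
  | C a =>
    rw [show slice p v (C a) = C a from AlgHom.commutes _ a, pderiv_C, derivation_C, map_zero]
  | add f g hf hg => simp only [map_add, hf, hg]
  | mul_X f b hf =>
    rw [map_mul, pderiv_mul, hf, Derivation.leibniz, smul_eq_mul, smul_eq_mul, map_add, map_mul,
      map_mul]
    have h1 : slice p v (dd (v j) (X b)) = C (v j b) := by
      rw [dd, mkDerivation_X]; exact AlgHom.commutes _ _
    have h2 : pderiv j (slice p v (X b)) = C (v j b) := by
      simp [slice, pderiv_X, Pi.single_apply]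
    rw [h1, h2]
    ring

theorem slice_bound {k : Type*} [Field k] [Fintype k] {ι : Type*} [Fintype ι] {r : ℕ}
    (g : Fin r → MvPolynomial ι k) (v : Fin r → ι → k)
    (B : ℕ) (hB : ∀ i, (g i).totalDegree ≤ B)
    (Z : Finset (ι → k)) (hz : ∀ p ∈ Z, ∀ i, eval p (g i) = 0)
    (hJ : ∀ p ∈ Z, (Matrix.of fun i j => eval p (dd (v j) (g i))).det ≠ 0) :
    Z.card * Fintype.card k ^ r ≤ (r * B + 1) ^ r * Fintype.card k ^ Fintype.card ι := by
  classical
  have h1 : ∑ p : ι → k, (Finset.univ.filter fun x : Fin r → k => p + ∑ j, x j • v j ∈ Z).card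
      = Z.card * Fintype.card k ^ r := by
    simp only [Finset.card_filter]
    rw [Finset.sum_comm]
    have : ∀ x : Fin r → k, ∑ p : ι → k, (if p + ∑ j, x j • v j ∈ Z then 1 else 0) = Z.card := by
      intro x
      refine (Fintype.sum_equiv (Equiv.addRight (∑ j, x j • v j)) _ (fun p => if p ∈ Z then 1 else 0)
        (fun _ => rfl)).trans ?_
      simp
    rw [Finset.sum_congr rfl fun x _ => this x]
    simp [mul_comm]
  have h2 : ∀ p : ι → k, (Finset.univ.filter fun x : Fin r → k => p + ∑ j, x j • v j ∈ Z).card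
      ≤ (r * B + 1) ^ r := by
    intro p
    apply bezout (fun i => slice p v (g i)) B (fun i => (totalDegree_slice _ _ _).trans (hB i))
    · intro x hx i
      rw [eval_slice]
      exact hz _ (Finset.mem_filter.mp hx).2 i
    · intro x hx
      have := hJ _ (Finset.mem_filter.mp hx).2
      convert this using 3
      funext i
      funext j
      rw [pderiv_slice, eval_slice]
  rw [← h1]
  refine (Finset.sum_le_sum fun p _ => h2 p).trans ?_
  simp [mul_comm]

end HR

open MvPolynomial
namespace HR
set_option linter.unusedSectionVars false

section ops
variable {k : Type*} [CommRing k] {ι : Type*} [Fintype ι]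

noncomputable def Gm {r : ℕ} (g : Fin r → MvPolynomial ι k) (v : Fin r → ι → k) :
    Matrix (Fin r) (Fin r) (MvPolynomial ι k) := Matrix.of fun i j => dd (v j) (g i)

noncomputable def Yop {r : ℕ} (g : Fin r → MvPolynomial ι k) (v : Fin r → ι → k) (u : ι → k) :
    Derivation k (MvPolynomial ι k) (MvPolynomial ι k) :=
  (Gm g v).det • dd u - ∑ j, (∑ i, (Gm g v).adjugate j i * dd u (g i)) • dd (v j)

theorem Yop_apply {r : ℕ} (g : Fin r → MvPolynomial ι k) (v : Fin r → ι → k) (u : ι → k)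
    (h : MvPolynomial ι k) : Yop g v u h = (Gm g v).det * dd u h -
      ∑ j, (∑ i, (Gm g v).adjugate j i * dd u (g i)) * dd (v j) h := by
  rw [Yop, Derivation.sub_apply, derivation_sum_apply]
  rfl

theorem Yop_self {r : ℕ} (g : Fin r → MvPolynomial ι k) (v : Fin r → ι → k) (u : ι → k) (l : Fin r) :
    Yop g v u (g l) = 0 := by
  rw [Yop_apply]
  have h1 : ∑ j, (∑ i, (Gm g v).adjugate j i * dd u (g i)) * dd (v j) (g l) =
      ∑ i, (Gm g v * (Gm g v).adjugate) l i * dd u (g i) := by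
    simp only [Finset.sum_mul, Matrix.mul_apply]
    rw [Finset.sum_comm]
    refine Finset.sum_congr rfl fun i _ => Finset.sum_congr rfl fun j _ => ?_
    simp only [Gm, Matrix.of_apply]
    ring
  rw [h1, Matrix.mul_adjugate]
  simp [Matrix.one_apply]

theorem dd_add (u u' : ι → k) (h : MvPolynomial ι k) : dd (u + u') h = dd u h + dd u' h := by
  simp only [dd_apply, Pi.add_apply, map_add, add_mul, Finset.sum_add_distrib]

theorem dd_smul (a : k) (u : ι → k) (h : MvPolynomial ι k) : dd (a • u) h = C a * dd u h := by
  simp only [dd_apply, Pi.smul_apply, smul_eq_mul, map_mul, Finset.mul_sum, mul_assoc]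

theorem dd_single [DecidableEq ι] (b : ι) (h : MvPolynomial ι k) : dd (Pi.single b 1) h = pderiv b h := by
  rw [dd_apply, Finset.sum_eq_single b]
  · simp
  · intro c _ hc; simp [hc]
  · simp

theorem Yop_add {r : ℕ} (g : Fin r → MvPolynomial ι k) (v : Fin r → ι → k) (u u' : ι → k)
    (h : MvPolynomial ι k) : Yop g v (u + u') h = Yop g v u h + Yop g v u' h := by
  simp only [Yop_apply, dd_add, mul_add, add_mul, Finset.sum_add_distrib]
  ring

theorem Yop_smul {r : ℕ} (g : Fin r → MvPolynomial ι k) (v : Fin r → ι → k) (a : k) (u : ι → k)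
    (h : MvPolynomial ι k) : Yop g v (a • u) h = C a * Yop g v u h := by
  simp only [Yop_apply, dd_smul, mul_sub, Finset.mul_sum, Finset.sum_mul]
  refine congrArg₂ (fun x y => x - y) ?_ ?_
  · ring
  · refine Finset.sum_congr rfl fun i _ => Finset.sum_congr rfl fun j _ => ?_
    ring

theorem derivation_eq_sum (Y : Derivation k (MvPolynomial ι k) (MvPolynomial ι k))
    (h : MvPolynomial ι k) : Y h = ∑ b, Y (X b) * pderiv b h := by
  classical
  have : Y = ∑ b : ι, (Y (X b)) • (pderiv b : Derivation k (MvPolynomial ι k) (MvPolynomial ι k)) := by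
    apply MvPolynomial.derivation_ext
    intro i
    rw [derivation_sum_apply]
    simp [pderiv_X, Pi.single_apply]
  conv_lhs => rw [this, derivation_sum_apply]
  simp

theorem det_mul_derivation [DecidableEq ι] {r : ℕ} (g : Fin r → MvPolynomial ι k) (v : Fin r → ι → k)
    (Y : Derivation k (MvPolynomial ι k) (MvPolynomial ι k)) (hY : ∀ i, Y (g i) = 0)
    (h : MvPolynomial ι k) :
    (Gm g v).det * Y h = ∑ b, Y (X b) * Yop g v (Pi.single b 1) h := by
  have e1 : ∀ b, Y (X b) * Yop g v (Pi.single b 1) h = (Gm g v).det * (Y (X b) * pderiv b h) -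
      ∑ j, (∑ i, (Gm g v).adjugate j i * (Y (X b) * pderiv b (g i))) * dd (v j) h := by
    intro b
    rw [Yop_apply, mul_sub, Finset.mul_sum]
    simp only [dd_single, Finset.mul_sum, Finset.sum_mul]
    refine congrArg₂ (fun x y => x - y) ?_ ?_
    · ring
    · refine Finset.sum_congr rfl fun i _ => Finset.sum_congr rfl fun j _ => ?_
      ring
  rw [Finset.sum_congr rfl fun b _ => e1 b, Finset.sum_sub_distrib, ← Finset.mul_sum,
    ← derivation_eq_sum Y h, Finset.sum_comm]
  have e2 : ∀ j, ∑ b, (∑ i, (Gm g v).adjugate j i * (Y (X b) * pderiv b (g i))) * dd (v j) h = 0 := by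
    intro j
    rw [← Finset.sum_mul, Finset.sum_comm]
    simp only [← Finset.mul_sum]
    simp only [← derivation_eq_sum Y, hY, mul_zero, Finset.sum_const_zero, zero_mul]
  simp [e2]

theorem totalDegree_det_le {r : ℕ} (M : Matrix (Fin r) (Fin r) (MvPolynomial ι k)) (B : ℕ)
    (hM : ∀ i j, (M i j).totalDegree ≤ B) : M.det.totalDegree ≤ r * B := by
  rw [Matrix.det_apply]
  refine totalDegree_finsetSum_le fun s _ => ?_
  refine le_trans ?_ (?_ : (∏ i, M (s i) i).totalDegree ≤ r * B)
  · rw [Units.smul_def]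
    rcases Int.units_eq_one_or (Equiv.Perm.sign s) with h | h <;> rw [h] <;> simp
  · refine (totalDegree_finsetProd _ _).trans ?_
    refine (Finset.sum_le_sum fun i _ => hM _ _).trans ?_
    simp

theorem totalDegree_Yop_le {r : ℕ} (g : Fin r → MvPolynomial ι k) (v : Fin r → ι → k) (u : ι → k)
    (h : MvPolynomial ι k) (B : ℕ) (hB : ∀ i, (g i).totalDegree ≤ B) :
    (Yop g v u h).totalDegree ≤ h.totalDegree + (r + 1) * B := by
  have hG : ∀ i j, (Gm g v i j).totalDegree ≤ B := fun i j => (totalDegree_dd_le _ _).trans (hB i)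
  have hadj : ∀ i j, ((Gm g v).adjugate i j).totalDegree ≤ r * B := by
    intro i j
    rw [Matrix.adjugate_apply]
    refine totalDegree_det_le _ B fun i' j' => ?_
    rw [Matrix.updateRow_apply]
    split_ifs with h
    · rw [Pi.single_apply]
      split_ifs <;> simp
    · exact hG _ _
  rw [Yop_apply]
  refine (totalDegree_sub _ _).trans (max_le ?_ ?_)
  · refine (totalDegree_mul _ _).trans ?_
    have := totalDegree_det_le _ B hG
    have := totalDegree_dd_le u h
    nlinarith
  · refine totalDegree_finsetSum_le fun j _ => (totalDegree_mul _ _).trans ?_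
    have h1 : (∑ i, (Gm g v).adjugate j i * dd u (g i)).totalDegree ≤ r * B + B := by
      refine totalDegree_finsetSum_le fun i _ => (totalDegree_mul _ _).trans ?_
      exact add_le_add (hadj _ _) ((totalDegree_dd_le _ _).trans (hB i))
    have := totalDegree_dd_le (v j) h
    nlinarith

end ops

theorem det_append {k : Type*} [Field k] {ι : Type*} [Fintype ι] {r : ℕ}
    (g : Fin r → MvPolynomial ι k) (v : Fin r → ι → k) (h : MvPolynomial ι k) (w : ι → k) (p : ι → k)
    (h1 : eval p (Gm g v).det ≠ 0) (h2 : eval p (Yop g v w h) ≠ 0) :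
    eval p (Gm (Fin.append g fun _ : Fin 1 => h) (Fin.append v fun _ : Fin 1 => w)).det ≠ 0 := by
  set G := (eval p).mapMatrix (Gm g v) with hG
  have hdet : eval p (Gm g v).det = G.det := RingHom.map_det _ _
  rw [hdet] at h1
  rw [RingHom.map_det]
  rw [← Matrix.det_submatrix_equiv_self (finSumFinEquiv (m := r) (n := 1))]
  have hb : ((eval p).mapMatrix (Gm (Fin.append g fun _ : Fin 1 => h)
      (Fin.append v fun _ : Fin 1 => w))).submatrix (finSumFinEquiv (m := r) (n := 1)) finSumFinEquiv =
      Matrix.fromBlocks G (Matrix.of fun i _ => eval p (dd w (g i)))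
        (Matrix.of fun _ j => eval p (dd (v j) h)) (Matrix.of fun _ _ => eval p (dd w h)) := by
    ext i j
    rcases i with i | i <;> rcases j with j | j <;> 
      simp [Gm, hG, Fin.append_left, Fin.append_right]
  rw [hb]
  have : Invertible G := Matrix.invertibleOfIsUnitDet G h1.isUnit
  rw [Matrix.det_fromBlocks₁₁]
  refine mul_ne_zero h1 ?_
  rw [Matrix.det_unique, Matrix.invOf_eq_nonsing_inv, Matrix.inv_def]
  intro h3
  apply h2
  have h4 : ∀ i j, eval p ((Gm g v).adjugate i j) = G.adjugate i j := by
    intro i j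
    rw [hG, ← RingHom.map_adjugate]; rfl
  rw [Yop_apply, map_sub, map_mul, hdet, map_sum]
  have h5 : ∑ j, eval p ((∑ i, (Gm g v).adjugate j i * dd w (g i)) * dd (v j) h) = 
      ∑ j, (∑ i, G.adjugate j i * eval p (dd w (g i))) * eval p (dd (v j) h) := by
    refine Finset.sum_congr rfl fun j _ => ?_
    simp only [map_mul, map_sum, h4]
  rw [h5]
  simp only [Matrix.sub_apply, Matrix.of_apply, Matrix.mul_apply, Matrix.smul_apply, smul_eq_mul,
    Ring.inverse_eq_inv] at h3
  have h6 := congrArg (fun x => G.det * x) h3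
  simp only [mul_sub, mul_zero, Finset.mul_sum, Finset.sum_mul] at h6
  rw [← h6]
  congr 1
  rw [Finset.sum_comm]
  simp only [Finset.sum_mul]
  refine Finset.sum_congr rfl fun i _ => Finset.sum_congr rfl fun j _ => ?_
  field_simp

end HR

open MvPolynomial
namespace HR
set_option linter.unusedSectionVars false

section chain
variable {k A U : Type*} [CommRing k] [CommRing A] [Algebra k A]

def chain (X : U → Derivation k A A) (m : Ideal A) (S0 : Set A) : ℕ → Set A
  | 0 => S0
  | (i + 1) => {f | f ∈ m ∧ ∀ u, X u f ∈ chain X m S0 i}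

/-- closure properties -/
structure Good (m : Ideal A) (δ : A) (S : Set A) : Prop where
  add : ∀ f ∈ S, ∀ g ∈ S, f + g ∈ S
  mul : ∀ a, ∀ f ∈ S, a * f ∈ S
  cancel : ∀ f, δ * f ∈ S → f ∈ S

theorem chain_good (X : U → Derivation k A A) (m : Ideal A) (S0 : Set A) (δ : A)
    (hδ : ∀ f, δ * f ∈ m → f ∈ m) (h0 : Good m δ S0) (h1 : chain X m S0 1 ⊆ S0) (i : ℕ) :
    Good m δ (chain X m S0 i) ∧ chain X m S0 (i + 1) ⊆ chain X m S0 i := by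
  induction i with
  | zero => exact ⟨h0, h1⟩
  | succ i ih =>
    obtain ⟨hg, hs⟩ := ih
    refine ⟨⟨?_, ?_, ?_⟩, ?_⟩
    · intro f hf g hg'
      refine ⟨m.add_mem hf.1 hg'.1, fun u => ?_⟩
      rw [map_add]
      exact hg.add _ (hf.2 u) _ (hg'.2 u)
    · intro a f hf
      refine ⟨m.mul_mem_left a hf.1, fun u => ?_⟩
      rw [Derivation.leibniz, smul_eq_mul, smul_eq_mul, mul_comm f]
      exact hg.add _ (hg.mul _ _ (hf.2 u)) _ (hg.mul _ _ (hs hf))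
    · intro f hf
      have hf' := hg.cancel f (hs hf)
      refine ⟨hδ f hf.1, fun u => ?_⟩
      have h2 := hf.2 u
      rw [Derivation.leibniz, smul_eq_mul, smul_eq_mul] at h2
      apply hg.cancel
      have h3 := hg.add _ h2 _ (hg.mul (- X u δ) _ hf')
      have : δ * X u f + f * X u δ + - X u δ * f = δ * X u f := by ring
      rwa [this] at h3
    · intro f hf
      exact ⟨hf.1, fun u => hs (hf.2 u)⟩

theorem Good.sum {m : Ideal A} {δ : A} {S : Set A} (h : Good m δ S) {β : Type*} (s : Finset β)
    (f : β → A) (hf : ∀ b ∈ s, f b ∈ S) (hz : (0 : A) ∈ S) : ∑ b ∈ s, f b ∈ S := by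
  classical
  induction s using Finset.induction_on with
  | empty => simpa
  | insert a s ha ih =>
    rw [Finset.sum_insert ha]
    exact h.add _ (hf a (Finset.mem_insert_self _ _)) _
      (ih fun b hb => hf b (Finset.mem_insert_of_mem hb))

end chain

section phase
variable {k ι : Type*} [Field k] [Fintype ι]

theorem good_ideal {A : Type*} [CommRing A] (m : Ideal A) (δ : A) (hδ : ∀ f, δ * f ∈ m → f ∈ m) :
    Good m δ (m : Set A) :=
  ⟨fun _ hf _ hg => m.add_mem hf hg, fun a _ hf => m.mul_mem_left a hf, hδ⟩

/-- the phase lemma -/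
theorem phase {r r' : ℕ} (g : Fin r → MvPolynomial ι k) (v : Fin r → ι → k)
    (g' : Fin r' → MvPolynomial ι k) (v' : Fin r' → ι → k)
    (hgg : ∀ i, ∃ i', g' i' = g i) (m : Ideal (MvPolynomial ι k)) (hm : m.IsPrime)
    (hδ : (Gm g v).det ∉ m) (j : ℕ) :
    chain (Yop g v) m (chain (Yop g' v') m m 1) j ⊆ chain (Yop g' v') m m (j + 1) := by
  classical
  have hδ' : ∀ f, (Gm g v).det * f ∈ m → f ∈ m := fun f hf => (hm.mem_or_mem hf).resolve_left hδ
  have key : ∀ u h, (Gm g v).det * Yop g' v' u h =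
      ∑ b, Yop g' v' u (X b) * Yop g v (Pi.single b 1) h := by
    intro u h
    apply det_mul_derivation
    intro i
    obtain ⟨i', hi'⟩ := hgg i
    rw [← hi', Yop_self]
  have g0 : Good m (Gm g v).det (chain (Yop g' v') m m 1) := by
    refine ⟨?_, ?_, ?_⟩
    · intro f hf f' hf'
      refine ⟨m.add_mem hf.1 hf'.1, fun u => ?_⟩
      rw [map_add]
      exact m.add_mem (hf.2 u) (hf'.2 u)
    · intro a f hf
      refine ⟨m.mul_mem_left a hf.1, fun u => ?_⟩
      rw [Derivation.leibniz, smul_eq_mul, smul_eq_mul]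
      exact m.add_mem (m.mul_mem_left _ (hf.2 u)) (m.mul_mem_right _ hf.1)
    · intro f hf
      have h1 := hδ' f hf.1
      refine ⟨h1, fun u => hδ' _ ?_⟩
      have h2 : Yop g' v' u ((Gm g v).det * f) ∈ m := hf.2 u
      rw [Derivation.leibniz, smul_eq_mul, smul_eq_mul] at h2
      exact (m.add_mem_iff_left (m.mul_mem_right _ h1)).mp h2
  have g1 : chain (Yop g v) m (chain (Yop g' v') m m 1) 1 ⊆ chain (Yop g' v') m m 1 := by
    intro f hf
    refine ⟨hf.1, fun u => hδ' _ ?_⟩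
    rw [key]
    refine m.sum_mem fun b _ => m.mul_mem_left _ ?_
    exact (hf.2 (Pi.single b 1)).1
  have hgood := chain_good (Yop g v) m _ _ hδ' g0 g1
  have hz : ∀ i, (0 : MvPolynomial ι k) ∈ chain (Yop g v) m (chain (Yop g' v') m m 1) i := by
    intro i
    induction i with
    | zero => exact ⟨m.zero_mem, fun u => by rw [map_zero]; exact m.zero_mem⟩
    | succ i ih => exact ⟨m.zero_mem, fun u => by rw [map_zero]; exact ih⟩
  induction j with
  | zero => exact le_rfl
  | succ j ih =>
    intro f hf
    refine ⟨hf.1, fun u => ih ?_⟩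
    apply (hgood j).1.cancel
    rw [key]
    refine (hgood j).1.sum _ _ (fun b _ => (hgood j).1.mul _ _ (hf.2 _)) (hz j)

/-- span of operators applied to a space -/
noncomputable def nextS (X : (ι → k) → Derivation k (MvPolynomial ι k) (MvPolynomial ι k))
    (S : Submodule k (MvPolynomial ι k)) : Submodule k (MvPolynomial ι k) :=
  Submodule.span k (Set.range fun p : (ι → k) × S => X p.1 p.2)

theorem nextS_finite [Finite k] (X : (ι → k) → Derivation k (MvPolynomial ι k) (MvPolynomial ι k))
    (S : Submodule k (MvPolynomial ι k)) [Finite S] : Finite (nextS X S) := by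
  have : Module.Finite k (nextS X S) := by
    rw [Module.Finite.iff_fg]
    exact Submodule.fg_span (Set.finite_range _)
  exact Module.finite_of_finite k

theorem nextS_le (X : (ι → k) → Derivation k (MvPolynomial ι k) (MvPolynomial ι k))
    (S : Submodule k (MvPolynomial ι k)) (D B : ℕ) (hS : ∀ h ∈ S, h.totalDegree ≤ D)
    (hX : ∀ u h, (X u h).totalDegree ≤ h.totalDegree + B) :
    ∀ h ∈ nextS X S, h.totalDegree ≤ D + B := by
  intro h hh
  induction hh using Submodule.span_induction with
  | mem x hx =>
    obtain ⟨p, rfl⟩ := hx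
    exact (hX _ _).trans (Nat.add_le_add_right (hS _ p.2.2) _)
  | zero => simp
  | add x y _ _ hx hy => exact (totalDegree_add _ _).trans (max_le hx hy)
  | smul a x _ hx => exact (totalDegree_smul_le _ _).trans hx

theorem chain_of_iter (X : (ι → k) → Derivation k (MvPolynomial ι k) (MvPolynomial ι k))
    (m : Ideal (MvPolynomial ι k)) (S0 : Set (MvPolynomial ι k)) (j : ℕ) :
    ∀ S : Submodule k (MvPolynomial ι k), (S : Set _) ⊆ chain X m m j →
      (((nextS X)^[j] S : Submodule k (MvPolynomial ι k)) : Set _) ⊆ S0 →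
      (S : Set _) ⊆ chain X m S0 j := by
  induction j with
  | zero => exact fun S _ h => h
  | succ j ih =>
    intro S h1 h2 f hf
    refine ⟨(h1 hf).1, fun u => ?_⟩
    refine ih (nextS X S) ?_ h2 (Submodule.subset_span ⟨(u, ⟨f, hf⟩), rfl⟩)
    -- span inside chain
    intro h hh
    have hadd : ∀ i, ∀ x ∈ chain X m m i, ∀ y ∈ chain X m m i, x + y ∈ chain X m m i := by
      intro i
      induction i with
      | zero => exact fun x hx y hy => m.add_mem hx hy
      | succ i ih => exact fun x hx y hy => ⟨m.add_mem hx.1 hy.1, fun u => by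
          rw [map_add]; exact ih _ (hx.2 u) _ (hy.2 u)⟩
    have hsm : ∀ i, ∀ a : k, ∀ x ∈ chain X m m i, a • x ∈ chain X m m i := by
      intro i
      induction i with
      | zero => exact fun a x hx => by rw [smul_eq_C_mul]; exact m.mul_mem_left _ hx
      | succ i ih => exact fun a x hx => ⟨by rw [smul_eq_C_mul]; exact m.mul_mem_left _ hx.1, fun u => by
          rw [Derivation.map_smul]; exact ih _ _ (hx.2 u)⟩
    have hh' : h ∈ nextS X S := hh
    induction hh' using Submodule.span_induction with
    | mem x hx =>
      obtain ⟨p, rfl⟩ := hx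
      exact (h1 p.2.2).2 p.1
    | zero =>
      have := hsm j 0 _ ((h1 hf).2 u)
      rwa [zero_smul] at this
    | add x y hx' hy' hx hy => exact hadd _ _ (hx hx') _ (hy hy')
    | smul a x hx' hx => exact hsm _ _ _ (hx hx')

/-- the iterates vanish -/
theorem iter_subset_of_chain (X : (ι → k) → Derivation k (MvPolynomial ι k) (MvPolynomial ι k))
    (m : Ideal (MvPolynomial ι k)) (j : ℕ) :
    ∀ S : Submodule k (MvPolynomial ι k), (S : Set _) ⊆ chain X m m j →
      (((nextS X)^[j] S : Submodule k (MvPolynomial ι k)) : Set _) ⊆ (m : Set (MvPolynomial ι k)) := by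
  induction j with
  | zero => exact fun S h => h
  | succ j ih =>
    intro S h1
    refine ih (nextS X S) ?_
    intro h hh
    have hadd : ∀ i, ∀ x ∈ chain X m m i, ∀ y ∈ chain X m m i, x + y ∈ chain X m m i := by
      intro i
      induction i with
      | zero => exact fun x hx y hy => m.add_mem hx hy
      | succ i ih => exact fun x hx y hy => ⟨m.add_mem hx.1 hy.1, fun u => by
          rw [map_add]; exact ih _ (hx.2 u) _ (hy.2 u)⟩
    have hsm : ∀ i, ∀ a : k, ∀ x ∈ chain X m m i, a • x ∈ chain X m m i := by
      intro i
      induction i with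
      | zero => exact fun a x hx => by rw [smul_eq_C_mul]; exact m.mul_mem_left _ hx
      | succ i ih => exact fun a x hx => ⟨by rw [smul_eq_C_mul]; exact m.mul_mem_left _ hx.1, fun u => by
          rw [Derivation.map_smul]; exact ih _ _ (hx.2 u)⟩
    have hh' : h ∈ nextS X S := hh
    induction hh' using Submodule.span_induction with
    | mem x hx =>
      obtain ⟨p, rfl⟩ := hx
      exact (h1 p.2.2).2 p.1
    | zero =>
      have := hsm j 0 _ ((h1 S.zero_mem).2 0)
      rwa [zero_smul] at this
    | add x y hx' hy' hx hy => exact hadd _ _ (hx hx') _ (hy hy')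
    | smul a x hx' hx => exact hsm _ _ _ (hx hx')

end phase
end HR

open MvPolynomial
namespace HR

/-- selection lemma -/
theorem select {k : Type*} [Field k] [Finite k] {M : Type*} [AddCommGroup M] [Module k M] [Finite M]
    {β : Type*} (Z : Finset β) (φ : β → M → k) (hadd : ∀ p ∈ Z, ∀ x y, φ p (x + y) = φ p x + φ p y)
    (hne : ∀ p ∈ Z, ∃ x, φ p x ≠ 0) :
    ∃ x, ∃ Z' ⊆ Z, (∀ p ∈ Z', φ p x ≠ 0) ∧ Z.card ≤ 2 * Z'.card := by
  classical
  have := Fintype.ofFinite M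
  by_contra hcon
  push Not at hcon
  have h1 : ∀ x : M, 2 * (Z.filter fun p => φ p x ≠ 0).card < Z.card := fun x =>
    hcon x _ (Finset.filter_subset _ _) (fun p hp => (Finset.mem_filter.mp hp).2)
  have h2 : ∀ p ∈ Z, Fintype.card M ≤ 2 * (Finset.univ.filter fun x : M => φ p x ≠ 0).card := by
    intro p hp
    obtain ⟨x0, hx0⟩ := hne p hp
    have h3 : (Finset.univ.filter fun x : M => ¬ (φ p x ≠ 0)).card ≤
        (Finset.univ.filter fun x : M => φ p x ≠ 0).card := by
      refine Finset.card_le_card_of_injOn (fun x => x + x0) ?_ ?_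
      · intro x hx
        simp only [Finset.coe_filter, Finset.mem_univ, true_and, Set.mem_ofPred_eq, not_not] at hx ⊢
        rw [hadd p hp, hx, zero_add]; exact hx0
      · intro x _ y _ hxy
        exact add_right_cancel hxy
    have h4 := Finset.card_filter_add_card_filter_not (s := (Finset.univ : Finset M)) (fun x : M => φ p x ≠ 0)
    rw [Finset.card_univ] at h4
    omega
  have h5 : ∑ x : M, (Z.filter fun p => φ p x ≠ 0).card =
      ∑ p ∈ Z, (Finset.univ.filter fun x : M => φ p x ≠ 0).card := by
    simp only [Finset.card_filter]
    rw [Finset.sum_comm]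
  have h6 : ∑ x : M, 2 * (Z.filter fun p => φ p x ≠ 0).card < ∑ x : M, Z.card :=
    Finset.sum_lt_sum_of_nonempty ⟨0, Finset.mem_univ _⟩ fun x _ => h1 x
  have h7 : ∑ p ∈ Z, Fintype.card M ≤ ∑ p ∈ Z, 2 * (Finset.univ.filter fun x : M => φ p x ≠ 0).card :=
    Finset.sum_le_sum h2
  rw [← Finset.mul_sum, h5] at h6
  rw [← Finset.mul_sum] at h7
  simp only [Finset.sum_const, smul_eq_mul, Finset.card_univ] at h6 h7
  rw [mul_comm] at h7
  omega

section ext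
variable {k ι : Type*} [Field k] [Fintype k] [Fintype ι]

structure Inv {r : ℕ} (Z Z' : Finset (ι → k)) (B N : ℕ) (g : Fin r → MvPolynomial ι k)
    (v : Fin r → ι → k) : Prop where
  sub : Z' ⊆ Z
  card : N ≤ Z'.card * 8 ^ r
  zero : ∀ p ∈ Z', ∀ i, eval p (g i) = 0
  det : ∀ p ∈ Z', eval p (Gm g v).det ≠ 0
  deg : ∀ i, (g i).totalDegree ≤ B

theorem extend (Z : Finset (ι → k)) (B N R : ℕ) (W : Submodule k (MvPolynomial ι k)) [Finite W]
    (hW : ∀ h ∈ W, h.totalDegree ≤ B) (hWZ : ∀ p ∈ Z, ∀ h ∈ W, eval p h = 0)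
    (hR : ∀ (Z' : Finset (ι → k)) (g : Fin (R + 1) → MvPolynomial ι k) (v : Fin (R + 1) → ι → k),
      ¬ Inv Z Z' B N g v)
    (t : ℕ) : ∀ (r : ℕ) (_ : r + t = R) (Z1 : Finset (ι → k)) (g1 : Fin r → MvPolynomial ι k)
      (v1 : Fin r → ι → k), Inv Z Z1 B N g1 v1 →
    ∃ (r' : ℕ) (_ : r' ≤ R) (Z' : Finset (ι → k)) (g : Fin r' → MvPolynomial ι k)
      (v : Fin r' → ι → k), Inv Z Z' B (N) g v ∧ (∀ i, ∃ i', g i' = g1 i) ∧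
      ∃ Z'' ⊆ Z', Z'.card ≤ 2 * Z''.card ∧ ∀ p ∈ Z'', ∀ h ∈ W, ∀ u, eval p (Yop g v u h) = 0 := by
  classical
  -- either we finish, or we extend
  have step : ∀ (r : ℕ) (Z1 : Finset (ι → k)) (g1 : Fin r → MvPolynomial ι k)
      (v1 : Fin r → ι → k), Inv Z Z1 B N g1 v1 →
      (∃ Z'' ⊆ Z1, Z1.card ≤ 2 * Z''.card ∧ ∀ p ∈ Z'', ∀ h ∈ W, ∀ u, eval p (Yop g1 v1 u h) = 0) ∨
      (∃ (Z2 : Finset (ι → k)) (h : MvPolynomial ι k) (w : ι → k),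
        Inv Z Z2 B N (Fin.append g1 fun _ : Fin 1 => h) (Fin.append v1 fun _ : Fin 1 => w)) := by
    intro r Z1 g1 v1 hI
    by_cases hc : Z1.card ≤ 2 * (Z1.filter fun p => ∀ h ∈ W, ∀ u, eval p (Yop g1 v1 u h) = 0).card
    · left
      exact ⟨_, Finset.filter_subset _ _, hc, fun p hp => (Finset.mem_filter.mp hp).2⟩
    · right
      have h4 := Finset.card_filter_add_card_filter_not (s := Z1)
        (fun p => ∀ h ∈ W, ∀ u, eval p (Yop g1 v1 u h) = 0)
      set Za := Z1.filter fun p => ¬ ∀ h ∈ W, ∀ u, eval p (Yop g1 v1 u h) = 0 with hZa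
      have hc2 : Z1.card ≤ 2 * Za.card := by omega
      have hex : ∀ p ∈ Za, ∃ u, ∃ h ∈ W, eval p (Yop g1 v1 u h) ≠ 0 := by
        intro p hp
        have := (Finset.mem_filter.mp hp).2
        push Not at this
        obtain ⟨h, hh, u, hu⟩ := this
        exact ⟨u, h, hh, hu⟩
      choose! up hup using hex
      obtain ⟨h, Zb, hZb, hb1, hb2⟩ := select (k := k) (M := W) Za
        (fun p h => eval p (Yop g1 v1 (up p) (h : MvPolynomial ι k)))
        (fun p _ x y => by simp) (fun p hp => by
          obtain ⟨h, hh, h'⟩ := hup p hp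
          exact ⟨⟨h, hh⟩, h'⟩)
      obtain ⟨w, Zc, hZc, hc1, hc2'⟩ := select (k := k) (M := ι → k) Zb
        (fun p u => eval p (Yop g1 v1 u (h : MvPolynomial ι k)))
        (fun p _ x y => by rw [Yop_add, map_add]) (fun p hp => ⟨up p, hb1 p hp⟩)
      have hsub : Zc ⊆ Z1 := hZc.trans (hZb.trans (Finset.filter_subset _ _))
      refine ⟨Zc, h, w, ⟨hsub.trans hI.sub, ?_, ?_, ?_, ?_⟩⟩
      · refine hI.card.trans ?_
        rw [pow_succ]
        have : Z1.card ≤ Zc.card * 8 := by omega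
        calc Z1.card * 8 ^ r ≤ (Zc.card * 8) * 8 ^ r := Nat.mul_le_mul_right _ this
          _ = _ := by ring
      · intro p hp i
        refine Fin.addCases (fun i => ?_) (fun i => ?_) i
        · rw [Fin.append_left]; exact hI.zero p (hsub hp) i
        · rw [Fin.append_right]; exact hWZ p (hI.sub (hsub hp)) h h.2
      · intro p hp
        exact det_append g1 v1 h w p (hI.det p (hsub hp)) (hc1 p hp)
      · intro i
        refine Fin.addCases (fun i => ?_) (fun i => ?_) i
        · rw [Fin.append_left]; exact hI.deg i
        · rw [Fin.append_right]; exact hW h h.2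
  induction t with
  | zero =>
    intro r hr Z1 g1 v1 hI
    rw [add_zero] at hr
    subst hr
    rcases step r Z1 g1 v1 hI with h | ⟨Z2, h, w, hI2⟩
    · exact ⟨r, le_rfl, Z1, g1, v1, hI, fun i => ⟨i, rfl⟩, h⟩
    · exact absurd hI2 (hR _ _ _)
  | succ t ih =>
    intro r hr Z1 g1 v1 hI
    rcases step r Z1 g1 v1 hI with h | ⟨Z2, h, w, hI2⟩
    · exact ⟨r, by omega, Z1, g1, v1, hI, fun i => ⟨i, rfl⟩, h⟩
    · obtain ⟨r', hr', Z', g, v, h1, h2, h3⟩ := ih (r + 1) (by omega) Z2 _ _ hI2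
      refine ⟨r', hr', Z', g, v, h1, fun i => ?_, h3⟩
      obtain ⟨i', hi'⟩ := h2 (Fin.castAdd 1 i)
      exact ⟨i', by rw [hi', Fin.append_left]⟩

end ext
end HR

open MvPolynomial
namespace HR

def BB (m D R j : ℕ) : ℕ := (D + 1) * ((m + 1) * (R + 2)) ^ j
def MM (m D s : ℕ) : ℕ := 8 ^ (m + 1) * ((2 * s + 1) * BB m D (2 * s) m + 1)

theorem BB_succ (m D R j : ℕ) (hj : j ≤ m) : D + j * ((R + 1) * BB m D R j) ≤ BB m D R (j + 1) := by
  unfold BB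
  rw [pow_succ]
  set c := (m + 1) * (R + 2)
  have hc : 1 ≤ c ^ j := Nat.one_le_pow _ _ (by positivity)
  have h1 : D ≤ (D + 1) * c ^ j := by nlinarith
  have h2 : j * ((R + 1) * ((D + 1) * c ^ j)) ≤ (m * (R + 1)) * ((D + 1) * c ^ j) := by
    calc j * ((R + 1) * ((D + 1) * c ^ j)) ≤ m * ((R + 1) * ((D + 1) * c ^ j)) := Nat.mul_le_mul_right _ hj
      _ = _ := by ring
  have h3 : 1 + m * (R + 1) ≤ c := by simp only [c]; nlinarith
  calc D + j * ((R + 1) * ((D + 1) * c ^ j)) ≤ (1 + m * (R + 1)) * ((D + 1) * c ^ j) := by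
        exact (add_le_add h1 h2).trans (le_of_eq (by ring))
    _ ≤ c * ((D + 1) * c ^ j) := Nat.mul_le_mul_right _ h3
    _ = _ := by ring

theorem BB_mono (m D R : ℕ) {j j' : ℕ} (h : j ≤ j') : BB m D R j ≤ BB m D R j' := by
  unfold BB
  exact Nat.mul_le_mul_left _ (Nat.pow_le_pow_right (by positivity) h)

theorem iter_nextS {k ι : Type*} [Field k] [Fintype k] [Fintype ι]
    (X : (ι → k) → Derivation k (MvPolynomial ι k) (MvPolynomial ι k)) (B : ℕ)
    (hX : ∀ u h, (X u h).totalDegree ≤ h.totalDegree + B) (j : ℕ) :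
    ∀ (D : ℕ) (S : Submodule k (MvPolynomial ι k)), Finite S → (∀ h ∈ S, h.totalDegree ≤ D) →
      Finite ((nextS X)^[j] S : Submodule k (MvPolynomial ι k)) ∧
      ∀ h ∈ ((nextS X)^[j] S : Submodule k (MvPolynomial ι k)), h.totalDegree ≤ D + j * B := by
  induction j with
  | zero => intro D S hf hS; exact ⟨hf, by simpa using hS⟩
  | succ j ih =>
    intro D S hf hS
    have := ih (D + B) (nextS X S) (nextS_finite X S) (nextS_le X S D B hS hX)
    refine ⟨this.1, fun h hh => (this.2 h hh).trans (le_of_eq (by ring))⟩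

theorem phases {k ι : Type*} [Field k] [Fintype k] [Fintype ι] (m D s : ℕ)
    (F : Submodule k (MvPolynomial ι k)) (hFf : Finite F) (hFD : ∀ h ∈ F, h.totalDegree ≤ D)
    (Z : Finset (ι → k)) (hFZ : ∀ p ∈ Z, ∀ h ∈ F, eval p h = 0)
    (hZ : Fintype.card k ^ Fintype.card ι ≤ Z.card * Fintype.card k ^ s)
    (hq : MM m D s ^ 2 ≤ Fintype.card k) :
    ∃ (r : ℕ) (_ : r ≤ 2 * s) (g : Fin r → MvPolynomial ι k) (v : Fin r → ι → k) (p : ι → k),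
      eval p (Gm g v).det ≠ 0 ∧
      (F : Set (MvPolynomial ι k)) ⊆ chain (Yop g v) (RingHom.ker (eval p)) (RingHom.ker (eval p)) m := by
  classical
  set q := Fintype.card k with hqd
  have hqpos : 0 < q := Fintype.card_pos
  have hM2 : 2 ≤ MM m D s := by
    unfold MM
    calc 2 ≤ 8 ^ 1 * 1 := by norm_num
      _ ≤ _ := Nat.mul_le_mul (Nat.pow_le_pow_right (by norm_num) (by omega)) (by omega)
  -- the bound on the number of functions
  have key : ∀ j, j ≤ m → ∀ (Z1 Z' : Finset (ι → k)) (N : ℕ), Z.card ≤ N * 2 ^ j →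
      ∀ (g : Fin (2 * s + 1) → MvPolynomial ι k) (v : Fin (2 * s + 1) → ι → k),
      ¬ Inv Z1 Z' (BB m D (2 * s) m) N g v := by
    intro j hj Z1 Z' N hN g v hI
    have h1 := slice_bound g v _ hI.deg Z' hI.zero (by
      intro p hp
      have := hI.det p hp
      rwa [RingHom.map_det] at this)
    set T := (2 * s + 1) * BB m D (2 * s) m + 1 with hT
    have hMT : MM m D s = 8 ^ (m + 1) * T := rfl
    have h2 : q ^ Fintype.card ι * q ^ (2 * s + 1) ≤
        q ^ Fintype.card ι * (2 ^ j * (8 * T) ^ (2 * s + 1) * q ^ s) := by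
      calc q ^ Fintype.card ι * q ^ (2 * s + 1) ≤ (Z.card * q ^ s) * q ^ (2 * s + 1) :=
            Nat.mul_le_mul_right _ hZ
        _ ≤ ((Z'.card * 8 ^ (2 * s + 1)) * 2 ^ j * q ^ s) * q ^ (2 * s + 1) := by
            gcongr
            exact hN.trans (Nat.mul_le_mul_right _ hI.card)
        _ = (Z'.card * q ^ (2 * s + 1)) * (8 ^ (2 * s + 1) * 2 ^ j * q ^ s) := by ring
        _ ≤ (T ^ (2 * s + 1) * q ^ Fintype.card ι) * (8 ^ (2 * s + 1) * 2 ^ j * q ^ s) :=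
            Nat.mul_le_mul_right _ h1
        _ = _ := by rw [mul_pow]; ring
    have h3 := Nat.le_of_mul_le_mul_left h2 (by positivity)
    have h4 : 2 ^ j * (8 * T) ^ (2 * s + 1) ≤ MM m D s ^ (2 * s + 1) := by
      rw [hMT, show 8 ^ (m + 1) * T = 8 ^ m * (8 * T) by ring, mul_pow (8 ^ m)]
      refine Nat.mul_le_mul_right _ ?_
      calc 2 ^ j ≤ 2 ^ m := Nat.pow_le_pow_right (by norm_num) hj
        _ ≤ 8 ^ m := Nat.pow_le_pow_left (by norm_num) _
        _ = (8 ^ m) ^ 1 := (pow_one _).symm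
        _ ≤ (8 ^ m) ^ (2 * s + 1) := Nat.pow_le_pow_right (by positivity) (by omega)
    have h5 : q ^ (2 * s + 1) = q ^ (s + 1) * q ^ s := by rw [← pow_add]; congr 1; omega
    rw [h5] at h3
    have h6 := Nat.le_of_mul_le_mul_right h3 (by positivity)
    have h7 : MM m D s ^ (2 * s + 1) < q ^ (s + 1) := by
      calc MM m D s ^ (2 * s + 1) < MM m D s ^ (2 * s + 2) := Nat.pow_lt_pow_right hM2 (by omega)
        _ = (MM m D s ^ 2) ^ (s + 1) := by rw [← pow_mul]; congr 1
        _ ≤ q ^ (s + 1) := Nat.pow_le_pow_left hq _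
    omega
  have main : ∀ j, j ≤ m → ∃ (r : ℕ) (_ : r ≤ 2 * s) (g : Fin r → MvPolynomial ι k)
      (v : Fin r → ι → k) (Zj : Finset (ι → k)) (N : ℕ), Z.card ≤ N * 2 ^ j ∧
      Inv Z Zj (BB m D (2 * s) j) N g v ∧ ∀ p ∈ Zj, 
      (F : Set (MvPolynomial ι k)) ⊆ chain (Yop g v) (RingHom.ker (eval p)) (RingHom.ker (eval p)) j := by
    intro j
    induction j with
    | zero =>
      intro _
      refine ⟨0, Nat.zero_le _, Fin.elim0, Fin.elim0, Z, Z.card, by simp, ⟨le_rfl, by simp, ?_, ?_, ?_⟩, ?_⟩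
      · intro p _ i; exact i.elim0
      · intro p _; simp
      · intro i; exact i.elim0
      · intro p hp h hh
        exact hFZ p hp h hh
    | succ j ih =>
      intro hj
      obtain ⟨r, hr, g, v, Zj, N, hN, hI, hch⟩ := ih (by omega)
      have hdeg : ∀ u h, (Yop g v u h).totalDegree ≤ h.totalDegree + (2 * s + 1) * BB m D (2 * s) j := by
        intro u h
        refine (totalDegree_Yop_le g v u h _ hI.deg).trans ?_
        gcongr
      obtain ⟨hfin, hWd⟩ := iter_nextS (Yop g v) _ hdeg j D F hFf hFD
      have hWd' : ∀ h ∈ ((nextS (Yop g v))^[j] F : Submodule k (MvPolynomial ι k)),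
          h.totalDegree ≤ BB m D (2 * s) (j + 1) := fun h hh =>
        (hWd h hh).trans (BB_succ m D (2 * s) j (by omega))
      have hI' : Inv Zj Zj (BB m D (2 * s) (j + 1)) N g v :=
        ⟨le_rfl, hI.card, hI.zero, hI.det, fun i => (hI.deg i).trans (BB_mono _ _ _ (by omega))⟩
      have hvan : ∀ p ∈ Zj, ∀ h ∈ ((nextS (Yop g v))^[j] F : Submodule k (MvPolynomial ι k)),
          eval p h = 0 := fun p hp h hh =>
        iter_subset_of_chain (Yop g v) (RingHom.ker (eval p)) j F (hch p hp) hh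
      obtain ⟨r', hr', Z', g', v', hI2, hgg, Z'', hZ'', hc, hY⟩ := extend Zj (BB m D (2 * s) (j + 1)) N
        (2 * s) _ hWd' hvan (fun Z' g v hI3 => key j (by omega) Zj Z' N hN g v
          ⟨hI3.sub, hI3.card, hI3.zero, hI3.det, fun i => (hI3.deg i).trans (BB_mono _ _ _ hj)⟩)
        (2 * s - r) r (by omega) Zj g v hI'
      refine ⟨r', hr', g', v', Z'', Z''.card * 8 ^ r', ?_, ?_, ?_⟩
      · refine hN.trans ?_
        calc N * 2 ^ j ≤ (Z'.card * 8 ^ r') * 2 ^ j := Nat.mul_le_mul_right _ hI2.card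
          _ ≤ (2 * Z''.card * 8 ^ r') * 2 ^ j := by gcongr
          _ = _ := by ring
      · exact ⟨hZ''.trans (hI2.sub.trans hI.sub), le_rfl, fun p hp => hI2.zero p (hZ'' hp),
          fun p hp => hI2.det p (hZ'' hp), hI2.deg⟩
      · intro p hp
        have hpj : p ∈ Zj := hI2.sub (hZ'' hp)
        refine Set.Subset.trans ?_ (phase g v g' v' hgg (RingHom.ker (eval p)) (RingHom.ker_isPrime _)
          (hI.det p hpj) j)
        refine chain_of_iter (Yop g v) _ _ j F (hch p hpj) ?_
        intro h hh
        exact ⟨hvan p hpj h hh, fun u => hY p hp h hh u⟩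
  obtain ⟨r, hr, g, v, Zm, N, hN, hI, hch⟩ := main m le_rfl
  have hne : Zm.Nonempty := by
    rw [Finset.nonempty_iff_ne_empty]
    rintro rfl
    have h1 := hI.card
    simp only [Finset.card_empty, zero_mul, Nat.le_zero] at h1
    rw [h1, zero_mul, Nat.le_zero] at hN
    rw [hN, zero_mul, Nat.le_zero] at hZ
    exact absurd hZ (by positivity)
  obtain ⟨p, hp⟩ := hne
  exact ⟨r, hr, g, v, p, hI.det p hp, hch p hp⟩

end HR

open MvPolynomial
namespace HR
set_option linter.unusedSectionVars false

/-- `f` is a sum of `L` products of two elements with property `P`. -/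
def Rk {A : Type*} [CommRing A] (P : A → Prop) (L : ℕ) (f : A) : Prop :=
  ∃ a b : Fin L → A, (∀ i, P (a i)) ∧ (∀ i, P (b i)) ∧ f = ∑ i, a i * b i

section rk
variable {A : Type*} [CommRing A] {P : A → Prop}

theorem Rk.add {L L' : ℕ} {f f' : A} (h : Rk P L f) (h' : Rk P L' f') : Rk P (L + L') (f + f') := by
  obtain ⟨a, b, ha, hb, rfl⟩ := h
  obtain ⟨a', b', ha', hb', rfl⟩ := h'
  refine ⟨Fin.append a a', Fin.append b b', ?_, ?_, ?_⟩
  · intro i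
    refine Fin.addCases (fun i => ?_) (fun i => ?_) i
    · rw [Fin.append_left]; exact ha i
    · rw [Fin.append_right]; exact ha' i
  · intro i
    refine Fin.addCases (fun i => ?_) (fun i => ?_) i
    · rw [Fin.append_left]; exact hb i
    · rw [Fin.append_right]; exact hb' i
  · rw [Fin.sum_univ_add]
    simp only [Fin.append_left, Fin.append_right]

theorem Rk.zero : Rk P 0 (0 : A) := ⟨Fin.elim0, Fin.elim0, fun i => i.elim0, fun i => i.elim0, by simp⟩

theorem Rk.mul {a b : A} (ha : P a) (hb : P b) : Rk P 1 (a * b) :=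
  ⟨fun _ => a, fun _ => b, fun _ => ha, fun _ => hb, by simp⟩

theorem Rk.sum {β : Type*} (s : Finset β) (L : ℕ) (f : β → A) (h : ∀ b ∈ s, Rk P L (f b)) :
    Rk P (s.card * L) (∑ b ∈ s, f b) := by
  classical
  induction s using Finset.induction_on with
  | empty => simpa using Rk.zero
  | insert a s ha ih =>
    rw [Finset.sum_insert ha, Finset.card_insert_of_notMem ha, add_mul, one_mul, add_comm (s.card * L)]
    exact (h a (Finset.mem_insert_self _ _)).add (ih fun b hb => h b (Finset.mem_insert_of_mem hb))

theorem Rk.mono {L L' : ℕ} {f : A} (h : Rk P L f) (hL : L ≤ L') (h0 : P 0) : Rk P L' f := by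
  have h1 : Rk P (L' - L) (0 : A) := ⟨fun _ => 0, fun _ => 0, fun _ => h0, fun _ => h0, by simp⟩
  have := h.add h1
  rwa [add_zero, Nat.add_sub_cancel' hL] at this

theorem Rk.imp {Q : A → Prop} {L : ℕ} {f : A} (h : Rk P L f) (hPQ : ∀ a, P a → Q a) : Rk Q L f := by
  obtain ⟨a, b, ha, hb, rfl⟩ := h
  exact ⟨a, b, fun i => hPQ _ (ha i), fun i => hPQ _ (hb i), rfl⟩

end rk

/-- coefficientwise degree bound -/
def RD {k ι σ : Type*} [CommRing k] (t : ℕ) (f : MvPolynomial ι (MvPolynomial σ k)) : Prop :=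
  ∀ s, (coeff s f).totalDegree ≤ t

section rd
variable {k ι σ : Type*} [CommRing k]

theorem RD.mono {t t' : ℕ} {f : MvPolynomial ι (MvPolynomial σ k)} (h : RD t f) (ht : t ≤ t') : RD t' f :=
  fun s => (h s).trans ht

theorem RD.add {t : ℕ} {f g : MvPolynomial ι (MvPolynomial σ k)} (h : RD t f) (h' : RD t g) :
    RD t (f + g) := fun s => by
  rw [coeff_add]
  exact (totalDegree_add _ _).trans (max_le (h s) (h' s))

theorem RD.sub {t : ℕ} {f g : MvPolynomial ι (MvPolynomial σ k)} (h : RD t f) (h' : RD t g) :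
    RD t (f - g) := fun s => by
  rw [coeff_sub]
  exact (totalDegree_sub _ _).trans (max_le (h s) (h' s))

theorem RD.sum {t : ℕ} {β : Type*} (s : Finset β) {f : β → MvPolynomial ι (MvPolynomial σ k)}
    (h : ∀ b ∈ s, RD t (f b)) : RD t (∑ b ∈ s, f b) := fun m => by
  rw [coeff_sum]
  exact totalDegree_finsetSum_le fun b hb => h b hb m

theorem RD.mul {t t' : ℕ} {f g : MvPolynomial ι (MvPolynomial σ k)} (h : RD t f) (h' : RD t' g) :
    RD (t + t') (f * g) := fun s => by
  classical
  rw [coeff_mul]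
  refine totalDegree_finsetSum_le fun b hb => ?_
  exact (totalDegree_mul _ _).trans (add_le_add (h _) (h' _))

theorem RD.map (f : MvPolynomial ι k) : RD 0 (MvPolynomial.map (C : k →+* MvPolynomial σ k) f) := fun s => by
  rw [coeff_map, totalDegree_C]

theorem RD.C {t : ℕ} {a : MvPolynomial σ k} (h : a.totalDegree ≤ t) :
    RD t (C a : MvPolynomial ι (MvPolynomial σ k)) := fun s => by
  classical
  rw [coeff_C]
  split_ifs
  · exact h
  · simp

theorem RD.X (i : ι) : RD 0 (MvPolynomial.X i : MvPolynomial ι (MvPolynomial σ k)) := by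
  have := RD.map (σ := σ) (MvPolynomial.X i : MvPolynomial ι k)
  rwa [map_X] at this

theorem RD.pderiv {t : ℕ} {f : MvPolynomial ι (MvPolynomial σ k)} (h : RD t f) (b : ι) :
    RD t (pderiv b f) := by
  classical
  rw [f.as_sum, map_sum]
  refine RD.sum _ fun m _ => ?_
  rw [pderiv_monomial]
  intro s
  rw [coeff_monomial]
  split_ifs
  · have h2 : ((m b : ℕ) : MvPolynomial σ k) = MvPolynomial.C ((m b : ℕ) : k) := by simp
    rw [h2]
    refine (totalDegree_mul _ _).trans ?_
    rw [totalDegree_C, add_zero]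
    exact h m
  · simp

theorem RD.dd [Fintype ι] {t d : ℕ} {f : MvPolynomial ι (MvPolynomial σ k)} (h : RD t f)
    (u : ι → MvPolynomial σ k) (hu : ∀ b, (u b).totalDegree ≤ d) : RD (t + d) (dd u f) := by
  rw [dd_apply]
  refine RD.sum _ fun b _ => ?_
  rw [mul_comm]
  exact RD.mul (h.pderiv b) (RD.C (hu b))

theorem RD.eval {t : ℕ} {f : MvPolynomial ι (MvPolynomial σ k)} (h : RD t f) (p : ι → k) :
    (eval (fun b => (MvPolynomial.C (p b) : MvPolynomial σ k)) f).totalDegree ≤ t := by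
  rw [eval_eq]
  refine totalDegree_finsetSum_le fun m _ => ?_
  refine (totalDegree_mul _ _).trans ?_
  have : (∏ i ∈ m.support, (MvPolynomial.C (p i) : MvPolynomial σ k) ^ m i) =
      MvPolynomial.C (∏ i ∈ m.support, p i ^ m i) := by simp
  rw [this, totalDegree_C, add_zero]
  exact h m

end rd

section transfer
variable {k ι σ : Type*} [CommRing k] [Fintype ι] [DecidableEq ι]

theorem map_pderiv' (f : MvPolynomial ι k) (b : ι) :
    pderiv b (MvPolynomial.map (C : k →+* MvPolynomial σ k) f) = MvPolynomial.map C (pderiv b f) :=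
  pderiv_map

theorem dd_map (v : ι → k) (f : MvPolynomial ι k) :
    dd (fun b => (C (v b) : MvPolynomial σ k)) (MvPolynomial.map C f) = MvPolynomial.map C (dd v f) := by
  simp only [dd_apply, map_sum, map_mul, map_C, map_pderiv']

theorem dd_map_gen (u : ι → MvPolynomial σ k) (f : MvPolynomial ι k) :
    dd u (MvPolynomial.map C f) = ∑ b, C (u b) * MvPolynomial.map C (dd (Pi.single b 1) f) := by
  simp only [dd_apply u, map_pderiv', dd_single]

variable {r : ℕ} (g : Fin r → MvPolynomial ι k) (v : Fin r → ι → k)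

noncomputable def gR (σ : Type*) : Fin r → MvPolynomial ι (MvPolynomial σ k) := fun i => MvPolynomial.map C (g i)
noncomputable def vR (σ : Type*) : Fin r → ι → MvPolynomial σ k := fun i b => C (v i b)

theorem Gm_R : Gm (gR g σ) (vR v σ) = (MvPolynomial.map (C : k →+* MvPolynomial σ k)).mapMatrix (Gm g v) := by
  ext1 i j
  exact dd_map (v j) (g i)

theorem det_R : (Gm (gR g σ) (vR v σ)).det = MvPolynomial.map C (Gm g v).det := by
  rw [Gm_R, RingHom.map_det]

theorem adj_R (i j : Fin r) : (Gm (gR g σ) (vR v σ)).adjugate i j = MvPolynomial.map C ((Gm g v).adjugate i j) := by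
  rw [Gm_R, ← RingHom.map_adjugate]; rfl

theorem Yop_R (u : ι → MvPolynomial σ k) (f : MvPolynomial ι k) :
    Yop (gR g σ) (vR v σ) u (MvPolynomial.map C f) =
      ∑ b, C (u b) * MvPolynomial.map C (Yop g v (Pi.single b 1) f) := by
  have hlin : Yop (gR g σ) (vR v σ) u (MvPolynomial.map C f) =
      ∑ b, C (u b) * Yop (gR g σ) (vR v σ) (Pi.single b 1) (MvPolynomial.map C f) := by
    have : ∀ s : Finset ι, Yop (gR g σ) (vR v σ) (∑ b ∈ s, u b • Pi.single b 1) (MvPolynomial.map C f) =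
      ∑ b ∈ s, C (u b) * Yop (gR g σ) (vR v σ) (Pi.single b 1) (MvPolynomial.map C f) := by
      intro s
      induction s using Finset.induction_on with
      | empty =>
        have := Yop_smul (gR g σ) (vR v σ) 0 0 (MvPolynomial.map C f)
        simpa using this
      | insert a s ha ih => rw [Finset.sum_insert ha, Finset.sum_insert ha, Yop_add, Yop_smul, ih]
    have hu : u = ∑ b, u b • (Pi.single b 1 : ι → MvPolynomial σ k) := by
      funext b
      simp [Finset.sum_apply, Pi.single_apply]
    rw [← this, ← hu]
  rw [hlin]
  refine Finset.sum_congr rfl fun b _ => ?_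
  refine congrArg (fun x => C (u b) * x) ?_
  rw [Yop_apply, Yop_apply, det_R]
  have hs : (Pi.single b 1 : ι → MvPolynomial σ k) = fun b' => C ((Pi.single b 1 : ι → k) b') := by
    funext b'
    by_cases h : b' = b
    · subst h; simp
    · simp [h]
  rw [hs]
  have hv : ∀ j, dd (vR v σ j) (MvPolynomial.map C f) = MvPolynomial.map C (dd (v j) f) := fun j => dd_map _ _
  simp only [adj_R, gR, hv, dd_map, map_sub, map_mul, map_sum]

theorem chain_R (p : ι → k) (i : ℕ) : ∀ f ∈ chain (Yop g v) (RingHom.ker (eval p)) (RingHom.ker (eval p)) i,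
    MvPolynomial.map C f ∈ chain (Yop (gR g σ) (vR v σ))
      (RingHom.ker (eval fun b => (C (p b) : MvPolynomial σ k)))
      (RingHom.ker (eval fun b => (C (p b) : MvPolynomial σ k))) i := by
  have hev : ∀ f : MvPolynomial ι k, f ∈ RingHom.ker (eval p) → 
      MvPolynomial.map C f ∈ RingHom.ker (eval fun b => (C (p b) : MvPolynomial σ k)) := by
    intro f hf
    rw [RingHom.mem_ker] at hf ⊢
    have := map_eval (C : k →+* MvPolynomial σ k) p f
    rw [hf, map_zero] at this
    exact this.symm
  have hgood := chain_good (Yop (gR g σ) (vR v σ))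
      (RingHom.ker (eval fun b => (C (p b) : MvPolynomial σ k)))
      (RingHom.ker (eval fun b => (C (p b) : MvPolynomial σ k))) 1 (by simp) (good_ideal _ _ (by simp))
      (fun f hf => hf.1)
  induction i with
  | zero => exact hev
  | succ i ih =>
    intro f hf
    refine ⟨hev f hf.1, fun u => ?_⟩
    rw [Yop_R]
    have hz := (hgood i).1.mul 0 _ (ih _ (hf.2 0))
    rw [zero_mul] at hz
    exact (hgood i).1.sum _ _ (fun b _ => (hgood i).1.mul _ _ (ih _ (hf.2 _))) hz

theorem RD_Yop {t : ℕ} {f : MvPolynomial ι (MvPolynomial σ k)} (h : RD t f)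
    (u : ι → MvPolynomial σ k) (hu : ∀ b, (u b).totalDegree ≤ 1) :
    RD (t + 1) (Yop (gR g σ) (vR v σ) u f) := by
  rw [Yop_apply, det_R]
  refine RD.sub ?_ (RD.sum _ fun j _ => ?_)
  · have := RD.mul (RD.map (σ := σ) (Gm g v).det) (h.dd u hu)
    exact this.mono (by omega)
  · have h1 : RD 1 (∑ i, (Gm (gR g σ) (vR v σ)).adjugate j i * dd u (gR g σ i)) := by
      refine RD.sum _ fun i _ => ?_
      rw [adj_R]
      exact (RD.mul (RD.map _) ((RD.map (g i)).dd u hu)).mono (by omega)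
    have h2 : RD t (dd (vR v σ j) f) := h.dd (d := 0) _ (fun b => by simp [vR])
    exact (RD.mul h1 h2).mono (by omega)

def LL (r : ℕ) : ℕ → ℕ
  | 0 => 0
  | (t + 1) => LL r t + LL r t + (1 + r)

/-- the main expansion -/
theorem expand (U : ℕ → ι → MvPolynomial σ k) (hU : ∀ t b, (U t b).totalDegree ≤ 1)
    (h : ℕ → MvPolynomial ι (MvPolynomial σ k)) (Φ : ℕ → MvPolynomial ι (MvPolynomial σ k))
    (h0 : Φ 0 = h 0) (m : ℕ) (hh : ∀ t < m, dd (U t) (h t) = h (t + 1))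
    (hΦ : ∀ t, Φ (t + 1) = Yop (gR g σ) (vR v σ) (U t) (Φ t)) (hrd : ∀ t, RD (t + 1) (h t) ∨ m < t) :
    ∀ t ≤ m, ∃ w, Rk (RD t) (LL r t) w ∧
      Φ t = (MvPolynomial.map C (Gm g v).det) ^ t * h t + w := by
  intro t
  induction t with
  | zero => intro _; exact ⟨0, Rk.zero, by rw [h0]; simp⟩
  | succ t ih =>
    intro ht
    obtain ⟨w, ⟨a, b, ha, hb, rfl⟩, hw⟩ := ih (by omega)
    have hht : RD (t + 1) (h t) := (hrd t).resolve_right (by omega)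
    set δ := MvPolynomial.map (C : k →+* MvPolynomial σ k) (Gm g v).det with hδ
    have hδt : RD 0 (δ ^ t) := by rw [hδ, ← map_pow]; exact RD.map _
    set Y := Yop (gR g σ) (vR v σ) (U t) with hY
    have e1 : Y (h t) = δ * h (t + 1) -
        ∑ j, (∑ i, (Gm (gR g σ) (vR v σ)).adjugate j i * dd (U t) (gR g σ i)) * dd (vR v σ j) (h t) := by
      rw [hY, Yop_apply, hh t (by omega), det_R]
    have e2 : Φ (t + 1) = δ ^ (t + 1) * h (t + 1) + 
        ((∑ i, Y (a i) * b i + ∑ i, a i * Y (b i)) + (h t * Y (δ ^ t) +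
        ∑ j, (- (δ ^ t * ∑ i, (Gm (gR g σ) (vR v σ)).adjugate j i * dd (U t) (gR g σ i))) *
          dd (vR v σ j) (h t))) := by
      rw [hΦ, hw, ← hY, map_add, Derivation.leibniz, smul_eq_mul, smul_eq_mul, e1, map_sum]
      simp only [Derivation.leibniz, smul_eq_mul]
      rw [mul_sub, Finset.mul_sum, Finset.sum_add_distrib]
      have e3 : ∑ j, (- (δ ^ t * ∑ i, (Gm (gR g σ) (vR v σ)).adjugate j i * dd (U t) (gR g σ i))) *
          dd (vR v σ j) (h t) = - ∑ j, δ ^ t * ((∑ i, (Gm (gR g σ) (vR v σ)).adjugate j i *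
            dd (U t) (gR g σ i)) * dd (vR v σ j) (h t)) := by
        rw [← Finset.sum_neg_distrib]
        refine Finset.sum_congr rfl fun j _ => ?_
        ring
      have e4 : ∑ i, b i * Y (a i) = ∑ i, Y (a i) * b i := 
        Finset.sum_congr rfl fun i _ => mul_comm _ _
      rw [e3, e4, pow_succ]
      ring
    refine ⟨_, ?_, e2⟩
    have hrY : ∀ f, RD t f → RD (t + 1) (Y f) := fun f hf => RD_Yop g v hf (U t) (hU t)
    refine Rk.add (Rk.add ?_ ?_) (Rk.add ?_ ?_)
    · exact ⟨_, _, fun i => hrY _ (ha i), fun i => (hb i).mono (by omega), rfl⟩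
    · exact ⟨_, _, fun i => (ha i).mono (by omega), fun i => hrY _ (hb i), rfl⟩
    · refine Rk.mul hht ((RD_Yop g v hδt (U t) (hU t)).mono (by omega))
    · refine ⟨_, _, fun j => ?_, fun j => ?_, rfl⟩
      · rw [← zero_sub]
        refine RD.sub (fun s => by simp) ?_
        refine (RD.mul hδt (RD.sum _ (t := 1) fun i _ => ?_)).mono (by omega)
        rw [adj_R]
        exact (RD.mul (RD.map _) ((RD.map (g i)).dd (U t) (hU t))).mono (by omega)
      · exact hht.dd (d := 0) _ (fun b => by simp [vR])

end transfer
end HR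

open MvPolynomial
namespace HR
set_option linter.unusedSectionVars false

section tensor
variable {k : Type*} [CommRing k] {m : ℕ} {ν : Type*} [Fintype ν] [DecidableEq ν]

/-- the multilinear polynomial with coefficient tensor `c` -/
noncomputable def tens {e : ℕ} (c : (Fin e → ν) → k) : MvPolynomial (Fin e × ν) k :=
  ∑ J : Fin e → ν, C (c J) * ∏ l, X (l, J l)

noncomputable def tF (c : (Fin (m + 1) → ν) → k) (i : ν) : MvPolynomial (Fin m × ν) k :=
  ∑ J : Fin (m + 1) → ν, if J (Fin.last m) = i then C (c J) * ∏ l : Fin m, X (l, J l.castSucc) else 0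

noncomputable def tU (m : ℕ) (ν : Type*) (k : Type*) [CommRing k] (t : ℕ) :
    Fin m × ν → MvPolynomial (Fin (m + 1) × ν) k :=
  fun b => if (b.1 : ℕ) = t then X (b.1.castSucc, b.2) else 0

noncomputable def tfac (J : Fin (m + 1) → ν) (k : Type*) [CommRing k] (t : ℕ) (l : Fin m) :
    MvPolynomial (Fin m × ν) (MvPolynomial (Fin (m + 1) × ν) k) :=
  if (l : ℕ) < t then C (X (l.castSucc, J l.castSucc)) else X (l, J l.castSucc)

noncomputable def tH (c : (Fin (m + 1) → ν) → k) (t : ℕ) :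
    MvPolynomial (Fin m × ν) (MvPolynomial (Fin (m + 1) × ν) k) :=
  ∑ J : Fin (m + 1) → ν, C (C (c J) * X (Fin.last m, J (Fin.last m))) * ∏ l, tfac J k t l

theorem der_prod {A β : Type*} [CommRing A] [Algebra k A] [DecidableEq β] (D : Derivation k A A) (s : Finset β) (f : β → A) :
    D (∏ b ∈ s, f b) = ∑ b ∈ s, (∏ x ∈ s.erase b, f x) * D (f b) := by
  induction s using Finset.induction_on with
  | empty => simp
  | insert a s ha ih =>
    rw [Finset.prod_insert ha, Derivation.leibniz, Finset.sum_insert ha, Finset.erase_insert ha, ih,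
      smul_eq_mul, smul_eq_mul, add_comm, Finset.mul_sum]
    refine congrArg₂ (fun x y => x + y) rfl ?_
    refine Finset.sum_congr rfl fun b hb => ?_
    have hab : a ≠ b := fun h => ha (h ▸ hb)
    rw [Finset.erase_insert_of_ne hab, Finset.prod_insert (by simp [ha]), mul_assoc]

theorem dd_C' {ι : Type*} [Fintype ι] (u : ι → k) (a : k) : dd u (C a : MvPolynomial ι k) = 0 := by
  rw [dd_apply]; simp

theorem dd_X' {ι : Type*} [Fintype ι] (u : ι → k) (i : ι) : dd u (X i : MvPolynomial ι k) = C (u i) := by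
  classical
  rw [dd_apply, Finset.sum_eq_single i]
  · simp
  · intro j _ hj; simp [pderiv_X_of_ne hj.symm]
  · simp

theorem dd_tH (c : (Fin (m + 1) → ν) → k) (t : ℕ) (ht : t < m) :
    dd (tU m ν k t) (tH c t) = tH c (t + 1) := by
  rw [tH, tH, map_sum]
  refine Finset.sum_congr rfl fun J _ => ?_
  rw [Derivation.leibniz, dd_C', smul_zero, add_zero, smul_eq_mul]
  refine congrArg (fun x => _ * x) ?_
  rw [der_prod, Finset.sum_eq_single ⟨t, ht⟩]
  · rw [← Finset.prod_erase_mul _ (tfac J k (t+1)) (Finset.mem_univ ⟨t, ht⟩)]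
    refine congrArg₂ (fun x y => x * y) ?_ ?_
    · refine Finset.prod_congr rfl fun l hl => ?_
      have hl' : (l : ℕ) ≠ t := fun h => (Finset.ne_of_mem_erase hl) (Fin.ext h)
      unfold tfac
      by_cases h : (l : ℕ) < t
      · rw [if_pos h, if_pos (by omega)]
      · rw [if_neg h, if_neg (by omega)]
    · unfold tfac
      rw [if_neg (by simp), if_pos (by simp), dd_X']
      simp [tU]
  · intro l _ hl
    have hl' : (l : ℕ) ≠ t := fun h => hl (Fin.ext h)
    have : dd (tU m ν k t) (tfac J k t l) = 0 := by
      unfold tfac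
      split_ifs
      · rw [dd_C']
      · rw [dd_X']; simp [tU, hl']
    rw [this, mul_zero]
  · simp

theorem tH_zero (c : (Fin (m + 1) → ν) → k) :
    tH c 0 = ∑ i : ν, C (X (Fin.last m, i)) * MvPolynomial.map C (tF c i) := by
  simp only [tF, map_sum, Finset.mul_sum, tH]
  rw [Finset.sum_comm]
  refine Finset.sum_congr rfl fun J _ => ?_
  rw [Finset.sum_eq_single (J (Fin.last m))]
  · simp only [if_true, map_mul, map_C, map_prod, map_X, tfac, Nat.not_lt_zero, if_false]
    ring
  · intro i _ hi
    rw [if_neg hi.symm, map_zero, mul_zero]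
  · simp

theorem tH_last (c : (Fin (m + 1) → ν) → k) : tH c m = C (tens c) := by
  simp only [tH, tens, map_sum]
  refine Finset.sum_congr rfl fun J _ => ?_
  rw [Fin.prod_univ_castSucc]
  simp only [tfac, Fin.is_lt, if_true, map_mul, map_prod]
  ring

theorem RD_tH (c : (Fin (m + 1) → ν) → k) (t : ℕ) (ht : t ≤ m) : RD (t + 1) (tH c t) := by
  unfold tH
  refine RD.sum _ fun J _ => ?_
  have h1 : RD 1 (C (C (c J) * X (Fin.last m, J (Fin.last m))) : 
      MvPolynomial (Fin m × ν) (MvPolynomial (Fin (m + 1) × ν) k)) := by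
    refine RD.C ((totalDegree_mul _ _).trans ?_)
    rw [totalDegree_C, zero_add]
    refine (totalDegree_monomial_le _ _).trans ?_
    simp
  have h2 : ∀ s : Finset (Fin m), RD (s.filter (fun l : Fin m => (l : ℕ) < t)).card (∏ l ∈ s, tfac J k t l) := by
    intro s
    induction s using Finset.induction_on with
    | empty =>
      have := RD.C (ι := Fin m × ν) (t := 0) (a := (1 : MvPolynomial (Fin (m + 1) × ν) k)) (by simp)
      simpa using this
    | insert a s ha ih =>
      rw [Finset.prod_insert ha, Finset.filter_insert]
      by_cases h : (a : ℕ) < t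
      · rw [if_pos h, Finset.card_insert_of_notMem (by simp [ha])]
        refine RD.mono (RD.mul (t := 1) ?_ ih) (by omega)
        unfold tfac
        rw [if_pos h]
        refine RD.C ?_
        refine (totalDegree_monomial_le _ _).trans ?_
        simp
      · rw [if_neg h]
        have := RD.mul (RD.X (σ := Fin (m + 1) × ν) (k := k) (a, J a.castSucc)) ih
        rw [zero_add] at this
        unfold tfac at *
        rw [if_neg h]
        exact this
  have h3 : (Finset.univ.filter (fun l : Fin m => (l : ℕ) < t)).card ≤ t := by
    calc _ ≤ (Finset.range t).card := Finset.card_le_card_of_injOn (fun l : Fin m => (l : ℕ)) 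
          (fun l hl => by simpa using hl) (fun a _ b _ h => Fin.ext h)
      _ = t := by simp
  exact (RD.mul h1 ((h2 Finset.univ).mono h3)).mono (by omega)

end tensor

section concl
variable {k : Type*} [Field k] {m : ℕ} {ν : Type*} [Fintype ν] [DecidableEq ν]

theorem tens_rank_of_chain (c : (Fin (m + 1) → ν) → k) {r : ℕ} (g : Fin r → MvPolynomial (Fin m × ν) k)
    (v : Fin r → Fin m × ν → k) (p : Fin m × ν → k) (hp : eval p (Gm g v).det ≠ 0)
    (hF : ∀ i, tF c i ∈ chain (Yop g v) (RingHom.ker (eval p)) (RingHom.ker (eval p)) m) :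
    Rk (fun f => f.totalDegree < m + 1) (LL r m) (tens c) := by
  set σ := Fin (m + 1) × ν
  let Φ : ℕ → MvPolynomial (Fin m × ν) (MvPolynomial σ k) := fun t =>
    Nat.rec (tH c 0) (fun t f => Yop (gR g σ) (vR v σ) (tU m ν k t) f) t
  have hΦ : ∀ t, Φ (t + 1) = Yop (gR g σ) (vR v σ) (tU m ν k t) (Φ t) := fun t => rfl
  obtain ⟨w, hw, hw2⟩ := expand g v (tU m ν k) (fun t b => by
      unfold tU; split_ifs
      · refine (totalDegree_monomial_le _ _).trans ?_
        simp
      · simp) (tH c) Φ rfl m (dd_tH c) hΦ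
      (fun t => (le_or_gt t m).imp (RD_tH c t) id) m le_rfl
  set I := RingHom.ker (eval fun b => (C (p b) : MvPolynomial σ k)) with hI
  have hgood := chain_good (Yop (gR g σ) (vR v σ)) I I 1 (by simp) (good_ideal _ _ (by simp)) (fun f hf => hf.1)
  have hch : ∀ t ≤ m, Φ t ∈ chain (Yop (gR g σ) (vR v σ)) I I (m - t) := by
    intro t
    induction t with
    | zero =>
      intro _
      have : Φ 0 = ∑ i : ν, C (X (Fin.last m, i)) * MvPolynomial.map C (tF c i) := tH_zero c
      rw [this, Nat.sub_zero]
      have hmem := fun i => chain_R (σ := σ) g v p m _ (hF i)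
      refine (hgood m).1.sum _ _ (fun i _ => (hgood m).1.mul _ _ (hmem i)) ?_
      rcases isEmpty_or_nonempty ν with hν | ⟨⟨i⟩⟩
      · have : ∀ j, (0 : MvPolynomial (Fin m × ν) (MvPolynomial σ k)) ∈ chain (Yop (gR g σ) (vR v σ)) I I j := by
          intro j
          induction j with
          | zero => exact I.zero_mem
          | succ j ih => exact ⟨I.zero_mem, fun u => by rw [map_zero]; exact ih⟩
        exact this m
      · have := (hgood m).1.mul 0 _ (hmem i)
        rwa [zero_mul] at this
    | succ t ih =>
      intro ht
      have h1 := ih (by omega)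
      obtain ⟨j, hj⟩ : ∃ j, m - t = j + 1 := ⟨m - t - 1, by omega⟩
      have hj' : m - (t + 1) = j := by omega
      rw [hj] at h1
      rw [hj', hΦ]
      exact h1.2 _
  have h0 := hch m le_rfl
  rw [Nat.sub_self] at h0
  have h1 : eval (fun b => (C (p b) : MvPolynomial σ k)) (Φ m) = 0 := h0
  rw [hw2, tH_last, map_add, map_mul, map_pow, eval_C] at h1
  have h2 : eval (fun b => (C (p b) : MvPolynomial σ k)) (MvPolynomial.map C (Gm g v).det) = 
      C (eval p (Gm g v).det) := (map_eval (C : k →+* MvPolynomial σ k) p _).symm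
  rw [h2] at h1
  set δ := eval p (Gm g v).det
  obtain ⟨a, b, ha, hb, rfl⟩ := hw
  refine ⟨fun i => C (-(δ⁻¹ ^ m)) * eval (fun b => (C (p b) : MvPolynomial σ k)) (a i), 
    fun i => eval (fun b => (C (p b) : MvPolynomial σ k)) (b i), fun i => ?_, fun i => ?_, ?_⟩
  · refine Nat.lt_succ_of_le ((totalDegree_mul _ _).trans ?_)
    rw [totalDegree_C, zero_add]
    exact (ha i).eval p
  · exact Nat.lt_succ_of_le ((hb i).eval p)
  · rw [map_sum] at h1
    simp only [map_mul] at h1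
    simp only [mul_assoc]
    rw [← Finset.mul_sum]
    have h3 : (C (δ⁻¹ ^ m) : MvPolynomial σ k) * C δ ^ m = 1 := by
      rw [← C_pow, ← C_mul, ← mul_pow, inv_mul_cancel₀ hp, one_pow, C_1]
    have h4 : tens c = C (δ⁻¹ ^ m) * (C δ ^ m * tens c) := by rw [← mul_assoc, h3, one_mul]
    rw [h4, eq_neg_of_add_eq_zero_left h1, C_neg]
    ring

/-- counting form over large fields -/
theorem tens_rank_large [Fintype k] (c : (Fin (m + 1) → ν) → k) (s : ℕ) (Z : Finset (Fin m × ν → k))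
    (hZ0 : ∀ p ∈ Z, ∀ i, eval p (tF c i) = 0)
    (hZ : Fintype.card k ^ Fintype.card (Fin m × ν) ≤ Z.card * Fintype.card k ^ s)
    (hq : MM m m s ^ 2 ≤ Fintype.card k) :
    Rk (fun f => f.totalDegree < m + 1) (LL (2 * s) m) (tens c) := by
  have hdeg : ∀ h ∈ Submodule.span k (Set.range (tF c)), h.totalDegree ≤ m := by
    intro h hh
    induction hh using Submodule.span_induction with
    | mem x hx =>
      obtain ⟨i, rfl⟩ := hx
      refine totalDegree_finsetSum_le fun J _ => ?_
      split_ifs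
      · refine (totalDegree_mul _ _).trans ?_
        rw [totalDegree_C, zero_add]
        refine (totalDegree_finsetProd _ _).trans ?_
        refine (Finset.sum_le_sum (g := fun _ => 1) fun l _ => ?_).trans (by simp)
        refine (totalDegree_monomial_le _ _).trans ?_
        simp
      · simp
    | zero => simp
    | add x y _ _ hx hy => exact (totalDegree_add _ _).trans (max_le hx hy)
    | smul a x _ hx => exact (totalDegree_smul_le _ _).trans hx
  have hvan : ∀ p ∈ Z, ∀ h ∈ Submodule.span k (Set.range (tF c)), eval p h = 0 := by
    intro p hp h hh
    induction hh using Submodule.span_induction with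
    | mem x hx =>
      obtain ⟨i, rfl⟩ := hx
      exact hZ0 p hp i
    | zero => simp
    | add x y _ _ hx hy => rw [map_add, hx, hy, add_zero]
    | smul a x _ hx => rw [smul_eval, hx, mul_zero]
  have hfin : Finite (Submodule.span k (Set.range (tF c))) := by
    have : Module.Finite k (Submodule.span k (Set.range (tF c))) :=
      Module.Finite.span_of_finite k (Set.finite_range _)
    exact Module.finite_of_finite k
  obtain ⟨r, hr, g, v, p, hp, hF⟩ := phases m m s _ hfin hdeg Z hvan hZ hq
  have h := tens_rank_of_chain c g v p hp (fun i => hF (Submodule.subset_span ⟨i, rfl⟩))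
  refine h.mono ?_ (by simp)
  have : ∀ t, LL r t ≤ LL (2 * s) t := by
    intro t
    induction t with
    | zero => exact le_rfl
    | succ t ih => simp only [LL]; omega
  exact this m

end concl
end HR

open MvPolynomial
namespace HR
set_option linter.unusedSectionVars false

section grid
open scoped BigOperators

theorem expect_pow_le {β : Type*} [Fintype β] [Nonempty β] (f : β → ℝ) (hf : ∀ b, 0 ≤ f b) (L : ℕ) :
    (𝔼 b, f b) ^ L ≤ 𝔼 b, f b ^ L := by
  have hc : (0 : ℝ) < Fintype.card β := by exact_mod_cast Fintype.card_pos
  have := Real.pow_arith_mean_le_arith_mean_pow Finset.univ (fun _ : β => (1 : ℝ) / Fintype.card β) f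
    (fun _ _ => by positivity) (by simp) (fun b _ => hf b) L
  rw [Fintype.expect_eq_sum_div_card, Fintype.expect_eq_sum_div_card]
  rw [← Finset.mul_sum, ← Finset.mul_sum] at this
  rw [div_eq_inv_mul, div_eq_inv_mul]
  simpa using this

theorem expect_cons {α : Type*} [Fintype α] (m : ℕ) (f : (Fin (m + 1) → α) → ℝ) :
    𝔼 x, f x = 𝔼 y : Fin m → α, 𝔼 a : α, f (Fin.cons a y) := by
  rw [Finset.expect_comm, ← Finset.expect_product' (Finset.univ : Finset α) (Finset.univ : Finset (Fin m → α))
    (fun a y => f (Fin.cons a y)), Finset.univ_product_univ]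
  exact (Fintype.expect_equiv (Fin.consEquiv (fun _ => α)) _ _ (fun p => rfl)).symm

theorem expect_nonneg' {β : Type*} [Fintype β] (f : β → ℝ) (hf : ∀ b, 0 ≤ f b) : 0 ≤ 𝔼 b, f b := by
  rw [Fintype.expect_eq_sum_div_card]
  exact div_nonneg (Finset.sum_nonneg fun b _ => hf b) (by positivity)

theorem expect_le' {β : Type*} [Fintype β] (f g : β → ℝ) (hf : ∀ b, f b ≤ g b) : 𝔼 b, f b ≤ 𝔼 b, g b := by
  rw [Fintype.expect_eq_sum_div_card, Fintype.expect_eq_sum_div_card]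
  gcongr with b; exact hf b

theorem grid {A : Type*} [Fintype A] [Nonempty A] (l : ℕ) (m : ℕ) (f : (Fin m → A) → ℝ) (hf : ∀ x, 0 ≤ f x) :
    (𝔼 x, f x) ^ (l ^ m) ≤ 𝔼 x : Fin m → Fin l → A, ∏ φ : Fin m → Fin l, f (fun i => x i (φ i)) := by
  induction m with
  | zero =>
    have h1 : ∀ x : Fin 0 → A, x = Fin.elim0 := fun x => Subsingleton.elim _ _
    rw [Fintype.expect_eq_sum_div_card, Fintype.expect_eq_sum_div_card]
    simp [Finset.univ_unique]
    rw [Subsingleton.elim (default : Fin 0 → A)]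
  | succ m ih =>
    have key : ∀ y : Fin m → Fin l → A,
        𝔼 b : Fin l → A, ∏ φ : Fin (m + 1) → Fin l, f (fun i => (Fin.cons b y : Fin (m + 1) → Fin l → A) i (φ i)) =
        (𝔼 a, ∏ φ : Fin m → Fin l, f (Fin.cons a (fun i => y i (φ i)))) ^ l := by
      intro y
      rw [Finset.expect_pow, Fintype.piFinset_univ]
      refine Finset.expect_congr rfl fun b _ => ?_
      rw [← (Fin.consEquiv (fun _ : Fin (m + 1) => Fin l)).prod_comp]
      rw [Fintype.prod_prod_type]
      refine Finset.prod_congr rfl fun j _ => Finset.prod_congr rfl fun φ _ => ?_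
      refine congrArg f ?_
      funext i
      refine Fin.cases ?_ (fun i => ?_) i <;> simp [Fin.consEquiv]
    rw [expect_cons, expect_cons]
    simp only [key]
    refine le_trans ?_ (expect_pow_le _ (fun y => expect_nonneg' _ fun a => Finset.prod_nonneg fun φ _ => hf _) l)
    rw [pow_succ, pow_mul]
    refine pow_le_pow_left₀ (pow_nonneg (expect_nonneg' _ fun y => expect_nonneg' _ fun a => hf _) _) ?_ l
    rw [Finset.expect_comm Finset.univ Finset.univ (fun (y : Fin m → Fin l → A) a => ∏ φ : Fin m → Fin l, f (Fin.cons a (fun i => y i (φ i)))),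
      Finset.expect_comm]
    refine (expect_pow_le _ (fun a => expect_nonneg' _ fun y => hf _) _).trans ?_
    refine expect_le' _ _ fun a => ?_
    exact ih (fun y => f (Fin.cons a y)) (fun y => hf _)

end grid

section descent
variable {k K σ : Type*} [Field k] [Field K] [Algebra k K]

/-- coefficientwise application of a linear functional -/
noncomputable def lmap (τ : K →ₗ[k] k) (f : MvPolynomial σ K) : MvPolynomial σ k :=
  ∑ s ∈ f.support, monomial s (τ (coeff s f))

theorem coeff_lmap (τ : K →ₗ[k] k) (f : MvPolynomial σ K) (s : σ →₀ ℕ) : coeff s (lmap τ f) = τ (coeff s f) := by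
  classical
  rw [lmap, coeff_sum]
  simp only [coeff_monomial]
  rw [Finset.sum_ite_eq']
  split_ifs with h
  · rfl
  · rw [notMem_support_iff.mp h, map_zero]

theorem lmap_add (τ : K →ₗ[k] k) (f g : MvPolynomial σ K) : lmap τ (f + g) = lmap τ f + lmap τ g := by
  ext s; simp [coeff_lmap]

theorem lmap_sum (τ : K →ₗ[k] k) {β : Type*} (s : Finset β) (f : β → MvPolynomial σ K) :
    lmap τ (∑ b ∈ s, f b) = ∑ b ∈ s, lmap τ (f b) := by
  ext s; simp [coeff_lmap, coeff_sum]

theorem lmap_map_mul (τ : K →ₗ[k] k) (f : MvPolynomial σ k) (g : MvPolynomial σ K) :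
    lmap τ (MvPolynomial.map (algebraMap k K) f * g) = f * lmap τ g := by
  classical
  ext s
  rw [coeff_lmap, coeff_mul, coeff_mul, map_sum]
  refine Finset.sum_congr rfl fun p _ => ?_
  rw [coeff_map, coeff_lmap, ← Algebra.smul_def, map_smul, smul_eq_mul]

theorem lmap_C_map (τ : K →ₗ[k] k) (a : K) (f : MvPolynomial σ k) :
    lmap τ (C a * MvPolynomial.map (algebraMap k K) f) = C (τ a) * f := by
  ext s
  rw [coeff_lmap, coeff_C_mul, coeff_C_mul, coeff_map, mul_comm, ← Algebra.smul_def, map_smul, smul_eq_mul, mul_comm]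

theorem totalDegree_lmap_le (τ : K →ₗ[k] k) (f : MvPolynomial σ K) : (lmap τ f).totalDegree ≤ f.totalDegree := by
  refine Finset.sup_mono fun s hs => ?_
  rw [mem_support_iff, coeff_lmap] at hs
  rw [mem_support_iff]
  intro h
  rw [h, map_zero] at hs
  exact hs rfl

theorem descent {l : ℕ} (β : Module.Basis (Fin l) k K) (τ : K →ₗ[k] k) {e L : ℕ} {f : MvPolynomial σ K}
    (h : Rk (fun f => f.totalDegree < e) L f) : Rk (fun f => f.totalDegree < e) (L * l) (lmap τ f) := by
  obtain ⟨a, b, ha, hb, rfl⟩ := h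
  rw [lmap_sum]
  have h1 : ∀ i ∈ (Finset.univ : Finset (Fin L)), Rk (fun f : MvPolynomial σ k => f.totalDegree < e) l (lmap τ (a i * b i)) := by
    intro i _
    have h2 : a i = ∑ j, C (β j) * MvPolynomial.map (algebraMap k K) (lmap (β.coord j) (a i)) := by
      ext s
      rw [coeff_sum]
      simp only [coeff_C_mul, coeff_map, coeff_lmap]
      conv_lhs => rw [← β.sum_repr (coeff s (a i))]
      refine Finset.sum_congr rfl fun j _ => ?_
      rw [Algebra.smul_def, mul_comm, β.coord_apply]
    refine ⟨fun j => lmap (β.coord j) (a i), fun j => lmap τ (C (β j) * b i), fun j => ?_, fun j => ?_, ?_⟩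
    · exact (totalDegree_lmap_le _ _).trans_lt (ha i)
    · refine (totalDegree_lmap_le _ _).trans_lt (lt_of_le_of_lt (totalDegree_mul _ _) ?_)
      rw [totalDegree_C, zero_add]; exact hb i
    · conv_lhs => rw [h2]
      rw [Finset.sum_mul, lmap_sum]
      refine Finset.sum_congr rfl fun j _ => ?_
      rw [← lmap_map_mul]
      refine congrArg (lmap τ) ?_
      ring
  have := Rk.sum _ l _ h1
  simpa using this

end descent

theorem exists_ext (k : Type) [Field k] [Fintype k] (l : ℕ) (hl : l ≠ 0) :
    ∃ (K : Type) (_ : Field K) (_ : Fintype K) (_ : Algebra k K) (_ : Module.Basis (Fin l) k K),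
      Fintype.card K = Fintype.card k ^ l := by
  classical
  obtain ⟨p, hp⟩ := CharP.exists k
  have : Fact p.Prime := ⟨CharP.char_is_prime k p⟩
  have : NeZero l := ⟨hl⟩
  let _ : Fintype (FiniteField.Extension k p l) := Fintype.ofFinite _
  refine ⟨FiniteField.Extension k p l, inferInstance, inferInstance, inferInstance,
    Module.finBasisOfFinrankEq _ _ (FiniteField.finrank_extension k p l), ?_⟩
  have := FiniteField.natCard_extension k p l
  rwa [Nat.card_eq_fintype_card, Nat.card_eq_fintype_card] at this

end HR

open MvPolynomial
namespace HR
set_option linter.unusedSectionVars false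
open scoped BigOperators

theorem exp_beats_poly (B E : ℕ) : ∃ l : ℕ, 1 ≤ l ∧ B * l ^ E ≤ 2 ^ l := by
  have h := tendsto_pow_const_div_const_pow_of_one_lt E (r := (2 : ℝ)) (by norm_num)
  have h2 := h.eventually (gt_mem_nhds (show (0 : ℝ) < 1 / (B + 1) by positivity))
  obtain ⟨l, hl1, hl2⟩ := (h2.and (Filter.eventually_ge_atTop 1)).exists
  refine ⟨l, hl2, ?_⟩
  rw [div_lt_div_iff₀ (by positivity) (by positivity)] at hl1
  have : (B : ℝ) * (l : ℝ) ^ E ≤ 2 ^ l := by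
    have : (0 : ℝ) ≤ (l : ℝ) ^ E := by positivity
    nlinarith
  exact_mod_cast this

theorem MM_mul (m s L : ℕ) (hL : 1 ≤ L) : MM m m (s * L) ≤ MM m m s * L ^ (m + 1) := by
  unfold MM BB
  have h1 : 2 * (s * L) + 1 ≤ (2 * s + 1) * L := by nlinarith
  have h2 : 2 * (s * L) + 2 ≤ (2 * s + 2) * L := by nlinarith
  calc 8 ^ (m + 1) * ((2 * (s * L) + 1) * ((m + 1) * ((m + 1) * (2 * (s * L) + 2)) ^ m) + 1) 
      ≤ 8 ^ (m + 1) * (((2 * s + 1) * L) * ((m + 1) * ((m + 1) * ((2 * s + 2) * L)) ^ m) + L ^ (m + 1)) := by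
        gcongr
        exact Nat.one_le_pow _ _ hL
    _ = _ := by rw [← mul_assoc (m + 1) (2 * s + 2) L, mul_pow _ L]; ring

theorem exists_l (m s : ℕ) : ∃ l : ℕ, 1 ≤ l ∧ MM m m (s * l ^ m) ^ 2 ≤ 2 ^ l := by
  obtain ⟨l, hl, h⟩ := exp_beats_poly (MM m m s ^ 2) (m * (m + 1) * 2)
  refine ⟨l, hl, ?_⟩
  calc MM m m (s * l ^ m) ^ 2 ≤ (MM m m s * (l ^ m) ^ (m + 1)) ^ 2 := by
        gcongr; exact MM_mul m s _ (Nat.one_le_pow _ _ hl)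
    _ = MM m m s ^ 2 * l ^ (m * (m + 1) * 2) := by rw [mul_pow, ← pow_mul, ← pow_mul, mul_assoc]
    _ ≤ _ := h

section
variable {k K : Type*} [Field k] [Field K] [Algebra k K] {m n l : ℕ}

theorem eval_tF {R : Type*} [CommRing R] (c : (Fin (m + 1) → Fin n) → R) (i : Fin n) (x : Fin m × Fin n → R) :
    eval x (tF c i) = ∑ J : Fin (m + 1) → Fin n, if J (Fin.last m) = i then c J * ∏ a : Fin m, x (a, J a.castSucc) else 0 := by
  rw [tF, map_sum]
  refine Finset.sum_congr rfl fun J _ => ?_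
  split_ifs
  · simp
  · simp

theorem eval_tF_ext (β : Fin l → K) (c : (Fin (m + 1) → Fin n) → k) (i : Fin n)
    (x : Fin m → Fin l → Fin n → k) :
    eval (fun b => ∑ t, algebraMap k K (x b.1 t b.2) * β t) (tF (fun J => algebraMap k K (c J)) i) =
      ∑ φ : Fin m → Fin l, (∏ a, β (φ a)) * algebraMap k K (eval (fun b => x b.1 (φ b.1) b.2) (tF c i)) := by
  simp only [eval_tF, map_sum, Finset.mul_sum]
  rw [Finset.sum_comm]
  refine Finset.sum_congr rfl fun J _ => ?_
  split_ifs
  · rw [Finset.prod_univ_sum, Fintype.piFinset_univ, Finset.mul_sum]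
    refine Finset.sum_congr rfl fun φ _ => ?_
    rw [Finset.prod_mul_distrib, map_mul, map_prod]
    ring
  · simp

theorem lmap_tens (τ : K →ₗ[k] k) (hτ : τ 1 = 1) {e : ℕ} (c : (Fin e → Fin n) → k) :
    lmap τ (tens (fun J => algebraMap k K (c J))) = tens c := by
  have : tens (fun J => algebraMap k K (c J)) = C 1 * MvPolynomial.map (algebraMap k K) (tens c) := by
    simp [tens, map_sum]
  rw [this, lmap_C_map, hτ, C_1, one_mul]

theorem exists_functional' {V : Type*} [AddCommGroup V] [Module k V] (v : V) (hv : v ≠ 0) :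
    ∃ τ : V →ₗ[k] k, τ v = 1 := by
  obtain ⟨τ, hτ⟩ := (LinearMap.toSpanSingleton k V v).exists_leftInverse_of_injective
    (LinearMap.ker_toSpanSingleton k hv)
  refine ⟨τ, ?_⟩
  have := LinearMap.congr_fun hτ 1
  simpa using this

theorem exists_functional : ∃ τ : K →ₗ[k] k, τ 1 = 1 := exists_functional' 1 one_ne_zero

end

theorem BR (m s : ℕ) : ∃ ρ : ℕ, ∀ (k : Type) [Field k] [Fintype k] (n : ℕ) (c : (Fin (m + 1) → Fin n) → k)
    (Z : Finset (Fin m × Fin n → k)), (∀ p ∈ Z, ∀ i, eval p (tF c i) = 0) →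
    Fintype.card k ^ (m * n) ≤ Z.card * Fintype.card k ^ s →
    Rk (fun f => f.totalDegree < m + 1) ρ (tens c) := by
  classical
  obtain ⟨l, hl, hM⟩ := exists_l m s
  refine ⟨LL (2 * (s * l ^ m)) m * l, ?_⟩
  intro k _ _ n c Z hZ0 hZ
  obtain ⟨K, _, _, _, β, hcard⟩ := exists_ext k l (by omega)
  obtain ⟨τ, hτ⟩ := exists_functional (k := k) (K := K)
  rw [← lmap_tens τ hτ]
  refine descent β τ ?_
  set q := Fintype.card k with hq
  have hq2 : 2 ≤ q := Fintype.one_lt_card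
  let f : (Fin m → Fin n → k) → ℝ := fun x => if (fun b => x b.1 b.2) ∈ Z then 1 else 0
  have hg := grid l m f (fun x => by simp only [f]; split_ifs <;> norm_num)
  have hcardA : Fintype.card (Fin m → Fin n → k) = q ^ (m * n) := by simp [← pow_mul, mul_comm, hq]
  have hcardB : Fintype.card (Fin m → Fin l → Fin n → k) = (q ^ l) ^ (m * n) := by
    simp [← pow_mul, hq]; congr 1; ring
  have h1 : ∑ x, f x = Z.card := by
    simp only [f, Finset.sum_boole]
    norm_cast
    refine Finset.card_bij (fun x _ b => x b.1 b.2) (fun x hx => by simpa using hx) ?_ ?_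
    · intro x _ y _ h
      funext a j
      exact congrFun h (a, j)
    · intro z hz
      exact ⟨fun a j => z (a, j), by simpa using hz, rfl⟩
  let emb : (Fin m → Fin l → Fin n → k) → (Fin m × Fin n → K) := fun x b => 
    ∑ t, algebraMap k K (x b.1 t b.2) * β t
  have hemb : Function.Injective emb := by
    intro x y h
    funext a t j
    have h2 := congrFun h (a, j)
    simp only [emb, ← Algebra.smul_def] at h2
    have h3 := congrArg (fun z => β.repr z t) h2
    simpa [Finsupp.single_apply] using h3
  let G : Finset (Fin m → Fin l → Fin n → k) := Finset.univ.filter fun x =>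
    ∀ φ : Fin m → Fin l, (fun b : Fin m × Fin n => x b.1 (φ b.1) b.2) ∈ Z
  have h2 : ∑ x : Fin m → Fin l → Fin n → k, ∏ φ : Fin m → Fin l, f (fun i => x i (φ i)) = G.card := by
    have : ∀ x : Fin m → Fin l → Fin n → k, ∏ φ : Fin m → Fin l, f (fun i => x i (φ i)) =
        if (∀ φ : Fin m → Fin l, (fun b : Fin m × Fin n => x b.1 (φ b.1) b.2) ∈ Z) then 1 else 0 := by
      intro x
      simp only [f]
      rw [Finset.prod_ite_zero]
      simp
    simp only [this, Finset.sum_boole]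
    rfl
  rw [Fintype.expect_eq_sum_div_card, Fintype.expect_eq_sum_div_card, h1, h2, hcardA, hcardB] at hg
  have h3 : (q : ℝ)⁻¹ ^ s ≤ Z.card / (q ^ (m * n) : ℕ) := by
    rw [inv_pow, ← one_div, div_le_div_iff₀ (by positivity) (by positivity), one_mul]
    exact_mod_cast hZ
  have h4 : ((q : ℝ)⁻¹ ^ s) ^ (l ^ m) ≤ G.card / ((q ^ l) ^ (m * n) : ℕ) :=
    (pow_le_pow_left₀ (by positivity) h3 _).trans hg
  have h5 : (q ^ l) ^ (m * n) ≤ G.card * q ^ (s * l ^ m) := by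
    rw [← pow_mul, inv_pow, ← one_div, div_le_div_iff₀ (by positivity) (by positivity), one_mul] at h4
    exact_mod_cast h4
  refine tens_rank_large _ (s * l ^ m) (G.image emb) ?_ ?_ ?_
  · intro p hp i
    obtain ⟨x, hx, rfl⟩ := Finset.mem_image.mp hp
    simp only [emb]
    rw [eval_tF_ext]
    refine Finset.sum_eq_zero fun φ _ => ?_
    rw [hZ0 _ ((Finset.mem_filter.mp hx).2 φ), map_zero, mul_zero]
  · rw [Finset.card_image_of_injective _ hemb, hcard]
    simp only [Fintype.card_prod, Fintype.card_fin]
    refine h5.trans (Nat.mul_le_mul le_rfl (Nat.pow_le_pow_left ?_ _))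
    exact Nat.le_self_pow (by omega) q
  · rw [hcard]
    exact hM.trans (Nat.pow_le_pow_left hq2 l)

end HR

open MvPolynomial
namespace HR
set_option linter.unusedSectionVars false
open scoped BigOperators

/-- alternating sum over subsets containing a fixed one -/
theorem alt_sum {R : Type*} [CommRing R] {e : ℕ} (T : Finset (Fin e)) :
    ∑ S : Finset (Fin e), (if T ⊆ S then (-1 : R) ^ (e - S.card) else 0) = if T = Finset.univ then 1 else 0 := by
  classical
  have h1 : ∑ S : Finset (Fin e), (if T ⊆ S then (-1 : R) ^ (e - S.card) else 0) =
      ∑ S : Finset (Fin e), (if S ⊆ Tᶜ then (-1 : R) ^ S.card else 0) := by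
    refine Fintype.sum_bijective compl compl_bijective _ _ fun S => ?_
    simp only [Finset.compl_subset_compl, Finset.card_compl, Fintype.card_fin]
  have h2 : (Finset.univ.filter fun S : Finset (Fin e) => S ⊆ Tᶜ) = Tᶜ.powerset := by
    ext S; simp
  rw [h1, ← Finset.sum_filter, h2]
  have h3 := congrArg (Int.cast (R := R)) (Finset.sum_powerset_neg_one_pow_card (x := Tᶜ))
  rw [Int.cast_sum] at h3
  simp only [Int.cast_pow, Int.cast_neg, Int.cast_one, Finset.compl_eq_empty_iff] at h3
  rw [h3]
  split_ifs <;> simp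

theorem alt_prod {R : Type*} [CommRing R] {e m : ℕ} (y : Fin m → R) (a : Fin e → Fin m → R) :
    ∑ S : Finset (Fin e), (-1 : R) ^ (e - S.card) * ∏ l, (y l + ∑ i ∈ S, a i l) =
      ∑ f : Fin m → Option (Fin e), (if (Finset.univ.filter fun i => ∃ l, f l = some i) = Finset.univ then
        ∏ l, (match f l with | none => y l | some i => a i l) else 0) := by
  classical
  have h1 : ∀ S : Finset (Fin e), ∏ l, (y l + ∑ i ∈ S, a i l) =
      ∑ f : Fin m → Option (Fin e), if (Finset.univ.filter fun i => ∃ l, f l = some i) ⊆ S then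
        ∏ l, (match f l with | none => y l | some i => a i l) else 0 := by
    intro S
    have h2 : ∀ l, (y l + ∑ i ∈ S, a i l) = ∑ o : Option (Fin e), 
        (match o with | none => y l | some i => if i ∈ S then a i l else 0) := by
      intro l
      rw [Fintype.sum_option]
      simp
    simp only [h2]
    rw [Fintype.prod_sum]
    refine Finset.sum_congr rfl fun f _ => ?_
    split_ifs with h
    · refine Finset.prod_congr rfl fun l _ => ?_
      cases hf : f l with
      | none => rfl
      | some i =>
        have : i ∈ S := h (by simp; exact ⟨l, hf⟩)
        simp [this]
    · obtain ⟨i, hi, hiS⟩ := Finset.not_subset.mp h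
      simp only [Finset.mem_filter, Finset.mem_univ, true_and] at hi
      obtain ⟨l, hl⟩ := hi
      refine Finset.prod_eq_zero (Finset.mem_univ l) ?_
      rw [hl]
      simp [hiS]
  simp only [h1, Finset.mul_sum]
  rw [Finset.sum_comm]
  refine Finset.sum_congr rfl fun f _ => ?_
  have h3 := alt_sum (R := R) (Finset.univ.filter fun i : Fin e => ∃ l, f l = some i)
  set T := (Finset.univ.filter fun i : Fin e => ∃ l, f l = some i)
  set p := ∏ l, (match f l with | none => y l | some i => a i l)
  calc _ = (∑ S : Finset (Fin e), (if T ⊆ S then (-1 : R) ^ (e - S.card) else 0)) * p := by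
        rw [Finset.sum_mul]
        refine Finset.sum_congr rfl fun S _ => ?_
        split_ifs <;> simp
    _ = _ := by rw [h3]; split_ifs <;> simp

/-- functions of the shape `w ↦ Σ c_J Π w_l(J l)`, independent of the algebra -/
def IsTens {k : Type} [Field k] {n e : ℕ} (c : (Fin e → Fin n) → k)
    (Φ : ∀ (R : Type) [CommRing R] [Algebra k R], (Fin n → R) → (Fin e → Fin n → R) → R) : Prop :=
  ∀ (R : Type) [CommRing R] [Algebra k R] (γ : Fin n → R) (w : Fin e → Fin n → R),
    Φ R γ w = ∑ J : Fin e → Fin n, algebraMap k R (c J) * ∏ l, w l (J l)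

theorem tens_monomial {k : Type} [Field k] {n e m : ℕ} (hm : m ≤ e) (j : Fin m → Fin n) :
    ∃ c : (Fin e → Fin n) → k, IsTens c (fun R _ _ γ w =>
      ∑ S : Finset (Fin e), (-1 : R) ^ (e - S.card) * ∏ l, (γ (j l) + ∑ i ∈ S, w i (j l))) := by
  classical
  by_cases hlt : m < e
  · refine ⟨0, fun R _ _ γ w => ?_⟩
    simp only [alt_prod (fun l => γ (j l)) (fun i l => w i (j l))]
    simp only [Pi.zero_apply, map_zero, zero_mul, Finset.sum_const_zero]
    refine Finset.sum_eq_zero fun f _ => ?_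
    rw [if_neg]
    intro h
    have h1 : ∀ i : Fin e, ∃ l, f l = some i := fun i => by
      have := Finset.mem_univ i
      rw [← h] at this
      simpa using this
    choose g hg using h1
    have hginj : Function.Injective g := fun a b hab => by
      have := hg a
      rw [hab, hg b] at this
      exact (Option.some.inj this).symm
    have := Fintype.card_le_of_injective g hginj
    simp at this
    omega
  · obtain rfl : m = e := by omega
    refine ⟨fun J => ∑ σ : Equiv.Perm (Fin m), if J = fun i => j (σ i) then 1 else 0, fun R _ _ γ w => ?_⟩
    simp only [alt_prod (fun l => γ (j l)) (fun i l => w i (j l))]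
    have h2 : ∑ J : Fin m → Fin n, (algebraMap k R) (∑ σ : Equiv.Perm (Fin m), if J = fun i => j (σ i) then 1 else 0) * ∏ l, w l (J l)
        = ∑ σ : Equiv.Perm (Fin m), ∏ l, w l (j (σ l)) := by
      simp only [map_sum, Finset.sum_mul]
      rw [Finset.sum_comm]
      refine Finset.sum_congr rfl fun σ _ => ?_
      rw [Finset.sum_eq_single (fun i => j (σ i))]
      · simp
      · intro J _ hJ
        rw [if_neg hJ, map_zero, zero_mul]
      · simp
    rw [h2, ← Finset.sum_filter]
    symm
    refine Finset.sum_bij (fun σ _ => fun l => some (σ⁻¹ l)) ?_ ?_ ?_ ?_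
    · intro σ _
      simp only [Finset.mem_filter, Finset.mem_univ, true_and]
      ext i
      simp only [Finset.mem_filter, Finset.mem_univ, true_and, iff_true]
      exact ⟨σ i, by simp⟩
    · intro σ _ σ' _ h
      have : σ⁻¹ = σ'⁻¹ := Equiv.ext fun l => Option.some.inj (congrFun h l)
      exact inv_injective this
    · intro f hf
      simp only [Finset.mem_filter, Finset.mem_univ, true_and] at hf
      have h1 : ∀ i : Fin m, ∃ l, f l = some i := fun i => by
        have := Finset.mem_univ i
        rw [← hf] at this
        simpa using this
      choose g hg using h1
      have hginj : Function.Injective g := fun a b hab => by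
        have := hg a
        rw [hab, hg b] at this
        exact (Option.some.inj this).symm
      have hgb : Function.Bijective g := Finite.injective_iff_bijective.mp hginj
      refine ⟨Equiv.ofBijective g hgb, Finset.mem_univ _, ?_⟩
      funext l
      obtain ⟨i, rfl⟩ := hgb.2 l
      rw [hg]
      congr 1
      rw [Equiv.Perm.inv_eq_iff_eq]
      rfl
    · intro σ _
      refine Eq.trans ?_ (Equiv.prod_comp σ (fun x => w (σ⁻¹ x) (j x)))
      simp

theorem exists_tensor {k : Type} [Field k] {n e : ℕ} (P : MvPolynomial (Fin n) k) (hP : P.totalDegree ≤ e) :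
    ∃ c : (Fin e → Fin n) → k, IsTens c (fun R _ _ γ w =>
      ∑ S : Finset (Fin e), (-1 : R) ^ (e - S.card) * aeval (fun j => γ j + ∑ i ∈ S, w i j) P) := by
  classical
  have hmon : ∀ s ∈ P.support, ∃ c : (Fin e → Fin n) → k, IsTens c (fun R _ _ γ w =>
      ∑ S : Finset (Fin e), (-1 : R) ^ (e - S.card) * aeval (fun j => γ j + ∑ i ∈ S, w i j) (monomial s (1 : k))) := by
    intro s hs
    have hdeg : (s.sum fun _ x => x) ≤ e := (le_totalDegree hs).trans hP
    -- list the monomial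
    let M : Multiset (Fin n) := Finsupp.toMultiset s
    have hM : M.card = s.sum fun _ x => x := by simp [M, Finsupp.card_toMultiset]; rfl
    obtain ⟨L, hL⟩ : ∃ L : List (Fin n), (L : Multiset (Fin n)) = M := Quot.exists_rep M
    have hLlen : L.length ≤ e := by
      have : L.length = M.card := by rw [← hL]; rfl
      rw [this, hM]; exact hdeg
    obtain ⟨c, hc⟩ := tens_monomial (k := k) hLlen (fun l => L.get l)
    refine ⟨c, fun R _ _ γ w => ?_⟩
    rw [← hc R γ w]
    refine Finset.sum_congr rfl fun S _ => ?_
    refine congrArg (fun x => _ * x) ?_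
    rw [aeval_monomial, map_one, one_mul]
    have h1 : (s.prod fun i m => (γ i + ∑ i_1 ∈ S, w i_1 i) ^ m) = (M.map fun i => (γ i + ∑ i_1 ∈ S, w i_1 i)).prod := by
      rw [Finsupp.toMultiset_map, Finsupp.prod_toMultiset, Finsupp.prod_mapDomain_index]
      · simp
      · intros; exact pow_add _ _ _
    rw [h1, ← hL, Multiset.map_coe, Multiset.prod_coe, ← List.prod_ofFn]
    congr 1
    conv_lhs => rw [← List.ofFn_get L]
    rw [List.map_ofFn]
    rfl
  choose! c hc using hmon
  refine ⟨fun J => ∑ s ∈ P.support, coeff s P * c s J, fun R _ _ γ w => ?_⟩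
  have h1 : ∀ v : Fin n → R, aeval v P = ∑ s ∈ P.support, algebraMap k R (coeff s P) * aeval v (monomial s (1 : k)) := by
    intro v
    conv_lhs => rw [P.as_sum]
    rw [map_sum]
    refine Finset.sum_congr rfl fun s _ => ?_
    rw [aeval_monomial, aeval_monomial, map_one, one_mul]
  simp only [h1, Finset.mul_sum, map_sum, Finset.sum_mul, map_mul]
  rw [Finset.sum_comm, Finset.sum_comm (s := Finset.univ (α := Fin e → Fin n))]
  refine Finset.sum_congr rfl fun s hs => ?_
  have h2 := hc s hs R γ w
  simp only at h2
  calc _ = algebraMap k R (coeff s P) * (∑ S : Finset (Fin e), (-1 : R) ^ (e - S.card) * aeval (fun j => γ j + ∑ i ∈ S, w i j) (monomial s (1 : k))) := by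
        rw [Finset.mul_sum]
        refine Finset.sum_congr rfl fun S _ => ?_
        ring
    _ = _ := by
        rw [h2, Finset.mul_sum]
        refine Finset.sum_congr rfl fun J _ => ?_
        ring

end HR

open MvPolynomial
namespace HR
set_option linter.unusedSectionVars false
open scoped BigOperators

theorem multiDiff_eq {k : Type} [Field k] {n e : ℕ} (P : MvPolynomial (Fin n) k)
    (c : (Fin e → Fin n) → k)
    (hc : IsTens c (fun R _ _ γ w => ∑ S : Finset (Fin e), (-1:R)^(e - S.card) *
      aeval (fun j => γ j + ∑ i ∈ S, w i j) P)) : multiDiff e P = tens c := by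
  have h := hc (MvPolynomial (Fin e × Fin n) k) 0 (fun i j => X (i, j))
  simp only at h
  unfold multiDiff tens
  simp only [MvPolynomial.algebraMap_eq] at h
  rw [← h]
  refine Finset.sum_congr rfl fun S _ => ?_
  simp only [Pi.zero_apply, zero_add]
  rw [MvPolynomial.smul_eq_C_mul]
  simp

theorem exists_addChar (k : Type) [Field k] [Fintype k] : ∃ ψ : AddChar k ℂ, ψ ≠ 1 := by
  have : Nontrivial k := inferInstance
  obtain ⟨ψ, h⟩ := AddChar.exists_apply_ne_zero.mpr (one_ne_zero (α := k))
  exact ⟨ψ, fun h' => h (by rw [h']; simp)⟩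

theorem addChar_map_sum {A : Type*} [AddCommGroup A] (ψ : AddChar A ℂ) {ι : Type*} (s : Finset ι) (f : ι → A) :
    ψ (∑ i ∈ s, f i) = ∏ i ∈ s, ψ (f i) := by
  classical
  induction s using Finset.induction_on with
  | empty => simp
  | insert a s ha ih => rw [Finset.sum_insert ha, Finset.prod_insert ha, AddChar.map_add_eq_mul, ih]

theorem addChar_sum_mul {k : Type} [Field k] [Fintype k] [DecidableEq k] (ψ : AddChar k ℂ) (hψ : ψ ≠ 1) {n : ℕ}
    (F : Fin n → k) : ∑ y : Fin n → k, ψ (∑ i, F i * y i) =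
      if (∀ i, F i = 0) then ((Fintype.card k : ℂ)) ^ n else 0 := by
  have h1 : ∀ y : Fin n → k, ψ (∑ i, F i * y i) = ∏ i, ψ (F i * y i) := by
    intro y
    rw [addChar_map_sum]
  simp only [h1]
  rw [← Fintype.prod_sum (f := fun i y => ψ (F i * y))]
  have h2 : ∀ i, ∑ y, ψ (F i * y) = if F i = 0 then (Fintype.card k : ℂ) else 0 := by
    intro i
    have := AddChar.sum_mulShift (R := k) (R' := ℂ) (ψ := ψ) (F i) (AddChar.IsPrimitive.of_ne_one hψ)
    rw [Nat.cast_ite, Nat.cast_zero] at this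
    rw [← this]
    exact Finset.sum_congr rfl fun y _ => by rw [mul_comm]
  simp only [h2]
  split_ifs with h
  · simp [h]
  · push Not at h
    obtain ⟨i, hi⟩ := h
    exact Finset.prod_eq_zero (Finset.mem_univ i) (by simp [hi])


def Tform {k : Type} [Field k] {n e : ℕ} (c : (Fin e → Fin n) → k) (h : Fin e → Fin n → k) : k :=
  ∑ J : Fin e → Fin n, c J * ∏ l, h l (J l)

theorem Tform_snoc {k : Type} [Field k] {n m : ℕ} (c : (Fin (m+1) → Fin n) → k) (x : Fin m → Fin n → k)
    (y : Fin n → k) : Tform c (Fin.snoc (α := fun _ => Fin n → k) x y) =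
      ∑ i, eval (fun p : Fin m × Fin n => x p.1 p.2) (tF c i) * y i := by
  simp only [eval_tF, Tform, Finset.sum_mul]
  rw [Finset.sum_comm]
  refine Finset.sum_congr rfl fun J _ => ?_
  simp only [ite_mul, zero_mul]
  rw [Finset.sum_ite_eq]
  simp [Fin.prod_univ_castSucc, mul_assoc]

theorem bias {k : Type} [Field k] [Fintype k] (m s : ℕ) {ρ : ℕ} {n : ℕ} (c : (Fin (m + 1) → Fin n) → k)
    (hBR : ∀ (Z : Finset (Fin m × Fin n → k)), (∀ p ∈ Z, ∀ i, eval p (tF c i) = 0) →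
    Fintype.card k ^ (m * n) ≤ Z.card * Fintype.card k ^ s →
    Rk (fun f => f.totalDegree < m + 1) ρ (tens c))
    (hc : ¬ Rk (fun f => f.totalDegree < m + 1) ρ (tens c)) (ψ : AddChar k ℂ) (hψ : ψ ≠ 1) :
    (𝔼 h : Fin (m + 1) → Fin n → k, ψ (Tform c h)).re ≤ 1 / (Fintype.card k : ℝ) ^ s := by
  classical
  set q := Fintype.card k with hq
  have hq0 : 0 < q := Fintype.card_pos
  set Z : Finset (Fin m × Fin n → k) := Finset.univ.filter fun p => ∀ i, eval p (tF c i) = 0 with hZ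
  have h1 : ¬ (q ^ (m * n) ≤ Z.card * q ^ s) := fun h => hc (hBR Z (by simp [hZ]) h)
  push Not at h1
  have h2 : ∑ h : Fin (m + 1) → Fin n → k, ψ (Tform c h) = (Z.card : ℂ) * (q : ℂ) ^ n := by
    have e1 : ∑ h : Fin (m + 1) → Fin n → k, ψ (Tform c h) = ∑ p : (Fin n → k) × (Fin m → Fin n → k),
        ψ (Tform c (Fin.snoc (α := fun _ => Fin n → k) p.2 p.1)) :=
      (Fintype.sum_equiv (Fin.snocEquiv (fun _ => Fin n → k)) _ _ (fun p => rfl)).symm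
    rw [e1, Fintype.sum_prod_type_right]
    simp only [Tform_snoc, addChar_sum_mul ψ hψ]
    rw [← Finset.sum_filter, Finset.sum_const, nsmul_eq_mul]
    congr 2
    refine Finset.card_bij (fun x _ p => x p.1 p.2) ?_ ?_ ?_
    · intro x hx; simpa [hZ] using hx
    · intro x _ y _ hxy; ext i j; exact congrFun hxy (i, j)
    · intro p hp; exact ⟨fun i j => p (i, j), by simpa [hZ] using hp, rfl⟩
  rw [Fintype.expect_eq_sum_div_card, h2]
  have h3 : Fintype.card (Fin (m + 1) → Fin n → k) = q ^ (m * n) * q ^ n := by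
    simp only [Fintype.card_fun, Fintype.card_fin]
    ring
  rw [h3]
  have h4 : ((Z.card : ℂ) * (q : ℂ) ^ n / ((q ^ (m * n) * q ^ n : ℕ) : ℂ)) = (((Z.card : ℝ) / (q : ℝ) ^ (m * n) : ℝ) : ℂ) := by
    have : (q : ℂ) ≠ 0 := by exact_mod_cast hq0.ne'
    push_cast
    field_simp
  rw [h4, Complex.ofReal_re, div_le_div_iff₀ (by positivity) (by positivity), one_mul]
  exact_mod_cast h1.le

def Dd {G A : Type*} [Add G] [Sub A] : (e : ℕ) → (G → A) → (Fin e → G) → G → A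
  | 0, F, _, γ => F γ
  | e + 1, F, w, γ => Dd e (fun γ => F (γ + w 0) - F γ) (Fin.tail w) γ

theorem Dd_eq {G k : Type*} [AddCommGroup G] [CommRing k] (e : ℕ) (F : G → k) (w : Fin e → G) (γ : G) :
    Dd e F w γ = ∑ S : Finset (Fin e), (-1 : k) ^ (e - S.card) * F (γ + ∑ i ∈ S, w i) := by
  induction e generalizing F γ with
  | zero =>
    simp only [Dd, Fintype.sum_unique]
    rw [show (default : Finset (Fin 0)) = ∅ from Subsingleton.elim _ _]
    simp
  | succ e ih =>
    have key : ∀ f : Finset (Fin (e + 1)) → k, ∑ S, f S = ∑ S : Finset (Fin e), f (S.map (Fin.succEmb e)) +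
        ∑ S : Finset (Fin e), f (insert 0 (S.map (Fin.succEmb e))) := by
      intro f
      have h1 : (Finset.univ : Finset (Finset (Fin (e + 1)))) =
          (insert 0 ((Finset.univ : Finset (Fin e)).map (Fin.succEmb e))).powerset := by
        rw [← Finset.powerset_univ]
        congr 1
        ext i
        refine Fin.cases ?_ (fun i => ?_) i <;> simp
      have h2 : ((Finset.univ : Finset (Fin e)).map (Fin.succEmb e)).powerset =
          (Finset.univ : Finset (Finset (Fin e))).map (Finset.mapEmbedding (Fin.succEmb e)).toEmbedding := by
        ext S
        simp only [Finset.mem_powerset, Finset.mem_map, Finset.mem_univ, true_and]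
        constructor
        · intro h
          obtain ⟨u, _, hu⟩ := Finset.subset_map_iff.mp h
          exact ⟨u, hu.symm⟩
        · rintro ⟨u, rfl⟩
          exact Finset.map_subset_map.mpr (Finset.subset_univ _)
      rw [h1, Finset.sum_powerset_insert (by simp), h2, Finset.sum_map, Finset.sum_map]
      rfl
    rw [Dd, ih, key, ← Finset.sum_add_distrib]
    refine Finset.sum_congr rfl fun S _ => ?_
    have hS : S.card ≤ e := by simpa using Finset.card_le_univ S
    rw [Finset.card_insert_of_notMem (by simp), Finset.sum_insert (by simp), Finset.sum_map, Finset.card_map]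
    simp only [Fin.tail, Fin.coe_succEmb, Nat.reduceSubDiff]
    rw [show e + 1 - S.card = (e - S.card) + 1 by omega, add_right_comm, add_assoc γ, ← add_assoc γ]
    ring

end HR

open MvPolynomial
namespace HR
set_option linter.unusedSectionVars false
open scoped BigOperators ComplexConjugate

theorem re_expect {β : Type*} [Fintype β] (f : β → ℂ) : (𝔼 b, f b).re = 𝔼 b, (f b).re := by
  rw [Fintype.expect_eq_sum_div_card, Fintype.expect_eq_sum_div_card]
  simp

theorem norm_expect_le {β : Type*} [Fintype β] (f : β → ℂ) : ‖𝔼 b, f b‖ ≤ 𝔼 b, ‖f b‖ := by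
  rw [Fintype.expect_eq_sum_div_card, Fintype.expect_eq_sum_div_card, norm_div, Complex.norm_natCast]
  gcongr
  exact norm_sum_le _ _

theorem vdc_step {G H : Type*} [AddCommGroup G] [Fintype G] [AddCommGroup H] [Fintype H] (φ : H →+ G)
    (u : G → ℂ) (hu : ∀ γ, ‖u γ‖ ≤ 1) (hi : ∀ γ h, u (γ + φ h) = u γ) (f : G → ℂ) :
    ‖𝔼 γ, u γ * f γ‖ ^ 2 ≤ 𝔼 h, (𝔼 γ, conj (f γ) * f (γ + φ h)).re := by
  have h1 : 𝔼 γ, u γ * f γ = 𝔼 γ, u γ * 𝔼 h, f (γ + φ h) := by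
    have e1 : ∀ h, 𝔼 γ, u γ * f γ = 𝔼 γ, u γ * f (γ + φ h) := by
      intro h
      refine (Fintype.expect_equiv (Equiv.addRight (φ h)) _ _ (fun γ => ?_)).symm
      simp [hi]
    calc 𝔼 γ, u γ * f γ = 𝔼 h : H, 𝔼 γ, u γ * f γ := by
          rw [Fintype.expect_const]
      _ = 𝔼 h : H, 𝔼 γ, u γ * f (γ + φ h) := Finset.expect_congr rfl fun h _ => e1 h
      _ = _ := by
        rw [Finset.expect_comm]
        simp only [Finset.mul_expect]
  rw [h1]
  have h2 : ‖𝔼 γ, u γ * 𝔼 h, f (γ + φ h)‖ ≤ 𝔼 γ, ‖𝔼 h, f (γ + φ h)‖ := by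
    refine (norm_expect_le _).trans (expect_le' _ _ fun γ => ?_)
    rw [norm_mul]
    exact mul_le_of_le_one_left (norm_nonneg _) (hu γ)
  refine (pow_le_pow_left₀ (norm_nonneg _) h2 2).trans ((expect_pow_le _ (fun _ => norm_nonneg _) 2).trans (le_of_eq ?_))
  rw [← re_expect]
  have h3 : ∀ γ, ‖𝔼 h, f (γ + φ h)‖ ^ 2 = (𝔼 h', 𝔼 h, conj (f (γ + φ h')) * f (γ + φ h)).re := by
    intro γ
    rw [← Complex.normSq_eq_norm_sq]
    have : 𝔼 h', 𝔼 h, conj (f (γ + φ h')) * f (γ + φ h) = conj (𝔼 h, f (γ + φ h)) * 𝔼 h, f (γ + φ h) := by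
      rw [map_expect, Finset.expect_mul]
      simp only [Finset.mul_expect]
    rw [this, ← Complex.normSq_eq_conj_mul_self, Complex.ofReal_re]
  simp only [h3]
  rw [← re_expect]
  congr 1
  rw [Finset.expect_comm]
  have h4 : ∀ h' : H, 𝔼 γ, 𝔼 h, conj (f (γ + φ h')) * f (γ + φ h) = 𝔼 h, 𝔼 γ, conj (f γ) * f (γ + φ h) := by
    intro h'
    rw [Finset.expect_comm]
    refine (Fintype.expect_equiv (Equiv.addRight h') _ _ (fun h => ?_)).symm
    refine (Fintype.expect_equiv (Equiv.addRight (φ h')) _ _ (fun γ => ?_)).symm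
    simp only [Equiv.coe_addRight, map_add]
    rw [add_assoc, add_comm (φ h')]
  simp only [h4]
  rw [Fintype.expect_const]

theorem addChar_norm {A : Type*} [AddCommGroup A] [Finite A] (ψ : AddChar A ℂ) (a : A) : ‖ψ a‖ = 1 :=
  AddChar.norm_apply ψ a

theorem addChar_conj_mul {A : Type*} [AddCommGroup A] [Finite A] (ψ : AddChar A ℂ) (a b : A) :
    conj (ψ a) * ψ b = ψ (b - a) := by
  rw [← AddChar.map_neg_eq_conj, ← AddChar.map_add_eq_mul]
  congr 1; abel

theorem vdc {G H k : Type*} [AddCommGroup G] [Fintype G] [AddCommGroup H] [Fintype H] [AddCommGroup k] [Finite k]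
    (ψ : AddChar k ℂ) (m : ℕ) (φ : Fin (m + 1) → H →+ G)
    (u : G → ℂ) (hu : ∀ γ, ‖u γ‖ ≤ 1) (hi : ∀ γ h, u (γ + φ 0 h) = u γ) (F : G → k) :
    ‖𝔼 γ, u γ * ψ (F γ)‖ ^ 2 ^ (m + 1) ≤ 𝔼 h : Fin (m + 1) → H, (𝔼 γ, ψ (Dd (m + 1) F (fun i => φ i (h i)) γ)).re := by
  induction m generalizing u F with
  | zero =>
    refine (vdc_step (φ 0) u hu hi _).trans (le_of_eq ?_)
    refine (Fintype.expect_equiv (Equiv.funUnique (Fin 1) H) _ _ (fun h => ?_)).symm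
    simp only [addChar_conj_mul]
    simp [Dd]
  | succ m ih =>
    have h1 := vdc_step (φ 0) u hu hi (fun γ => ψ (F γ))
    simp only [addChar_conj_mul] at h1
    rw [pow_succ' 2, pow_mul]
    refine (pow_le_pow_left₀ (by positivity) h1 _).trans ?_
    have h2 : 𝔼 h, (𝔼 γ, ψ (F (γ + φ 0 h) - F γ)).re ≤ 𝔼 h, ‖𝔼 γ, 1 * ψ (F (γ + φ 0 h) - F γ)‖ := by
      refine expect_le' _ _ fun h => ?_
      simp only [one_mul]
      exact Complex.re_le_norm _
    refine (pow_le_pow_left₀ (le_trans (by positivity) h1) h2 _).trans ?_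
    refine (expect_pow_le _ (fun _ => norm_nonneg _) _).trans ?_
    rw [expect_cons, Finset.expect_comm]
    refine expect_le' _ _ fun h => ?_
    refine (ih (fun i => φ i.succ) (fun _ => 1) (by simp) (by simp) _).trans (le_of_eq ?_)
    rfl

end HR

open MvPolynomial
namespace HR
set_option linter.unusedSectionVars false
open scoped BigOperators ComplexConjugate

def Adapted {k : Type} [Field k] {n c : ℕ} (P : Fin c → MvPolynomial (Fin n) k) (d : Fin c → ℕ) (L : ℕ) : Prop :=
  ∀ b : Fin c → k, ∀ e, (∃ i, b i ≠ 0 ∧ d i = e) → (∀ i, b i ≠ 0 → d i ≤ e) →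
    ¬ Rk (fun f => f.totalDegree < e) L (multiDiff e (∑ i, C (b i) * P i))

theorem pow_le_of_prod {k R : Type*} [CommRing k] [CommRing R] [Algebra k R] (U : Submodule k R) (m : ℕ) :
    ∀ M : Submodule k R, (∀ u : Fin m → R, (∀ l, u l ∈ U) → ∏ l, u l ∈ M) → U ^ m ≤ M := by
  induction m with
  | zero =>
    intro M h
    rw [pow_zero, Submodule.one_le]
    simpa using h (fun _ => 0) (fun l => l.elim0)
  | succ m ih =>
    intro M h
    rw [pow_succ', Submodule.mul_le]
    intro a ha b hb
    have : U ^ m ≤ M.comap (LinearMap.mulLeft k a) := by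
      refine ih _ fun u hu => ?_
      have := h (Fin.cons a u) (fun l => by refine Fin.cases ?_ ?_ l <;> simp [ha, hu])
      simpa [Fin.prod_univ_succ] using this
    exact this hb

theorem exists_prod_ne {k R : Type*} [Field k] [CommRing R] [Algebra k R] (U1 U : Submodule k R) (m : ℕ)
    (Λ : R →ₗ[k] k) (x : R) (hx : x ∈ U1 * U ^ m) (hΛ : Λ x ≠ 0) :
    ∃ u : Fin (m + 1) → R, u 0 ∈ U1 ∧ (∀ l : Fin m, u l.succ ∈ U) ∧ Λ (∏ l, u l) ≠ 0 := by
  by_contra hcon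
  push Not at hcon
  have : U1 * U ^ m ≤ LinearMap.ker Λ := by
    rw [Submodule.mul_le]
    intro a ha b hb
    have : U ^ m ≤ (LinearMap.ker Λ).comap (LinearMap.mulLeft k a) := by
      refine pow_le_of_prod U m _ fun u hu => ?_
      have := hcon (Fin.cons a u) (by simpa using ha) (by simpa using hu)
      simpa [Fin.prod_univ_succ] using this
    exact this hb
  exact hΛ (this hx)

theorem isTens_sum {k : Type} [Field k] {n c e : ℕ} (P : Fin c → MvPolynomial (Fin n) k)
    (b : Fin c → k) (t : Fin c → (Fin e → Fin n) → k)
    (ht : ∀ i, b i ≠ 0 → IsTens (t i) (fun R _ _ γ w => ∑ S : Finset (Fin e), (-1:R)^(e - S.card) *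
      aeval (fun j => γ j + ∑ i ∈ S, w i j) (P i))) :
    IsTens (fun J => ∑ i, b i * t i J) (fun R _ _ γ w => ∑ S : Finset (Fin e), (-1:R)^(e - S.card) *
      aeval (fun j => γ j + ∑ i ∈ S, w i j) (∑ i, C (b i) * P i)) := by
  intro R _ _ γ w
  have h1 : ∀ i, algebraMap k R (b i) * (∑ S : Finset (Fin e), (-1:R)^(e - S.card) *
      aeval (fun j => γ j + ∑ i ∈ S, w i j) (P i)) = algebraMap k R (b i) *
      ∑ J, algebraMap k R (t i J) * ∏ l, w l (J l) := by
    intro i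
    by_cases hb : b i = 0
    · simp [hb]
    · have := ht i hb R γ w
      simp only at this
      rw [this]
  simp only [map_sum, map_mul, aeval_C, Finset.mul_sum, Finset.sum_mul] at h1 ⊢
  rw [Finset.sum_comm, Finset.sum_comm (s := (Finset.univ : Finset (Fin e → Fin n)))]
  refine Finset.sum_congr rfl fun i _ => ?_
  simp only [← mul_assoc] at h1 ⊢
  rw [← h1 i]
  refine Finset.sum_congr rfl fun S _ => ?_
  ring

theorem char_bound {k : Type} [Field k] [Fintype k] {R : Type} [CommRing R] [Algebra k R] {n c : ℕ}
    (P : Fin c → MvPolynomial (Fin n) k) (d : Fin c → ℕ) (hd : ∀ i, (P i).totalDegree ≤ d i)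
    (m s E ρ : ℕ) (hm : m + 1 ≤ E)
    (hBR : ∀ (t : (Fin (m + 1) → Fin n) → k) (Z : Finset (Fin m × Fin n → k)), (∀ p ∈ Z, ∀ i, eval p (tF t i) = 0) →
      Fintype.card k ^ (m * n) ≤ Z.card * Fintype.card k ^ (s * 2 ^ E) →
      Rk (fun f => f.totalDegree < m + 1) ρ (tens t))
    (hP : Adapted P d ρ) (ψ : AddChar k ℂ) (hψ : ψ ≠ 1)
    (U : Submodule k R) [Fintype U] (s0 : Fin n → R)
    (Λ : Fin c → R →ₗ[k] k) (hΛ : ∀ i, Λ i ≠ 0 → d i ≤ m + 1)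
    (u : Fin (m + 1) → R) (hu : ∀ l, u l ∈ U) (i0 : Fin c) (hi0 : d i0 = m + 1) (hΛ0 : Λ i0 (∏ l, u l) ≠ 0)
    (ι : (Fin n → U) → ℂ) (hι : ∀ γ, ‖ι γ‖ ≤ 1)
    (hi : ∀ γ (h : Fin n → k), ι (γ + fun j => h j • (⟨u 0, hu 0⟩ : U)) = ι γ) :
    ‖𝔼 γ, ι γ * ψ (∑ i, Λ i (aeval (fun j => s0 j + (γ j : R)) (P i)))‖ ≤ 1 / (Fintype.card k : ℝ) ^ s := by
  classical
  set b : Fin c → k := fun i => Λ i (∏ l, u l) with hb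
  have hbΛ : ∀ i, b i ≠ 0 → Λ i ≠ 0 := fun i h h' => h (by simp [hb, h'])
  have hex : ∀ i, ∃ t : (Fin (m + 1) → Fin n) → k, Λ i ≠ 0 → 
      IsTens t (fun R _ _ γ w => ∑ S : Finset (Fin (m + 1)), (-1:R)^(m + 1 - S.card) *
        aeval (fun j => γ j + ∑ i ∈ S, w i j) (P i)) := by
    intro i
    by_cases h : Λ i = 0
    · exact ⟨0, fun h' => absurd h h'⟩
    · obtain ⟨t, ht⟩ := exists_tensor (e := m + 1) (P i) ((hd i).trans (hΛ i h))
      exact ⟨t, fun _ => ht⟩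
  choose t ht using hex
  set tb : (Fin (m + 1) → Fin n) → k := fun J => ∑ i, b i * t i J with htb
  have hmd := multiDiff_eq _ _ (isTens_sum P b t (fun i hi => ht i (hbΛ i hi)))
  have hnR := hP b (m + 1) ⟨i0, hΛ0, hi0⟩ (fun i hi => hΛ i (hbΛ i hi))
  rw [hmd] at hnR
  have hbias := bias m (s * 2 ^ E) tb (hBR tb) hnR ψ hψ
  let φ : Fin (m + 1) → (Fin n → k) →+ (Fin n → U) := fun l =>
    { toFun := fun h j => h j • (⟨u l, hu l⟩ : U)
      map_zero' := by ext; simp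
      map_add' := fun x y => by ext; simp [add_smul] }
  have hv := vdc ψ m φ ι hι hi (fun γ => ∑ i, Λ i (aeval (fun j => s0 j + (γ j : R)) (P i)))
  have hD : ∀ (h : Fin (m + 1) → Fin n → k) (γ : Fin n → U),
      Dd (m + 1) (fun γ : Fin n → U => ∑ i, Λ i (aeval (fun j => s0 j + (γ j : R)) (P i))) (fun i => φ i (h i)) γ =
        Tform tb h := by
    intro h γ
    rw [Dd_eq]
    simp only [Finset.mul_sum]
    rw [Finset.sum_comm]
    have h1 : ∀ i, ∑ S : Finset (Fin (m + 1)), (-1 : k) ^ (m + 1 - S.card) *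
        Λ i (aeval (fun j => s0 j + (((γ + ∑ i ∈ S, φ i (h i)) j : U) : R)) (P i)) =
        b i * ∑ J, t i J * ∏ l, h l (J l) := by
      intro i
      by_cases hz : Λ i = 0
      · simp [hb, hz]
      have h2 := ht i hz R (fun j => s0 j + (γ j : R)) (fun l j => algebraMap k R (h l j) * u l)
      simp only at h2
      have h3 := congrArg (Λ i) h2
      rw [map_sum, map_sum] at h3
      rw [Finset.mul_sum]
      have h4 : ∀ S : Finset (Fin (m + 1)), (fun j => s0 j + (((γ + ∑ i ∈ S, φ i (h i)) j : U) : R)) =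
          fun j => s0 j + (γ j : R) + ∑ l ∈ S, algebraMap k R (h l j) * u l := by
        intro S; funext j
        simp [φ, Finset.sum_apply, add_assoc, Algebra.smul_def]
      simp only [h4]
      have h5 : ∀ (j : ℕ) (x : R), Λ i ((-1 : R) ^ j * x) = (-1 : k) ^ j * Λ i x := by
        intro j x
        have : (-1 : R) ^ j * x = ((-1 : k) ^ j) • x := by
          rw [Algebra.smul_def]; simp
        rw [this, map_smul, smul_eq_mul]
      simp only [h5] at h3
      rw [h3]
      refine Finset.sum_congr rfl fun J _ => ?_
      rw [Finset.prod_mul_distrib, ← map_prod, ← mul_assoc, ← map_mul, ← Algebra.smul_def, map_smul, smul_eq_mul]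
      simp only [hb]; ring
    simp only [h1, Tform, htb, Finset.mul_sum, Finset.sum_mul]
    rw [Finset.sum_comm]
    simp only [mul_assoc]
  simp only [hD, Fintype.expect_const] at hv
  rw [← re_expect] at hv
  have hq1 : (1 : ℝ) ≤ Fintype.card k := by exact_mod_cast Fintype.card_pos
  have h6 := hv.trans hbias
  refine le_of_not_gt fun hlt => ?_
  have h7 : (1 / (Fintype.card k : ℝ) ^ s) ^ 2 ^ (m + 1) < 1 / (Fintype.card k : ℝ) ^ (s * 2 ^ E) :=
    (pow_lt_pow_left₀ hlt (by positivity) (by positivity)).trans_le h6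
  rw [div_pow, one_pow, ← pow_mul, one_div_lt_one_div (by positivity) (by positivity)] at h7
  refine absurd h7 (not_lt.mpr (pow_le_pow_right₀ hq1 ?_))
  gcongr
  norm_num

end HR

open MvPolynomial
namespace HR
set_option linter.unusedSectionVars false
open scoped BigOperators ComplexConjugate

theorem dual_sum {k V : Type} [Field k] [Fintype k] [AddCommGroup V] [Module k V] [Finite V]
    [Fintype (Module.Dual k V)] (ψ : AddChar k ℂ) (hψ : ψ ≠ 1) (v : V) [Decidable (v = 0)] :
    ∑ Λ : Module.Dual k V, ψ (Λ v) = if v = 0 then (Nat.card V : ℂ) else 0 := by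
  classical
  let ev : Module.Dual k V →+ k := { toFun := fun Λ => Λ v, map_zero' := rfl, map_add' := fun _ _ => rfl }
  have h := AddChar.sum_eq_ite (ψ.compAddMonoidHom ev)
  have hc : Fintype.card (Module.Dual k V) = Nat.card V := by
    have hfd : Module.Finite k V := Module.Finite.of_finite
    rw [← Nat.card_eq_fintype_card]
    rw [Module.natCard_eq_pow_finrank (K := k) (V := V), Module.natCard_eq_pow_finrank (K := k), Subspace.dual_finrank_eq]
  have h1 : ∑ Λ : Module.Dual k V, ψ (Λ v) = ∑ Λ, (ψ.compAddMonoidHom ev) Λ := rfl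
  rw [h1, h, hc]
  have h2 : ψ.compAddMonoidHom ev = 0 ↔ v = 0 := by
    constructor
    · intro h0
      by_contra hv
      obtain ⟨Λ, hΛ⟩ := exists_functional' (k := k) v hv
      apply hψ
      ext a
      have := congrArg (fun χ : AddChar _ ℂ => χ (a • Λ)) h0
      simpa [ev, hΛ] using this
    · rintro rfl
      ext Λ
      simp [ev]
  simp only [h2]

def EQP (E s L : ℕ) : Prop := ∀ (k : Type) [Field k] [Fintype k] (c n : ℕ)
    (P : Fin c → MvPolynomial (Fin n) k) (d : Fin c → ℕ), (∀ i, 1 ≤ d i) → (∀ i, d i ≤ E) →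
    (∀ i, (P i).totalDegree ≤ d i) → Adapted P d L →
    ∀ (R : Type) [CommRing R] [Algebra k R] (U1 U : Submodule k R) [Fintype U] (s0 : Fin n → R) (f : Fin c → R)
      (H0 : Fin c → Submodule k R) [∀ i, Finite (H0 i)] (Y : Finset (Fin n → U)),
      U1 ≤ U → (∀ i, H0 i ≤ U1 * U ^ (d i - 1)) →
      (∀ γ ∈ Y, ∀ δ : Fin n → U, (∀ j, (δ j : R) ∈ U1) → γ + δ ∈ Y) →
      (∀ γ ∈ Y, ∀ i, aeval (fun j => s0 j + (γ j : R)) (P i) - f i ∈ H0 i) →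
      ∀ Y' : Finset (Fin n → U), (∀ γ ∈ Y, (∀ i, aeval (fun j => s0 j + (γ j : R)) (P i) = f i) → γ ∈ Y') →
      Fintype.card k ^ s * Y.card ≤ Fintype.card k ^ s * Y'.card * (∏ i, Nat.card (H0 i)) +
        (∏ i, Nat.card (H0 i)) * Fintype.card U ^ n

theorem EQ (E s : ℕ) : ∃ L : ℕ, EQP E s L := by
  classical
  have hBR := fun m => BR m (s * 2 ^ E)
  choose ρ hρ using hBR
  refine ⟨(Finset.range E).sup ρ, ?_⟩
  intro k _ _ c n P d hd1 hdE hdeg hP R _ _ U1 U _ s0 f H0 _ Y hU hH0 hY hYP Y' hY'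
  obtain ⟨ψ, hψ⟩ := exists_addChar k
  set q := Fintype.card k with hq
  have hq0 : 0 < q := Fintype.card_pos
  have hfin : ∀ i, Finite (Module.Dual k (H0 i)) := fun i => by
    have : Finite (H0 i → k) := Pi.finite
    exact Finite.of_injective (fun (Λ : Module.Dual k (H0 i)) x => Λ x) DFunLike.coe_injective
  let _ : ∀ i, Fintype (Module.Dual k (H0 i)) := fun i => Fintype.ofFinite _

  -- the error vector
  let v : (Fin n → U) → ∀ i, H0 i := fun γ i => if h : aeval (fun j => s0 j + (γ j : R)) (P i) - f i ∈ H0 i then ⟨_, h⟩ else 0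
  have hv : ∀ γ ∈ Y, ∀ i, (v γ i : R) = aeval (fun j => s0 j + (γ j : R)) (P i) - f i := by
    intro γ hγ i
    simp only [v, dif_pos (hYP γ hγ i)]
  set h0 : ℕ := ∏ i, Nat.card (H0 i) with hh0
  set Sol := Y.filter fun γ => ∀ i, v γ i = 0 with hSol
  have hSolY : Sol.card ≤ Y'.card := by
    refine Finset.card_le_card fun γ hγ => ?_
    rw [hSol, Finset.mem_filter] at hγ
    refine hY' γ hγ.1 fun i => ?_
    have := hv γ hγ.1 i
    rw [hγ.2 i] at this
    exact (sub_eq_zero.mp this.symm)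
  have hcount : ∑ Λ : ∀ i, Module.Dual k (H0 i), ∑ γ ∈ Y, ψ (∑ i, Λ i (v γ i)) = (h0 : ℂ) * Sol.card := by
    rw [Finset.sum_comm]
    have h1 : ∀ γ, ∑ Λ : ∀ i, Module.Dual k (H0 i), ψ (∑ i, Λ i (v γ i)) = if (∀ i, v γ i = 0) then (h0 : ℂ) else 0 := by
      intro γ
      simp only [addChar_map_sum]
      rw [← Fintype.prod_sum (f := fun i (Λ : Module.Dual k (H0 i)) => ψ (Λ (v γ i)))]
      simp only [dual_sum ψ hψ]
      split_ifs with h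
      · simp [h, hh0]
      · push Not at h
        obtain ⟨i, hi⟩ := h
        exact Finset.prod_eq_zero (Finset.mem_univ i) (by simp [hi])
    simp only [h1]
    rw [← Finset.sum_filter, Finset.sum_const, nsmul_eq_mul, mul_comm]
  have hbound : ∀ Λ : ∀ i, Module.Dual k (H0 i), Λ ≠ 0 →
      ‖∑ γ ∈ Y, ψ (∑ i, Λ i (v γ i))‖ ≤ (Fintype.card U : ℝ) ^ n * (1 / (q : ℝ) ^ s) := by
    intro Λ hΛ
    have hext : ∀ i, ∃ g : R →ₗ[k] k, (∀ x : H0 i, g x = Λ i x) ∧ (Λ i = 0 → g = 0) := by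
      intro i
      by_cases hz : Λ i = 0
      · exact ⟨0, by simp [hz], fun _ => rfl⟩
      · obtain ⟨g, hg⟩ := LinearMap.exists_extend (Λ i)
        exact ⟨g, fun x => by rw [← hg]; rfl, fun h => absurd h hz⟩
    choose g hg hg0 using hext
    obtain ⟨i1, hi1⟩ : ∃ i, Λ i ≠ 0 := by
      by_contra hcon; push Not at hcon; exact hΛ (funext hcon)
    obtain ⟨i0, hi0, hmax⟩ := Finset.exists_max_image (Finset.univ.filter fun i => Λ i ≠ 0) d ⟨i1, by simpa using hi1⟩
    simp only [Finset.mem_filter, Finset.mem_univ, true_and] at hi0 hmax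
    obtain ⟨m, hm⟩ : ∃ m, d i0 = m + 1 := ⟨d i0 - 1, by have := hd1 i0; omega⟩
    obtain ⟨x, hx⟩ : ∃ x, Λ i0 x ≠ 0 := by
      by_contra hcon; push Not at hcon; exact hi0 (LinearMap.ext hcon)
    obtain ⟨u, hu0, hu1, hu2⟩ := exists_prod_ne U1 U m (g i0) x (by
      have := hH0 i0 x.2
      rwa [hm, Nat.add_sub_cancel] at this) (by rwa [hg])
    have hu : ∀ l, u l ∈ U := fun l => Fin.cases (hU hu0) hu1 l
    have hcb := char_bound P d hdeg m s E ((Finset.range E).sup ρ) (hm ▸ hdE i0) (fun t Z h1 h2 =>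
      (hρ m k n t Z h1 h2).mono (Finset.le_sup (f := ρ) (Finset.mem_range.mpr (by have := hdE i0; omega))) (by simp))
      hP ψ hψ U s0 g (fun i hi => by
        have := hmax i (fun h => hi (hg0 i h))
        omega) u hu i0 hm hu2 (fun γ => if γ ∈ Y then 1 else 0) (fun γ => by split_ifs <;> simp) (fun γ h => by
          have hmem : ∀ (c : k), ((c • (⟨u 0, hu 0⟩ : U) : U) : R) ∈ U1 := fun c => U1.smul_mem c hu0
          have : (γ + fun j => h j • (⟨u 0, hu 0⟩ : U)) ∈ Y ↔ γ ∈ Y := by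
            constructor
            · intro hγ
              have := hY _ hγ (fun j => (- h j) • (⟨u 0, hu 0⟩ : U)) (fun j => hmem _)
              convert this using 1
              funext j
              simp only [Pi.add_apply]
              rw [add_assoc, ← add_smul, add_neg_cancel, zero_smul, add_zero]
            · intro hγ
              exact hY _ hγ _ (fun j => hmem _)
          simp only [this])
    have h2 : ∑ γ ∈ Y, ψ (∑ i, Λ i (v γ i)) = (Fintype.card (Fin n → U) : ℂ) * (ψ (- ∑ i, g i (f i)) *
        𝔼 γ, (if γ ∈ Y then 1 else 0) * ψ (∑ i, g i (aeval (fun j => s0 j + (γ j : R)) (P i)))) := by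
      rw [Fintype.expect_eq_sum_div_card, mul_left_comm, mul_div_cancel₀ _ (by exact_mod_cast Fintype.card_ne_zero),
        Finset.mul_sum]
      simp only [ite_mul, one_mul, zero_mul, mul_ite, mul_zero]
      rw [← Finset.sum_filter, Finset.filter_mem_eq_inter, Finset.univ_inter]
      refine Finset.sum_congr rfl fun γ hγ => ?_
      rw [← AddChar.map_add_eq_mul]
      congr 1
      have : ∀ i, Λ i (v γ i) = g i (aeval (fun j => s0 j + (γ j : R)) (P i)) - g i (f i) := by
        intro i
        rw [← hg, hv γ hγ, map_sub]
      simp only [this, Finset.sum_sub_distrib]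
      ring
    rw [h2, norm_mul, norm_mul, addChar_norm, one_mul, Complex.norm_natCast]
    have : (Fintype.card (Fin n → U) : ℝ) = (Fintype.card U : ℝ) ^ n := by simp
    rw [this]
    gcongr
  -- combine
  have hsplit : (h0 : ℂ) * Sol.card = Y.card + ∑ Λ ∈ (Finset.univ : Finset (∀ i, Module.Dual k (H0 i))).erase 0,
      ∑ γ ∈ Y, ψ (∑ i, Λ i (v γ i)) := by
    rw [← hcount, ← Finset.add_sum_erase _ _ (Finset.mem_univ (0 : ∀ i, Module.Dual k (H0 i)))]
    simp
  have hcard : Fintype.card (∀ i, Module.Dual k (H0 i)) = h0 := by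
    rw [Fintype.card_pi, hh0]
    refine Finset.prod_congr rfl fun i _ => ?_
    have hfd : Module.Finite k (H0 i) := Module.Finite.of_finite
    rw [← Nat.card_eq_fintype_card]
    rw [Module.natCard_eq_pow_finrank (K := k) (V := H0 i), Module.natCard_eq_pow_finrank (K := k), Subspace.dual_finrank_eq]
  have hfinal : (Y.card : ℝ) ≤ h0 * Sol.card + h0 * ((Fintype.card U : ℝ) ^ n * (1 / (q : ℝ) ^ s)) := by
    have e1 : ‖((Y.card : ℂ))‖ ≤ ‖(h0 : ℂ) * Sol.card‖ + ‖∑ Λ ∈ (Finset.univ : Finset (∀ i, Module.Dual k (H0 i))).erase 0,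
      ∑ γ ∈ Y, ψ (∑ i, Λ i (v γ i))‖ := by
      rw [show (Y.card : ℂ) = (h0 : ℂ) * Sol.card - ∑ Λ ∈ (Finset.univ : Finset (∀ i, Module.Dual k (H0 i))).erase 0,
        ∑ γ ∈ Y, ψ (∑ i, Λ i (v γ i)) by rw [hsplit]; ring]
      exact norm_sub_le _ _
    have e2 : ‖∑ Λ ∈ (Finset.univ : Finset (∀ i, Module.Dual k (H0 i))).erase 0,
      ∑ γ ∈ Y, ψ (∑ i, Λ i (v γ i))‖ ≤ h0 * ((Fintype.card U : ℝ) ^ n * (1 / (q : ℝ) ^ s)) := by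
      refine (norm_sum_le_of_le _ (fun Λ hΛ => hbound Λ (Finset.ne_of_mem_erase hΛ))).trans ?_
      rw [Finset.sum_const, nsmul_eq_mul]
      gcongr
      rw [← hcard]
      exact Finset.card_le_univ _
    rw [norm_mul, Complex.norm_natCast, Complex.norm_natCast, Complex.norm_natCast] at e1
    linarith
  have hqs : (0 : ℝ) < (q : ℝ) ^ s := by positivity
  have hfin2 : (q : ℝ) ^ s * Y.card ≤ (q : ℝ) ^ s * Sol.card * h0 + h0 * (Fintype.card U : ℝ) ^ n := by
    have := mul_le_mul_of_nonneg_left hfinal hqs.le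
    refine this.trans (le_of_eq ?_)
    field_simp
  have hfin3 : q ^ s * Y.card ≤ q ^ s * Sol.card * h0 + h0 * Fintype.card U ^ n := by exact_mod_cast hfin2
  refine hfin3.trans ?_
  gcongr

end HR

open MvPolynomial
namespace HR
set_option linter.unusedSectionVars false
open scoped BigOperators

theorem pow_mono_of_one {k R : Type*} [CommRing k] [CommRing R] [Algebra k R] (U : Submodule k R)
    (h1 : (1 : R) ∈ U) {m m' : ℕ} (h : m ≤ m') : U ^ m ≤ U ^ m' :=
  pow_le_pow_right₀ (Submodule.one_le.mpr h1) h

theorem aeval_mem_pow {k R : Type*} [CommRing k] [CommRing R] [Algebra k R] (U : Submodule k R)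
    (h1 : (1 : R) ∈ U) {σ : Type*} (γ : σ → R) (hγ : ∀ j, γ j ∈ U) (P : MvPolynomial σ k) {m : ℕ}
    (hP : P.totalDegree ≤ m) : aeval γ P ∈ U ^ m := by
  rw [aeval_def, eval₂_eq]
  refine Submodule.sum_mem _ fun e he => ?_
  rw [← Algebra.smul_def]
  refine Submodule.smul_mem _ _ ?_
  have h2 : (∏ i ∈ e.support, γ i ^ e i) ∈ U ^ (e.degree) := by
    rw [Finsupp.degree_apply]
    have : ∀ s : Finset σ, ∏ i ∈ s, γ i ^ e i ∈ U ^ (∑ i ∈ s, e i) := by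
      classical
      intro s
      induction s using Finset.induction_on with
      | empty => simp [Submodule.one_le.mp]
      | insert a s ha ih =>
        rw [Finset.prod_insert ha, Finset.sum_insert ha, pow_add]
        exact Submodule.mul_mem_mul (Submodule.pow_mem_pow _ (hγ a) _) ih
    exact this _
  refine pow_mono_of_one U h1 (le_trans ?_ hP) h2
  exact le_totalDegree he

theorem pow_span_le {k R : Type*} [CommRing k] [CommRing R] [Algebra k R] {M : ℕ} (w : Fin M → R) (m : ℕ) :
    (Submodule.span k (Set.range w)) ^ m = Submodule.span k (Set.range fun f : Fin m → Fin M => ∏ l, w (f l)) := by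
  apply le_antisymm
  · rw [Submodule.span_pow]
    refine Submodule.span_le.mpr fun x hx => ?_
    rw [Set.mem_pow] at hx
    obtain ⟨f, rfl⟩ := hx
    rw [List.prod_ofFn]
    refine Submodule.subset_span ?_
    choose g hg using fun i => (f i).2
    exact ⟨g, Finset.prod_congr rfl fun i _ => hg i⟩
  · rw [Submodule.span_le]
    rintro _ ⟨f, rfl⟩
    rw [Submodule.span_pow]
    refine Submodule.subset_span ?_
    rw [Set.mem_pow]
    exact ⟨fun l => ⟨w (f l), f l, rfl⟩, by rw [List.prod_ofFn]⟩

theorem finite_span {k R : Type*} [Field k] [Fintype k] [AddCommGroup R] [Module k R] {M : Type*} [Fintype M] (w : M → R) :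
    Finite (Submodule.span k (Set.range w)) ∧ Nat.card (Submodule.span k (Set.range w)) ≤ Fintype.card k ^ Fintype.card M := by
  have : Module.Finite k (Submodule.span k (Set.range w)) := Module.Finite.span_of_finite k (Set.finite_range w)
  refine ⟨Module.finite_of_finite k, ?_⟩
  rw [Module.natCard_eq_pow_finrank (K := k), Nat.card_eq_fintype_card]
  exact Nat.pow_le_pow_right Fintype.card_pos (finrank_range_le_card w)

theorem finite_pow_span {k R : Type*} [Field k] [Fintype k] [CommRing R] [Algebra k R] {M : ℕ} (w : Fin M → R) (m : ℕ) :
    Finite ↥((Submodule.span k (Set.range w)) ^ m) ∧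
      Nat.card ↥((Submodule.span k (Set.range w)) ^ m) ≤ Fintype.card k ^ (M ^ m) := by
  rw [pow_span_le]
  simpa using finite_span (k := k) (fun f : Fin m → Fin M => ∏ l, w (f l))

theorem card_le_of_le {k R : Type*} [Field k] [AddCommGroup R] [Module k R] {A B : Submodule k R} (h : A ≤ B) [Finite B] :
    Finite A ∧ Nat.card A ≤ Nat.card B :=
  ⟨Finite.of_injective _ (Submodule.inclusion_injective h),
    Nat.card_le_card_of_injective _ (Submodule.inclusion_injective h)⟩

theorem fibre_card {G H : Type*} [AddCommGroup G] [AddCommGroup H] [Fintype G] [Fintype H] [DecidableEq H] (Φ : G →+ H)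
    (hΦ : Function.Surjective Φ) (S : Finset H) :
    (Finset.univ.filter fun g => Φ g ∈ S).card * Fintype.card H = S.card * Fintype.card G := by
  have h1 : ∀ y : H, (Finset.univ.filter fun g => Φ g = y).card = (Finset.univ.filter fun g => Φ g = 0).card := by
    intro y
    obtain ⟨g, rfl⟩ := hΦ y
    refine (Finset.card_bij (fun x _ => x + g) ?_ ?_ ?_).symm
    · intro x hx; simpa using hx
    · intro x _ y _ h; simpa using h
    · intro x hx; exact ⟨x - g, by simpa [sub_eq_zero] using hx, by simp⟩
  have h2 : (Finset.univ.filter fun g => Φ g ∈ S).card = S.card * (Finset.univ.filter fun g => Φ g = 0).card := by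
    rw [Finset.card_eq_sum_card_fiberwise (f := Φ) (t := S) (fun x hx => by simpa using hx)]
    rw [← smul_eq_mul, ← Finset.sum_const]
    refine Finset.sum_congr rfl fun y hy => ?_
    rw [← h1 y]
    congr 1
    ext x
    simp only [Finset.mem_filter, Finset.mem_univ, true_and]
    exact ⟨fun h => h.2, fun h => ⟨h ▸ hy, h⟩⟩
  have h3 : Fintype.card G = Fintype.card H * (Finset.univ.filter fun g => Φ g = 0).card := by
    have := Finset.card_eq_sum_card_fiberwise (f := Φ) (s := Finset.univ) (t := Finset.univ) (fun x hx => by simp)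
    simp only [h1, Finset.sum_const, smul_eq_mul] at this
    exact this
  rw [h2, h3]; ring

/-- a polynomial of small degree vanishing everywhere is zero -/
theorem eq_zero_of_vanish {k : Type*} [Field k] [Fintype k] {N : ℕ} (f : MvPolynomial (Fin N) k)
    (hf : f.totalDegree < Fintype.card k) (h : ∀ t, eval t f = 0) : f = 0 := by
  refine MvPolynomial.eq_zero_of_eval_zero_at_prod_finset f (fun _ => Finset.univ) (fun i => ?_) (fun x _ => h x)
  exact (degreeOf_le_totalDegree f i).trans_lt hf

end HR

open MvPolynomial
namespace HR
set_option linter.unusedSectionVars false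
open scoped BigOperators

theorem ker_le {k R K : Type*} [Field k] [CommRing R] [Algebra k R] [CommRing K] [Algebra k K] (e : R →ₐ[k] K)
    (W : Submodule k R) (hW1 : (1 : R) ∈ W) (hWs : ∀ y, ∃ w ∈ W, e w = y) (j d : ℕ) (hj : 1 ≤ j) (hd : 1 ≤ d)
    (hjd : 2 ≤ j ∨ d = 1) :
    (W ^ j) ^ d ⊓ LinearMap.ker e.toLinearMap ≤ (W ^ j ⊓ LinearMap.ker e.toLinearMap) * (W ^ j) ^ (d - 1) := by
  set U := W ^ j with hU
  set U1 := U ⊓ LinearMap.ker e.toLinearMap with hU1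
  have hWU : W ≤ U := by
    have := pow_mono_of_one W hW1 hj
    rwa [pow_one] at this
  have h1U : (1 : R) ∈ U := hWU hW1
  have hUW : U ≤ U1 ⊔ W := by
    intro x hx
    obtain ⟨w, hw, hwe⟩ := hWs (e x)
    refine Submodule.mem_sup.mpr ⟨x - w, ⟨U.sub_mem hx (hWU hw), ?_⟩, w, hw, by ring⟩
    simp [hwe]
  have hU1m : ∀ m, U1 ≤ U1 * U ^ m := by
    intro m
    conv_lhs => rw [← mul_one U1]
    exact mul_le_mul_right (Submodule.one_le.mpr (by simpa using pow_mono_of_one U h1U (Nat.zero_le m) (by simp [Submodule.one_le.mp]))) _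
  obtain ⟨d, rfl⟩ : ∃ d', d = d' + 1 := ⟨d - 1, by omega⟩
  rw [Nat.add_sub_cancel]
  have hker : U1 * U ^ d ≤ LinearMap.ker e.toLinearMap := by
    rw [Submodule.mul_le]
    intro a ha b _
    have : e a = 0 := ha.2
    simp [this]
  rcases hjd with hj2 | hd1
  · have claim : ∀ d, U ^ (d + 1) ≤ U1 * U ^ d ⊔ W := by
      intro d
      induction d with
      | zero => simpa using hUW
      | succ d ih =>
        rw [pow_succ]
        refine (mul_le_mul_left ih U).trans ?_
        rw [Submodule.sup_mul, mul_assoc, ← pow_succ]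
        refine sup_le le_sup_left ?_
        refine (mul_le_mul_right hUW W).trans ?_
        rw [Submodule.mul_sup]
        refine sup_le ?_ ?_
        · refine le_trans ?_ le_sup_left
          rw [mul_comm]
          refine mul_le_mul_right ?_ U1
          refine hWU.trans ?_
          simpa using pow_mono_of_one U h1U (show 1 ≤ d + 1 by omega)
        · rw [← pow_two]
          refine (pow_mono_of_one W hW1 hj2).trans (hUW.trans (sup_le_sup_right (hU1m _) _))
    intro x hx
    obtain ⟨m, hm, w, hw, hmw⟩ := Submodule.mem_sup.mp (claim d hx.1)
    have hxk : e x = 0 := hx.2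
    have hmk : e m = 0 := hker hm
    have : w ∈ U1 := ⟨hWU hw, by
      have := congrArg e hmw
      rw [map_add, hmk, hxk, zero_add] at this
      exact this⟩
    rw [← hmw]
    exact Submodule.add_mem _ hm (hU1m d this)
  · obtain rfl : d = 0 := by omega
    simp [hU1]

theorem stepD {E s L : ℕ} (hL : EQP E s L) {k : Type} [Field k] [Fintype k] {c n : ℕ}
    (P : Fin c → MvPolynomial (Fin n) k) (d : Fin c → ℕ) (hd1 : ∀ i, 1 ≤ d i) (hdE : ∀ i, d i ≤ E)
    (hdeg : ∀ i, (P i).totalDegree ≤ d i) (hP : Adapted P d L)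
    (j : ℕ) (hj : 1 ≤ j) (hjd : 2 ≤ j ∨ ∀ i, d i = 1)
    (Q : MvPolynomial (Fin n) k) (hQ : j * Q.totalDegree < Fintype.card k)
    (hvan : ∀ x : Fin n → k, (∀ i, eval x (P i) = 0) → eval x Q = 0)
    {K : Type} [Field K] [Fintype K] [Algebra k K] {N : ℕ} (β : Module.Basis (Fin N) k K)
    (S : Finset (Fin n → K)) (hS : ∀ x ∈ S, (∀ i, aeval x (P i) = 0) ∧ aeval x Q ≠ 0) :
    Fintype.card k ^ s * S.card ≤ Fintype.card k ^ (∑ i, (N + 1) ^ (j * d i)) * Fintype.card K ^ n := by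
  classical
  let R := MvPolynomial (Fin N) k
  let e : R →ₐ[k] K := aeval β
  let w : Fin (N + 1) → R := Fin.cons 1 X
  set W : Submodule k R := Submodule.span k (Set.range w) with hWdef
  have hW1 : (1 : R) ∈ W := Submodule.subset_span ⟨0, rfl⟩
  have hWs : ∀ y, ∃ w ∈ W, e w = y := by
    intro y
    refine ⟨∑ i, β.repr y i • X i, Submodule.sum_mem _ fun i _ => Submodule.smul_mem _ _ (Submodule.subset_span ⟨i.succ, by simp [w]⟩), ?_⟩
    have hX : ∀ i, e (X i) = β i := fun i => aeval_X _ _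
    simp only [map_sum, map_smul, hX]
    exact β.sum_repr y
  have hWdeg : ∀ m, ∀ x ∈ W ^ m, x.totalDegree ≤ m := by
    intro m x hx
    have : W ^ m ≤ restrictTotalDegree (Fin N) k m := by
      rw [hWdef, pow_span_le, Submodule.span_le]
      rintro _ ⟨f, rfl⟩
      rw [SetLike.mem_coe, mem_restrictTotalDegree]
      refine (totalDegree_finsetProd _ _).trans ((Finset.sum_le_sum fun i _ => ?_).trans (show ∑ i : Fin m, 1 ≤ m by simp))
      refine Fin.cases ?_ (fun i => ?_) (f i)
      · simp [w]
      · simp [w]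
    exact (mem_restrictTotalDegree _ _ _).mp (this hx)
  set U := W ^ j with hU
  set U1 := U ⊓ LinearMap.ker e.toLinearMap with hU1
  have hWU : W ≤ U := by
    have := pow_mono_of_one W hW1 hj
    rwa [pow_one] at this
  have h1U : (1 : R) ∈ U := hWU hW1
  have : Finite U := (finite_pow_span w j).1
  let _ : Fintype U := Fintype.ofFinite U
  let H0 : Fin c → Submodule k R := fun i => U ^ d i ⊓ LinearMap.ker e.toLinearMap
  have hH0 : ∀ i, Finite (H0 i) ∧ Nat.card (H0 i) ≤ Fintype.card k ^ ((N + 1) ^ (j * d i)) := by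
    intro i
    have h1 := finite_pow_span (k := k) w (j * d i)
    have h2 : H0 i ≤ W ^ (j * d i) := by
      rw [pow_mul]
      exact inf_le_left
    have := h1.1
    exact ⟨(card_le_of_le h2).1, (card_le_of_le h2).2.trans h1.2⟩
  have : ∀ i, Finite (H0 i) := fun i => (hH0 i).1
  let Φ : (Fin n → U) →+ (Fin n → K) :=
    { toFun := fun γ j => e (γ j)
      map_zero' := by ext; simp
      map_add' := fun x y => by ext; simp }
  have hΦ : Function.Surjective Φ := by
    intro y
    choose g hg hge using hWs
    exact ⟨fun j => ⟨g (y j), hWU (hg _)⟩, funext fun j => hge _⟩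
  have hfib := fibre_card Φ hΦ S
  have hΦe : ∀ (γ : Fin n → U) (p : MvPolynomial (Fin n) k), aeval (Φ γ) p = e (aeval (fun j => (0 : Fin n → R) j + (γ j : R)) p) := by
    intro γ p
    simp only [Pi.zero_apply, zero_add]
    rw [← AlgHom.comp_apply, MvPolynomial.comp_aeval]
    rfl
  have main := hL k c n P d hd1 hdE hdeg hP R U1 U 0 0 H0 (Finset.univ.filter fun γ => Φ γ ∈ S) inf_le_left
    (fun i => ker_le e W hW1 hWs j (d i) hj (hd1 i) (hjd.imp id (fun h => h i)))
    (by
      intro γ hγ δ hδ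
      simp only [Finset.mem_filter, Finset.mem_univ, true_and] at hγ ⊢
      have : Φ δ = 0 := funext fun j => (hδ j).2
      rwa [map_add, this, add_zero])
    (by
      intro γ hγ i
      simp only [Finset.mem_filter, Finset.mem_univ, true_and] at hγ
      refine ⟨?_, ?_⟩
      · simp only [Pi.zero_apply, zero_add, sub_zero]
        exact aeval_mem_pow U h1U _ (fun j => (γ j).2) _ (hdeg i)
      · have h3 := (hS _ hγ).1 i
        rw [hΦe] at h3
        simpa using h3)
    ∅ (by
      intro γ hγ hz
      exfalso
      simp only [Finset.mem_filter, Finset.mem_univ, true_and] at hγ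
      apply (hS _ hγ).2
      rw [hΦe]
      have : aeval (fun j => (0 : Fin n → R) j + (γ j : R)) Q = 0 := by
        have hev : ∀ (t : Fin N → k) (p : MvPolynomial (Fin n) k), 
            eval t (aeval (fun j => (0 : Fin n → R) j + (γ j : R)) p) = eval (fun j => eval t (γ j : R)) p := by
          intro t p
          simp only [Pi.zero_apply, zero_add]
          have h5 := comp_aeval_apply (R := k) (fun j => (γ j : R)) (aeval t : R →ₐ[k] k) p
          exact h5
        refine eq_zero_of_vanish _ ?_ fun t => ?_
        · refine lt_of_le_of_lt (hWdeg (j * Q.totalDegree) _ ?_) hQ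
          rw [pow_mul]
          simp only [Pi.zero_apply, zero_add]
          exact aeval_mem_pow U h1U _ (fun j => (γ j).2) _ le_rfl
        · rw [hev]
          refine hvan _ fun i => ?_
          rw [← hev, hz i]
          simp
      rw [this, map_zero])
  rw [Finset.card_empty, mul_zero, zero_mul, zero_add] at main
  have hcU : 0 < Fintype.card U ^ n := pow_pos Fintype.card_pos n
  simp only [Fintype.card_fun, Fintype.card_fin] at hfib
  have hle : ∏ i, Nat.card (H0 i) ≤ Fintype.card k ^ (∑ i, (N + 1) ^ (j * d i)) := by
    rw [← Finset.prod_pow_eq_pow_sum]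
    exact Finset.prod_le_prod' fun i _ => (hH0 i).2
  refine Nat.le_of_mul_le_mul_right ?_ hcU
  calc _ = Fintype.card k ^ s * (S.card * Fintype.card U ^ n) := by ring
    _ = (Fintype.card k ^ s * (Finset.univ.filter fun γ => Φ γ ∈ S).card) * Fintype.card K ^ n := by rw [← hfib]; ring
    _ ≤ (∏ i, Nat.card (H0 i)) * Fintype.card U ^ n * Fintype.card K ^ n := Nat.mul_le_mul_right _ main
    _ ≤ Fintype.card k ^ (∑ i, (N + 1) ^ (j * d i)) * Fintype.card U ^ n * Fintype.card K ^ n := by gcongr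
    _ = _ := by ring

end HR

open MvPolynomial
namespace HR
set_option linter.unusedSectionVars false
open scoped BigOperators

section rel
variable {k R : Type*} [CommRing k] [CommRing R] [Algebra k R]

/-- the space of differences of order `N` -/
def Dif (U1 V : Submodule k R) : ℕ → Submodule k R
  | 0 => ⊥
  | N + 1 => U1 * V ^ N

/-- two elements of `V ^ N` which agree up to differences -/
def Rel (U1 V : Submodule k R) (N : ℕ) (f g : R) : Prop := f ∈ V ^ N ∧ g ∈ V ^ N ∧ f - g ∈ Dif U1 V N

variable {U1 V : Submodule k R}

theorem Dif_mono (h1 : (1 : R) ∈ V) {N M : ℕ} (h : N ≤ M) : Dif U1 V N ≤ Dif U1 V M := by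
  cases N with
  | zero => exact bot_le
  | succ N =>
    obtain ⟨M, rfl⟩ : ∃ M', M = M' + 1 := ⟨M - 1, by omega⟩
    exact mul_le_mul_right (pow_mono_of_one V h1 (by omega)) U1

theorem pow_mul_Dif (N M : ℕ) : V ^ N * Dif U1 V M ≤ Dif U1 V (N + M) := by
  cases M with
  | zero => simp [Dif]
  | succ M =>
    rw [← add_assoc]
    simp only [Dif]
    rw [pow_add]
    apply le_of_eq; ring

theorem Rel.mul {N M : ℕ} {f g f' g' : R} (h : Rel U1 V N f g) (h' : Rel U1 V M f' g') :
    Rel U1 V (N + M) (f * f') (g * g') := by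
  obtain ⟨h1, h2, h3⟩ := h
  obtain ⟨h1', h2', h3'⟩ := h'
  refine ⟨?_, ?_, ?_⟩
  · rw [pow_add]; exact Submodule.mul_mem_mul h1 h1'
  · rw [pow_add]; exact Submodule.mul_mem_mul h2 h2'
  · have e : f * f' - g * g' = f' * (f - g) + g * (f' - g') := by ring
    rw [e]
    refine Submodule.add_mem _ ?_ (pow_mul_Dif _ _ (Submodule.mul_mem_mul h2 h3'))
    rw [add_comm N M]
    exact pow_mul_Dif _ _ (Submodule.mul_mem_mul h1' h3)

theorem Rel.one : Rel U1 V 0 (1 : R) 1 := by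
  refine ⟨?_, ?_, by simp⟩ <;> simp [Submodule.one_le.mp]

theorem Rel.refl {N : ℕ} {f : R} (h : f ∈ V ^ N) : Rel U1 V N f f := ⟨h, h, by simp⟩

theorem Rel.pow {N : ℕ} {f g : R} (h : Rel U1 V N f g) (m : ℕ) : Rel U1 V (m * N) (f ^ m) (g ^ m) := by
  induction m with
  | zero => simpa using Rel.one
  | succ m ih =>
    rw [pow_succ, pow_succ, Nat.succ_mul]
    exact ih.mul h

theorem Rel.prod {ι : Type*} (s : Finset ι) (N : ι → ℕ) (f g : ι → R) (h : ∀ i ∈ s, Rel U1 V (N i) (f i) (g i)) :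
    Rel U1 V (∑ i ∈ s, N i) (∏ i ∈ s, f i) (∏ i ∈ s, g i) := by
  classical
  induction s using Finset.induction_on with
  | empty => simpa using Rel.one
  | insert a s ha ih =>
    rw [Finset.sum_insert ha, Finset.prod_insert ha, Finset.prod_insert ha]
    exact (h a (by simp)).mul (ih fun i hi => h i (by simp [hi]))

theorem diff_mem (h1 : (1 : R) ∈ V) (hU : U1 ≤ V) {σ : Type*} (z u : σ → R) (hz : ∀ j, z j ∈ V) (hu : ∀ j, u j ∈ U1)
    (P : MvPolynomial σ k) {d : ℕ} (hP : P.totalDegree ≤ d) :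
    aeval (fun j => z j + u j) P - aeval z P ∈ Dif U1 V d := by
  rw [aeval_def, aeval_def, eval₂_eq, eval₂_eq, ← Finset.sum_sub_distrib]
  refine Submodule.sum_mem _ fun e he => ?_
  rw [← mul_sub, ← Algebra.smul_def]
  refine Submodule.smul_mem _ _ ?_
  have h2 := Rel.prod (U1 := U1) (V := V) e.support (fun i => e i * 1) (fun i => (z i + u i) ^ e i) (fun i => z i ^ e i)
    (fun i _ => by
      refine Rel.pow ⟨?_, ?_, ?_⟩ _
      · simpa using V.add_mem (hz i) (hU (hu i))
      · simpa using hz i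
      · simpa [Dif] using hu i)
  refine Dif_mono h1 ?_ h2.2.2
  simp only [mul_one]
  exact (le_totalDegree he).trans hP

end rel

theorem rtd_pow (K : Type*) [CommRing K] (c m : ℕ) :
    (restrictTotalDegree (Fin c) K 1) ^ m = restrictTotalDegree (Fin c) K m := by
  apply le_antisymm
  · refine pow_le_of_prod _ m _ fun u hu => ?_
    rw [mem_restrictTotalDegree]
    refine (totalDegree_finsetProd _ _).trans ((Finset.sum_le_sum fun i _ => ?_).trans (show ∑ i : Fin m, 1 ≤ m by simp))
    exact (mem_restrictTotalDegree _ _ _).mp (hu i)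
  · intro p hp
    have h := aeval_mem_pow (restrictTotalDegree (Fin c) K 1) (by simp [mem_restrictTotalDegree]) (X : Fin c → MvPolynomial (Fin c) K)
      (fun j => (mem_restrictTotalDegree _ _ _).mpr (by
        refine (totalDegree_monomial_le _ _).trans ?_
        simp)) p
      ((mem_restrictTotalDegree _ _ _).mp hp)
    simpa using h

theorem rtd_one_eq (K : Type*) [CommRing K] (c : ℕ) :
    restrictTotalDegree (Fin c) K 1 = Submodule.span K (Set.range (Fin.cons 1 X : Fin (c + 1) → MvPolynomial (Fin c) K)) := by
  apply le_antisymm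
  · intro p hp
    have h := aeval_mem_pow (Submodule.span K (Set.range (Fin.cons 1 X : Fin (c + 1) → MvPolynomial (Fin c) K)))
      (Submodule.subset_span ⟨0, rfl⟩) (X : Fin c → MvPolynomial (Fin c) K)
      (fun j => Submodule.subset_span ⟨j.succ, rfl⟩) p
      ((mem_restrictTotalDegree _ _ _).mp hp)
    simpa using h
  · rw [Submodule.span_le]
    rintro _ ⟨i, rfl⟩
    refine Fin.cases ?_ (fun i => ?_) i
    · simp [mem_restrictTotalDegree]
    · rw [SetLike.mem_coe, mem_restrictTotalDegree]
      refine (totalDegree_monomial_le _ _).trans ?_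
      simp

theorem rtd_finite (K : Type*) [Field K] [Fintype K] (c m : ℕ) : Finite (restrictTotalDegree (Fin c) K m) ∧
    Nat.card (restrictTotalDegree (Fin c) K m) ≤ Fintype.card K ^ ((c + 1) ^ m) := by
  rw [← rtd_pow, rtd_one_eq]
  exact finite_pow_span _ _

theorem exists_v {E s L : ℕ} (hL : EQP E s L) {K : Type} [Field K] [Fintype K] {c n : ℕ}
    (P : Fin c → MvPolynomial (Fin n) K) (d : Fin c → ℕ) (hd1 : ∀ i, 1 ≤ d i) (hdE : ∀ i, d i ≤ E)
    (hdeg : ∀ i, (P i).totalDegree ≤ d i) (hP : Adapted P d L) (hs : ∑ i, (c + 1) ^ d i < s) :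
    ∃ γ : Fin n → MvPolynomial (Fin c) K, (∀ j, (γ j).totalDegree ≤ 1) ∧ ∀ i, aeval γ (P i) = X i ^ d i := by
  classical
  set W := restrictTotalDegree (Fin c) K 1 with hW
  have hWm : ∀ m, Finite ↥(W ^ m) ∧ Nat.card ↥(W ^ m) ≤ Fintype.card K ^ ((c + 1) ^ m) := by
    intro m; rw [hW, rtd_pow]; exact rtd_finite K c m
  have h1W : (1 : MvPolynomial (Fin c) K) ∈ W := by simp [hW, mem_restrictTotalDegree]
  have : Finite W := (rtd_finite K c 1).1
  let _ : Fintype W := Fintype.ofFinite W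
  have : ∀ i, Finite ↥(W ^ d i) := fun i => (hWm _).1
  by_contra hcon
  push Not at hcon
  have main := hL K c n P d hd1 hdE hdeg hP (MvPolynomial (Fin c) K) W W 0 (fun i => X i ^ d i) (fun i => W ^ d i)
    Finset.univ le_rfl (fun i => by rw [← pow_succ', Nat.sub_add_cancel (hd1 i)]) (by simp)
    (by
      intro γ _ i
      refine Submodule.sub_mem _ ?_ (Submodule.pow_mem_pow _ ((mem_restrictTotalDegree _ _ _).mpr (by simp)) _)
      simp only [Pi.zero_apply, zero_add]
      exact aeval_mem_pow W h1W _ (fun j => (γ j).2) _ (hdeg i)) ∅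
    (by
      intro γ _ h
      exfalso
      simp only [Pi.zero_apply, zero_add] at h
      obtain ⟨i, hi⟩ := hcon (fun j => (γ j : MvPolynomial (Fin c) K)) (fun j => (mem_restrictTotalDegree _ _ _).mp (γ j).2)
      exact hi (h i))
  rw [Finset.card_empty, mul_zero, zero_mul, zero_add, Finset.card_univ, Fintype.card_fun, Fintype.card_fin] at main
  have h2 := Nat.le_of_mul_le_mul_right main (pow_pos Fintype.card_pos n)
  have h3 : ∏ i, Nat.card ↥(W ^ d i) ≤ Fintype.card K ^ (∑ i, (c + 1) ^ d i) := by
    rw [← Finset.prod_pow_eq_pow_sum]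
    exact Finset.prod_le_prod' fun i _ => (hWm _).2
  exact absurd (h2.trans h3) (not_le.mpr (Nat.pow_lt_pow_right Fintype.one_lt_card hs))

end HR

open MvPolynomial
namespace HR
set_option linter.unusedSectionVars false
open scoped BigOperators

section theta
variable {K : Type*} [CommRing K] {c : ℕ}

theorem dif_coeff {N : ℕ} {f : MvPolynomial (Fin c) K} (h : f ∈ Dif 1 (restrictTotalDegree (Fin c) K 1) N)
    (β : Fin c →₀ ℕ) (hβ : N ≤ β.degree) : coeff β f = 0 := by
  cases N with
  | zero => simp only [Dif, Submodule.mem_bot] at h; simp [h]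
  | succ N =>
    simp only [Dif, one_mul, rtd_pow, mem_restrictTotalDegree] at h
    by_contra hc
    have := le_totalDegree (mem_support_iff.mpr hc)
    change β.degree ≤ _ at this
    omega

/-- the twisted monomials -/
noncomputable def th (G : Fin c → MvPolynomial (Fin c) K) (d : Fin c → ℕ) (α : Fin c →₀ ℕ) : MvPolynomial (Fin c) K :=
  ∏ i, (G i ^ (α i / d i) * X i ^ (α i % d i))

/-- the twisting map -/
noncomputable def Th (G : Fin c → MvPolynomial (Fin c) K) (d : Fin c → ℕ) :
    MvPolynomial (Fin c) K →ₗ[K] MvPolynomial (Fin c) K :=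
  (basisMonomials (Fin c) K).constr K (th G d)

theorem Th_monomial (G : Fin c → MvPolynomial (Fin c) K) (d : Fin c → ℕ) (α : Fin c →₀ ℕ) (a : K) :
    Th G d (monomial α a) = C a * th G d α := by
  have h : monomial α a = a • monomial α (1 : K) := by rw [smul_monomial, smul_eq_mul, mul_one]
  have h2 : Th G d (monomial α 1) = th G d α := by
    have := (basisMonomials (Fin c) K).constr_basis K (th G d) α
    rwa [coe_basisMonomials] at this
  rw [h, map_smul, h2, smul_eq_C_mul]

theorem Th_apply (G : Fin c → MvPolynomial (Fin c) K) (d : Fin c → ℕ) (p : MvPolynomial (Fin c) K) :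
    Th G d p = ∑ α ∈ p.support, C (coeff α p) * th G d α := by
  conv_lhs => rw [p.as_sum, map_sum]
  exact Finset.sum_congr rfl fun α _ => Th_monomial _ _ _ _

theorem mono_eq (d : Fin c → ℕ) (α : Fin c →₀ ℕ) :
    (monomial α (1 : K)) = ∏ i, ((X i ^ d i) ^ (α i / d i) * X i ^ (α i % d i)) := by
  rw [monomial_eq, C_1, one_mul, Finsupp.prod_fintype _ _ (by simp)]
  refine Finset.prod_congr rfl fun i _ => ?_
  rw [← pow_mul, ← pow_add, Nat.div_add_mod]

variable (G : Fin c → MvPolynomial (Fin c) K) (d : Fin c → ℕ) 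

theorem th_rel (hG : ∀ i, Rel 1 (restrictTotalDegree (Fin c) K 1) (d i) (G i) (X i ^ d i)) (α : Fin c →₀ ℕ) :
    Rel 1 (restrictTotalDegree (Fin c) K 1) α.degree (th G d α) (monomial α 1) := by
  rw [mono_eq d α]
  have h := Rel.prod (U1 := 1) (V := restrictTotalDegree (Fin c) K 1) Finset.univ (fun i => α i / d i * d i + α i % d i)
    (fun i => G i ^ (α i / d i) * X i ^ (α i % d i)) (fun i => (X i ^ d i) ^ (α i / d i) * X i ^ (α i % d i))
    (fun i _ => by
      refine ((hG i).pow _).mul (Rel.refl ?_)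
      refine Submodule.pow_mem_pow _ ?_ _
      rw [mem_restrictTotalDegree]
      refine (totalDegree_monomial_le _ _).trans ?_
      simp)
  have e : ∑ i, (α i / d i * d i + α i % d i) = α.degree := by
    rw [Finsupp.degree_eq_sum]
    exact Finset.sum_congr rfl fun i _ => Nat.div_add_mod' _ _
  rw [e] at h
  exact h

theorem Th_sub (p : MvPolynomial (Fin c) K) :
    Th G d p - p = ∑ α ∈ p.support, C (coeff α p) * (th G d α - monomial α 1) := by
  rw [Th_apply]
  conv_lhs => rw [sub_eq_add_neg]; enter [2, 1]; rw [p.as_sum]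
  rw [← sub_eq_add_neg, ← Finset.sum_sub_distrib]
  refine Finset.sum_congr rfl fun α _ => ?_
  rw [mul_sub, C_mul_monomial, mul_one]

theorem Th_sub_coeff (hG : ∀ i, Rel 1 (restrictTotalDegree (Fin c) K 1) (d i) (G i) (X i ^ d i)) (p : MvPolynomial (Fin c) K)
    (β : Fin c →₀ ℕ) (h : ∀ α ∈ p.support, α.degree ≤ β.degree) : coeff β (Th G d p) = coeff β p := by
  rw [← sub_eq_zero, ← coeff_sub, Th_sub, coeff_sum]
  refine Finset.sum_eq_zero fun α hα => ?_
  rw [coeff_C_mul, dif_coeff (th_rel G d hG α).2.2 β (h α hα), mul_zero]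

theorem Th_inj (hG : ∀ i, Rel 1 (restrictTotalDegree (Fin c) K 1) (d i) (G i) (X i ^ d i)) (p : MvPolynomial (Fin c) K)
    (h : Th G d p = 0) : p = 0 := by
  by_contra hp
  obtain ⟨β, hβ, hmax⟩ := Finset.exists_max_image p.support (fun α => α.degree) (Finset.nonempty_of_ne_empty (by simpa using hp))
  have := Th_sub_coeff G d hG p β hmax
  rw [h, coeff_zero] at this
  exact (mem_support_iff.mp hβ) this.symm

theorem Th_surj (hG : ∀ i, Rel 1 (restrictTotalDegree (Fin c) K 1) (d i) (G i) (X i ^ d i))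
    (Z : AddSubgroup (MvPolynomial (Fin c) K)) (hZ : ∀ f ∈ Z, Th G d f ∈ Z) (f : MvPolynomial (Fin c) K) (hf : f ∈ Z) :
    ∃ p ∈ Z, Th G d p = f := by
  have key : ∀ N, ∀ f ∈ Z, (∀ β : Fin c →₀ ℕ, N ≤ β.degree → coeff β f = 0) → ∃ p ∈ Z, Th G d p = f := by
    intro N
    induction N with
    | zero =>
      intro f hf h
      refine ⟨0, Z.zero_mem, ?_⟩
      rw [map_zero]
      ext β
      rw [h β (Nat.zero_le _), coeff_zero]
    | succ N ih =>
      intro f hf h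
      obtain ⟨p, hp, hp'⟩ := ih (f - Th G d f) (Z.sub_mem hf (hZ f hf)) (by
        intro β hβ
        rw [coeff_sub, sub_eq_zero]
        symm
        apply Th_sub_coeff G d hG
        intro α hα
        by_contra hc
        exact (mem_support_iff.mp hα) (h α (by omega)))
      exact ⟨p + f, Z.add_mem hp hf, by rw [map_add, hp']; ring⟩
  refine key (f.totalDegree + 1) f hf fun β hβ => ?_
  by_contra hc
  have := le_totalDegree (mem_support_iff.mpr hc)
  change β.degree ≤ _ at this
  omega

theorem th_add (hd : ∀ i, 1 ≤ d i) (i : Fin c) (α : Fin c →₀ ℕ) : G i * th G d α = th G d (Finsupp.single i (d i) + α) := by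
  unfold th
  have h : G i = ∏ j, (if i = j then G j else 1) := by simp
  conv_lhs => rw [h]
  rw [← Finset.prod_mul_distrib]
  refine Finset.prod_congr rfl fun j _ => ?_
  by_cases hj : i = j
  · subst hj
    simp only [if_true, Finsupp.add_apply, Finsupp.single_eq_same]
    rw [Nat.add_div_left _ (hd i), Nat.add_mod_left, pow_succ]
    ring
  · simp [hj]

theorem mul_Th (hd : ∀ i, 1 ≤ d i) (i : Fin c) (p : MvPolynomial (Fin c) K) : G i * Th G d p = Th G d (X i ^ d i * p) := by
  induction p using MvPolynomial.induction_on' with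
  | monomial α a =>
    rw [X_pow_eq_monomial, monomial_mul, one_mul, Th_monomial, Th_monomial, ← th_add G d hd]
    ring
  | add p q hp hq => rw [map_add, mul_add, hp, hq, mul_add, map_add]

/-- supported in the box -/
def IsBox (f : MvPolynomial (Fin c) K) : Prop := ∀ α ∈ f.support, ∀ i, α i < d i

theorem Th_box (f : MvPolynomial (Fin c) K) (hf : IsBox d f) : Th G d f = f := by
  rw [← sub_eq_zero, Th_sub]
  refine Finset.sum_eq_zero fun α hα => ?_
  have : th G d α = monomial α 1 := by
    rw [mono_eq d α]
    refine Finset.prod_congr rfl fun i _ => ?_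
    rw [Nat.div_eq_of_lt (hf α hα i), pow_zero, pow_zero]
  rw [this, sub_self, mul_zero]

theorem box_not_mem (hd : ∀ i, 1 ≤ d i) (hG : ∀ i, Rel 1 (restrictTotalDegree (Fin c) K 1) (d i) (G i) (X i ^ d i))
    (f : MvPolynomial (Fin c) K) (hf : IsBox d f) (h : f ∈ Ideal.span (Set.range G)) : f = 0 := by
  rw [Ideal.mem_span_range_iff_exists_fun] at h
  obtain ⟨q, hq⟩ := h
  choose p _ hp using fun i => Th_surj G d hG ⊤ (by simp) (q i) (AddSubgroup.mem_top _)
  have h1 : Th G d (f - ∑ i, X i ^ d i * p i) = 0 := by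
    rw [map_sub, map_sum, Th_box G d f hf, sub_eq_zero, ← hq]
    refine Finset.sum_congr rfl fun i _ => ?_
    rw [← mul_Th G d hd, hp, mul_comm]
  have h2 := sub_eq_zero.mp (Th_inj G d hG _ h1)
  by_contra hne
  obtain ⟨α, hα⟩ := Finset.nonempty_of_ne_empty (show f.support ≠ ∅ by simpa using hne)
  refine (mem_support_iff.mp hα) ?_
  rw [h2, coeff_sum]
  refine Finset.sum_eq_zero fun i _ => ?_
  rw [X_pow_eq_monomial, coeff_monomial_mul', if_neg]
  intro hle
  have := hle i
  rw [Finsupp.single_eq_same] at this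
  exact absurd (hf α hα i) (by omega)

/-- division with remainder -/
theorem division (hd : ∀ i, 1 ≤ d i) (hG : ∀ i, Rel 1 (restrictTotalDegree (Fin c) K 1) (d i) (G i) (X i ^ d i))
    (Z : AddSubgroup (MvPolynomial (Fin c) K)) (hZ : ∀ f ∈ Z, Th G d f ∈ Z)
    (hZ' : ∀ f ∈ Z, ∀ g : MvPolynomial (Fin c) K, (∀ α, coeff α g = 0 ∨ coeff α g = coeff α f) → g ∈ Z)
    (F : MvPolynomial (Fin c) K) (hF : F ∈ Z) :
    ∃ r ∈ Z, IsBox d r ∧ F - r ∈ Ideal.span (Set.range G) := by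
  classical
  obtain ⟨p, hp, rfl⟩ := Th_surj G d hG Z hZ F hF
  set r : MvPolynomial (Fin c) K := ∑ α ∈ p.support.filter (fun α => ∀ i, α i < d i), monomial α (coeff α p) with hr
  have hc : ∀ β, coeff β r = if ∀ i, β i < d i then coeff β p else 0 := by
    intro β
    rw [hr, coeff_sum]
    simp only [coeff_monomial]
    rw [Finset.sum_ite_eq']
    simp only [Finset.mem_filter, mem_support_iff]
    by_cases h1 : ∀ i, β i < d i
    · by_cases h2 : coeff β p = 0 <;> simp [h1, h2]
    · simp [h1]
  have hb : IsBox d r := by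
    intro α hα
    by_contra hcon
    rw [mem_support_iff, hc, if_neg hcon] at hα
    exact hα rfl
  refine ⟨r, hZ' p hp r fun α => ?_, hb, ?_⟩
  · rw [hc]; split_ifs <;> simp
  · have e : Th G d p - r = Th G d (p - r) := by rw [map_sub, Th_box G d r hb]
    rw [e]
    have e2 : p - r = ∑ α ∈ p.support.filter (fun α => ¬ ∀ i, α i < d i), monomial α (coeff α p) := by
      rw [sub_eq_iff_eq_add, hr, add_comm, Finset.sum_filter_add_sum_filter_not]
      exact p.as_sum
    rw [e2, map_sum]
    refine Ideal.sum_mem _ fun α hα => ?_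
    have h3 := (Finset.mem_filter.mp hα).2
    push Not at h3
    obtain ⟨i, hi⟩ := h3
    have e3 : monomial α (coeff α p) = X i ^ d i * monomial (α - Finsupp.single i (d i)) (coeff α p) := by
      rw [X_pow_eq_monomial, monomial_mul, one_mul, add_tsub_cancel_of_le]
      intro j
      by_cases hj : i = j
      · subst hj; simpa using hi
      · simp [hj]
    rw [e3, ← mul_Th G d hd]
    exact Ideal.mul_mem_right _ _ (Ideal.subset_span ⟨i, rfl⟩)

end theta
end HR

open MvPolynomial
namespace HR
set_option linter.unusedSectionVars false
open scoped BigOperators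

section gen
variable {K : Type*} [Field K] {c n : ℕ}

/-- evaluation at a translate of `γ` -/
noncomputable def GG {S : Type*} [CommRing S] [Algebra K S] (γ : Fin n → MvPolynomial (Fin c) K) (y : Fin n → S) :
    MvPolynomial (Fin n) K →ₐ[K] MvPolynomial (Fin c) S :=
  aeval (fun j => map (algebraMap K S) (γ j) + C (y j))

theorem GG_map {S S' : Type*} [CommRing S] [Algebra K S] [CommRing S'] [Algebra K S'] (γ : Fin n → MvPolynomial (Fin c) K)
    (y : Fin n → S) (φ : S →ₐ[K] S') (P : MvPolynomial (Fin n) K) :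
    mapAlgHom φ (GG γ y P) = GG γ (fun j => φ (y j)) P := by
  unfold GG
  rw [comp_aeval_apply]
  have : (fun j => mapAlgHom (σ := Fin c) φ (map (algebraMap K S) (γ j) + C (y j))) =
      fun j => map (algebraMap K S') (γ j) + C (φ (y j)) := by
    funext j
    rw [map_add, mapAlgHom_apply, mapAlgHom_apply]
    erw [map_C]
    rw [map_map]
    have : (φ : S →+* S').comp (algebraMap K S) = algebraMap K S' := φ.comp_algebraMap
    erw [this]
    rfl
  rw [this]

theorem GG_rel {S : Type*} [CommRing S] [Algebra K S] (γ : Fin n → MvPolynomial (Fin c) K) (y : Fin n → S)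
    (hγ : ∀ j, (γ j).totalDegree ≤ 1) (P : MvPolynomial (Fin n) K) {e : ℕ} (hP : P.totalDegree ≤ e) (i : Fin c)
    (hPi : aeval γ P = X i ^ e) : Rel 1 (restrictTotalDegree (Fin c) S 1) e (GG γ y P) (X i ^ e) := by
  have h1 : (1 : MvPolynomial (Fin c) S) ∈ restrictTotalDegree (Fin c) S 1 := by simp [mem_restrictTotalDegree]
  have hX : (X i : MvPolynomial (Fin c) S) ∈ restrictTotalDegree (Fin c) S 1 := by
    rw [mem_restrictTotalDegree]
    refine (totalDegree_monomial_le _ _).trans ?_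
    simp
  have hz : ∀ j, map (algebraMap K S) (γ j) ∈ restrictTotalDegree (Fin c) S 1 := by
    intro j
    rw [mem_restrictTotalDegree]
    refine le_trans ?_ (hγ j)
    exact Finset.sup_mono (support_map_subset _ _)
  have hu : ∀ j, (C (y j) : MvPolynomial (Fin c) S) ∈ (1 : Submodule S (MvPolynomial (Fin c) S)) := by
    intro j
    rw [Submodule.mem_one]
    exact ⟨y j, rfl⟩
  have hU : (1 : Submodule S (MvPolynomial (Fin c) S)) ≤ restrictTotalDegree (Fin c) S 1 := Submodule.one_le.mpr h1
  have hP' : (map (algebraMap K S) P).totalDegree ≤ e := (Finset.sup_mono (support_map_subset _ _)).trans hP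
  have e1 : aeval (fun j => map (algebraMap K S) (γ j) + C (y j)) (map (algebraMap K S) P) = GG γ y P := by
    rw [aeval_map_algebraMap]; rfl
  have e2 : aeval (fun j => map (algebraMap K S) (γ j)) (map (algebraMap K S) P) = (X i ^ e : MvPolynomial (Fin c) S) := by
    rw [aeval_map_algebraMap]
    have h := comp_aeval_apply (R := K) γ (mapAlgHom (σ := Fin c) (Algebra.ofId K S)) P
    rw [hPi] at h
    have h2 : (mapAlgHom (σ := Fin c) (Algebra.ofId K S)) (X i ^ e) = X i ^ e := by
      rw [map_pow, mapAlgHom_apply]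
      exact congrArg (· ^ e) (map_X _ _)
    rw [h2] at h
    exact h.symm
  refine ⟨?_, Submodule.pow_mem_pow _ hX _, ?_⟩
  · rw [← e1]
    exact aeval_mem_pow _ h1 _ (fun j => Submodule.add_mem _ (hz j) (hU (hu j))) _ hP'
  · rw [← e1, ← e2]
    exact diff_mem h1 hU _ _ hz hu _ hP'

/-- bidegree filtration -/
def ZZ (K : Type*) [Field K] (c n : ℕ) (a : ℕ) : Submodule K (MvPolynomial (Fin c) (MvPolynomial (Fin n) K)) where
  carrier := {F | ∀ (α : Fin c →₀ ℕ) (β : Fin n →₀ ℕ), a < α.degree + β.degree → coeff β (coeff α F) = 0}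
  add_mem' := by
    intro F G hF hG α β h
    rw [coeff_add, coeff_add, hF α β h, hG α β h, add_zero]
  zero_mem' := by intro α β h; simp
  smul_mem' := by
    intro t F hF α β h
    rw [coeff_smul, coeff_smul, hF α β h, smul_zero]

theorem ZZ_mul {a b : ℕ} {F G : MvPolynomial (Fin c) (MvPolynomial (Fin n) K)} (hF : F ∈ ZZ K c n a) (hG : G ∈ ZZ K c n b) :
    F * G ∈ ZZ K c n (a + b) := by
  classical
  intro α β h
  rw [coeff_mul, coeff_sum]
  refine Finset.sum_eq_zero fun x hx => ?_
  rw [coeff_mul]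
  refine Finset.sum_eq_zero fun y hy => ?_
  rw [Finset.HasAntidiagonal.mem_antidiagonal] at hx hy
  rw [← hx, ← hy, map_add, map_add] at h
  by_cases h1 : a < x.1.degree + y.1.degree
  · rw [hF _ _ h1, zero_mul]
  · rw [hG _ _ (by omega), mul_zero]

theorem ZZ_mono {a b : ℕ} (h : a ≤ b) : ZZ K c n a ≤ ZZ K c n b := fun F hF α β h' => hF α β (by omega)

theorem ZZ_C {a : ℕ} {f : MvPolynomial (Fin n) K} (hf : f.totalDegree ≤ a) : C f ∈ ZZ K c n a := by
  intro α β h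
  rw [coeff_C]
  split_ifs with h0
  · subst h0
    by_contra hc
    have := le_totalDegree (mem_support_iff.mpr hc)
    change β.degree ≤ _ at this
    simp at h
    omega
  · simp

theorem ZZ_one : (1 : MvPolynomial (Fin c) (MvPolynomial (Fin n) K)) ∈ ZZ K c n 0 := by
  rw [← C_1]; exact ZZ_C (by simp)

theorem ZZ_map {a : ℕ} {f : MvPolynomial (Fin c) K} (hf : f.totalDegree ≤ a) : map C f ∈ ZZ K c n a := by
  intro α β h
  rw [coeff_map, coeff_C]
  split_ifs with h0
  · subst h0
    by_contra hc
    have := le_totalDegree (mem_support_iff.mpr hc)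
    change α.degree ≤ _ at this
    simp at h
    omega
  · rfl

theorem ZZ_pow {a m : ℕ} {f : MvPolynomial (Fin c) (MvPolynomial (Fin n) K)} (hf : f ∈ ZZ K c n a) : f ^ m ∈ ZZ K c n (m * a) := by
  induction m with
  | zero => simpa using ZZ_one
  | succ m ih => rw [pow_succ, Nat.succ_mul]; exact ZZ_mul ih hf

theorem ZZ_prod {ι : Type*} (s : Finset ι) (f : ι → MvPolynomial (Fin c) (MvPolynomial (Fin n) K)) (a : ι → ℕ)
    (hf : ∀ i ∈ s, f i ∈ ZZ K c n (a i)) : ∏ i ∈ s, f i ∈ ZZ K c n (∑ i ∈ s, a i) := by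
  classical
  induction s using Finset.induction_on with
  | empty => simpa using ZZ_one
  | insert i s hi ih =>
    rw [Finset.prod_insert hi, Finset.sum_insert hi]
    exact ZZ_mul (hf i (by simp)) (ih fun j hj => hf j (by simp [hj]))

theorem ZZ_pow_le (m : ℕ) : (ZZ K c n 1) ^ m ≤ ZZ K c n m := by
  refine pow_le_of_prod _ m _ fun u hu => ?_
  have := ZZ_prod Finset.univ u (fun _ => 1) (fun i _ => hu i)
  simpa using this

theorem ZZ_GG (γ : Fin n → MvPolynomial (Fin c) K) (hγ : ∀ j, (γ j).totalDegree ≤ 1) (P : MvPolynomial (Fin n) K) {e : ℕ}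
    (hP : P.totalDegree ≤ e) : GG γ (X : Fin n → MvPolynomial (Fin n) K) P ∈ ZZ K c n e := by
  refine ZZ_pow_le e (aeval_mem_pow _ (ZZ_mono (Nat.zero_le 1) ZZ_one) _ (fun j => ?_) P hP)
  refine Submodule.add_mem _ (ZZ_map (hγ j)) (ZZ_C ?_)
  refine (totalDegree_monomial_le _ _).trans ?_
  simp

theorem ZZ_Th (G : Fin c → MvPolynomial (Fin c) (MvPolynomial (Fin n) K)) (d : Fin c → ℕ) (hG : ∀ i, G i ∈ ZZ K c n (d i))
    {a : ℕ} (F : MvPolynomial (Fin c) (MvPolynomial (Fin n) K)) (hF : F ∈ ZZ K c n a) : Th G d F ∈ ZZ K c n a := by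
  rw [Th_apply]
  refine Submodule.sum_mem _ fun α hα => ?_
  have h1 : th G d α ∈ ZZ K c n α.degree := by
    have h := ZZ_prod Finset.univ (fun i => G i ^ (α i / d i) * X i ^ (α i % d i)) (fun i => α i / d i * d i + α i % d i * 1)
      (fun i _ => ZZ_mul (ZZ_pow (hG i)) (ZZ_pow (by
        have := ZZ_map (n := n) (f := (X i : MvPolynomial (Fin c) K)) (a := 1) (by
          refine (totalDegree_monomial_le _ _).trans ?_
          simp)
        rwa [map_X] at this)))
    have e : ∑ i, (α i / d i * d i + α i % d i * 1) = α.degree := by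
      rw [Finsupp.degree_eq_sum]
      exact Finset.sum_congr rfl fun i _ => by rw [mul_one]; exact Nat.div_add_mod' _ _
    rw [e] at h
    exact h
  obtain ⟨β, hβ⟩ := Finset.nonempty_of_ne_empty (show (coeff α F).support ≠ ∅ by
    rw [Ne, support_eq_empty]; exact mem_support_iff.mp hα)
  have h2 : α.degree ≤ a := by
    by_contra hc
    exact (mem_support_iff.mp hβ) (hF α β (by omega))
  have h3 : (coeff α F).totalDegree ≤ a - α.degree := by
    refine Finset.sup_le fun β hβ => ?_
    by_contra hc
    refine (mem_support_iff.mp hβ) (hF α β ?_)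
    have : ¬ β.degree ≤ a - α.degree := hc
    omega
  have := ZZ_mul (ZZ_C (c := c) h3) h1
  rwa [Nat.sub_add_cancel h2] at this

theorem generic (γ : Fin n → MvPolynomial (Fin c) K) (hγ : ∀ j, (γ j).totalDegree ≤ 1)
    (P : Fin c → MvPolynomial (Fin n) K) (d : Fin c → ℕ) (hd : ∀ i, 1 ≤ d i) (hdeg : ∀ i, (P i).totalDegree ≤ d i)
    (hP : ∀ i, aeval γ (P i) = X i ^ d i) (Q : MvPolynomial (Fin n) K) :
    Q ∈ Ideal.span (Set.range P) ∨ ∃ h : MvPolynomial (Fin n) K, h ≠ 0 ∧ h.totalDegree ≤ Q.totalDegree ∧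
      ∀ y : Fin n → K, eval y h ≠ 0 → GG γ y Q ∉ Ideal.span (Set.range fun i => GG γ y (P i)) := by
  obtain ⟨r, hr, hb, hQr⟩ := division (fun i => GG γ (X : Fin n → MvPolynomial (Fin n) K) (P i)) d hd
    (fun i => GG_rel γ _ hγ _ (hdeg i) i (hP i)) (ZZ K c n Q.totalDegree).toAddSubgroup
    (fun f hf => ZZ_Th _ d (fun i => ZZ_GG γ hγ _ (hdeg i)) f hf)
    (by
      intro f hf g hg α β h
      rcases hg α with h' | h'
      · rw [h', coeff_zero]
      · rw [h']; exact hf α β h) (GG γ X Q) (ZZ_GG γ hγ Q le_rfl)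
  by_cases hr0 : r = 0
  · left
    rw [hr0, sub_zero] at hQr
    let ψ : MvPolynomial (Fin c) (MvPolynomial (Fin n) K) →+* MvPolynomial (Fin n) K :=
      ((aeval (fun j => X j - C (constantCoeff (γ j))) : MvPolynomial (Fin n) K →ₐ[K] MvPolynomial (Fin n) K) :
        MvPolynomial (Fin n) K →+* MvPolynomial (Fin n) K).comp constantCoeff
    have hψ : ∀ P : MvPolynomial (Fin n) K, ψ (GG γ X P) = P := by
      intro P
      unfold GG
      rw [map_aeval]
      have e1 : ψ.comp (algebraMap K _) = C := by
        ext1 t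
        have : algebraMap K (MvPolynomial (Fin c) (MvPolynomial (Fin n) K)) t = C (C t) := rfl
        simp only [RingHom.comp_apply, this, ψ, constantCoeff_C]
        exact aeval_C _ _
      have e2 : (fun i => ψ ((map (algebraMap K (MvPolynomial (Fin n) K))) (γ i) + C (X i))) = X := by
        funext i
        simp only [RingHom.comp_apply, ψ, map_add, constantCoeff_C, constantCoeff_map, RingHom.coe_coe]
        rw [aeval_X]
        have : algebraMap K (MvPolynomial (Fin n) K) (constantCoeff (γ i)) = C (constantCoeff (γ i)) := rfl
        rw [this]
        have h3 := aeval_C (R := K) (fun j => X j - C (constantCoeff (γ j)) : Fin n → MvPolynomial (Fin n) K) (constantCoeff (γ i))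
        rw [h3, this]
        ring
      rw [e1, e2]
      exact eval₂_eta P
    have h := Ideal.mem_map_of_mem ψ hQr
    rw [hψ, Ideal.map_span, ← Set.range_comp] at h
    have e : ψ ∘ (fun i => GG γ (X : Fin n → MvPolynomial (Fin n) K) (P i)) = P := by
      funext i; exact hψ (P i)
    rwa [e] at h
  · right
    obtain ⟨J, hJ⟩ := Finset.nonempty_of_ne_empty (show r.support ≠ ∅ by simpa using hr0)
    refine ⟨coeff J r, mem_support_iff.mp hJ, ?_, ?_⟩
    · refine Finset.sup_le fun β hβ => ?_
      by_contra hc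
      have : ¬ β.degree ≤ Q.totalDegree := hc
      exact (mem_support_iff.mp hβ) (hr J β (by omega))
    · intro y hy hmem
      have hm := Ideal.mem_map_of_mem (mapAlgHom (σ := Fin c) (aeval y : MvPolynomial (Fin n) K →ₐ[K] K)) hQr
      rw [Ideal.map_span, ← Set.range_comp, map_sub, GG_map] at hm
      have e : (mapAlgHom (σ := Fin c) (aeval y : MvPolynomial (Fin n) K →ₐ[K] K)) ∘
          (fun i => GG γ (X : Fin n → MvPolynomial (Fin n) K) (P i)) = fun i => GG γ y (P i) := by
        funext i
        simp only [Function.comp_apply]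
        rw [GG_map]
        simp only [aeval_X]
      rw [e] at hm
      simp only [aeval_X] at hm
      have hm2 := Ideal.sub_mem _ hmem hm
      rw [sub_sub_cancel] at hm2
      have hz := box_not_mem (fun i => GG γ y (P i)) d hd (fun i => GG_rel γ _ hγ _ (hdeg i) i (hP i)) _ (by
        intro α hα
        refine hb α (support_map_subset _ _ hα)) hm2
      have := congrArg (coeff J) hz
      rw [mapAlgHom_apply, coeff_map, coeff_zero] at this
      exact hy this

theorem sz_count [Fintype K] [DecidableEq K] (h : MvPolynomial (Fin n) K) (h0 : h ≠ 0) (hd : 2 * h.totalDegree ≤ Fintype.card K) :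
    Fintype.card K ^ n ≤ 2 * (Finset.univ.filter fun y : Fin n → K => eval y h ≠ 0).card := by
  have h1 := schwartz_zippel_totalDegree h0 (Finset.univ : Finset K)
  have e : (Fintype.piFinset fun _ : Fin n => (Finset.univ : Finset K)) = Finset.univ := by ext; simp
  rw [e, Finset.card_univ] at h1
  have h2 := Finset.card_filter_add_card_filter_not (s := (Finset.univ : Finset (Fin n → K))) (fun y => eval y h = 0)
  rw [Finset.card_univ, Fintype.card_fun, Fintype.card_fin] at h2
  have hpos : (0 : ℚ≥0) < (Fintype.card K : ℚ≥0) := by exact_mod_cast Fintype.card_pos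
  have h3 : (h.totalDegree : ℚ≥0) / Fintype.card K ≤ 1 / 2 := by
    rw [div_le_div_iff₀ hpos (by norm_num)]
    have : ((2 * h.totalDegree : ℕ) : ℚ≥0) ≤ Fintype.card K := by exact_mod_cast hd
    push_cast at this
    rw [one_mul, mul_comm]; exact this
  have h4 := h1.trans h3
  rw [div_le_div_iff₀ (pow_pos hpos n) (by norm_num), one_mul] at h4
  have h5 : (Finset.univ.filter fun y : Fin n → K => eval y h = 0).card * 2 ≤ Fintype.card K ^ n := by exact_mod_cast h4
  simp only [ne_eq]
  omega

end gen
end HR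

open MvPolynomial
namespace HR
set_option linter.unusedSectionVars false
open scoped BigOperators

section alg
variable {K : Type*} [Field K] {c : ℕ}

/-- the space `M * Γ0` -/
noncomputable def U1 (G : Fin c → MvPolynomial (Fin c) K) (A : ℕ) : Submodule K (MvPolynomial (Fin c) K) :=
  restrictTotalDegree (Fin c) K A * Submodule.span K (Set.range G)

variable (G : Fin c → MvPolynomial (Fin c) K) (d : Fin c → ℕ)

theorem one_mem_rtd (m : ℕ) : (1 : MvPolynomial (Fin c) K) ∈ restrictTotalDegree (Fin c) K m := by
  simp [mem_restrictTotalDegree]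

theorem rtd_mono {m m' : ℕ} (h : m ≤ m') : restrictTotalDegree (Fin c) K m ≤ restrictTotalDegree (Fin c) K m' := by
  intro p hp
  rw [mem_restrictTotalDegree] at hp ⊢
  omega

theorem span_le_U1 (A : ℕ) : Submodule.span K (Set.range G) ≤ U1 G A := by
  intro x hx
  have := Submodule.mul_mem_mul (one_mem_rtd (K := K) (c := c) A) hx
  rwa [one_mul] at this

theorem U1_le_ideal (A : ℕ) : ∀ x ∈ U1 G A, x ∈ Ideal.span (Set.range G) := by
  intro x hx
  refine Submodule.mul_induction_on hx (fun m _ g hg => ?_) (fun x y hx hy => Ideal.add_mem _ hx hy)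
  refine Ideal.mul_mem_left _ _ ?_
  refine Submodule.span_induction (fun x hx => Ideal.subset_span hx) (Ideal.zero_mem _) (fun x y _ _ hx hy => Ideal.add_mem _ hx hy)
    (fun a x _ hx => ?_) hg
  rw [smul_eq_C_mul]
  exact Ideal.mul_mem_left _ _ hx

theorem rtd_succ_le (hd : ∀ i, 1 ≤ d i) (hG : ∀ i, Rel 1 (restrictTotalDegree (Fin c) K 1) (d i) (G i) (X i ^ d i)) :
    restrictTotalDegree (Fin c) K (∑ i, (d i - 1) + 1) ≤
      restrictTotalDegree (Fin c) K (∑ i, (d i - 1)) ⊔ U1 G (∑ i, (d i - 1)) := by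
  set A := ∑ i, (d i - 1) with hA
  intro p hp
  rw [mem_restrictTotalDegree] at hp
  rw [p.as_sum]
  refine Submodule.sum_mem _ fun α hα => ?_
  have h1 : α.degree ≤ A + 1 := (le_totalDegree hα).trans hp
  by_cases h2 : α.degree ≤ A
  · refine Submodule.mem_sup_left ?_
    rw [mem_restrictTotalDegree]
    exact (totalDegree_monomial_le _ _).trans h2
  · obtain ⟨i, hi⟩ : ∃ i, d i ≤ α i := by
      by_contra hcon
      push Not at hcon
      apply h2
      rw [Finsupp.degree_eq_sum]
      exact Finset.sum_le_sum fun i _ => by have := hcon i; omega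
    have hle : Finsupp.single i (d i) ≤ α := by
      intro j
      by_cases hj : i = j
      · subst hj; simpa using hi
      · simp [hj]
    set m : MvPolynomial (Fin c) K := monomial (α - Finsupp.single i (d i)) (coeff α p) with hm
    have hdeg : m.totalDegree + d i ≤ A + 1 := by
      have e1 : m.totalDegree ≤ (α - Finsupp.single i (d i)).degree := totalDegree_monomial_le _ _
      have e2 : (α - Finsupp.single i (d i)).degree + d i = α.degree := by
        have := congrArg Finsupp.degree (tsub_add_cancel_of_le hle)
        rw [map_add] at this
        simpa using this
      omega
    have e3 : monomial α (coeff α p) = X i ^ d i * m := by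
      rw [X_pow_eq_monomial, hm, monomial_mul, one_mul, add_tsub_cancel_of_le hle]
    have e4 : X i ^ d i * m = -((G i - X i ^ d i) * m) + m * G i := by ring
    rw [e3, e4]
    have hdi := hd i
    refine Submodule.add_mem_sup (Submodule.neg_mem _ ?_) (Submodule.mul_mem_mul ?_ (Submodule.subset_span ⟨i, rfl⟩))
    · have h5 := (hG i).2.2
      obtain ⟨D, hD⟩ : ∃ D, d i = D + 1 := ⟨d i - 1, by omega⟩
      rw [hD] at h5
      simp only [Dif, one_mul, rtd_pow, mem_restrictTotalDegree] at h5
      rw [mem_restrictTotalDegree]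
      refine (totalDegree_mul _ _).trans ?_
      rw [hD]
      omega
    · rw [mem_restrictTotalDegree]; omega

theorem W_mul_U1 (hd : ∀ i, 1 ≤ d i) (hG : ∀ i, Rel 1 (restrictTotalDegree (Fin c) K 1) (d i) (G i) (X i ^ d i)) :
    restrictTotalDegree (Fin c) K 1 * U1 G (∑ i, (d i - 1)) ≤ U1 G (∑ i, (d i - 1)) * (1 ⊔ U1 G (∑ i, (d i - 1))) := by
  set A := ∑ i, (d i - 1) with hA
  have h1 : restrictTotalDegree (Fin c) K 1 * restrictTotalDegree (Fin c) K A ≤ restrictTotalDegree (Fin c) K A ⊔ U1 G A := by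
    refine le_trans ?_ (rtd_succ_le G d hd hG)
    rw [← rtd_pow K c A, ← rtd_pow K c (A + 1), pow_succ']
  have h2 : (restrictTotalDegree (Fin c) K A ⊔ U1 G A) * Submodule.span K (Set.range G) ≤ U1 G A * (1 ⊔ U1 G A) := by
    rw [Submodule.sup_mul]
    refine sup_le ?_ ?_
    · change U1 G A ≤ _
      rw [Submodule.mul_sup, mul_one]
      exact le_sup_left
    · exact mul_le_mul_right ((span_le_U1 G A).trans le_sup_right) _
  refine le_trans ?_ h2
  conv_lhs => rw [U1, ← mul_assoc]
  exact mul_le_mul_left h1 _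

theorem U1_mul_V (hd : ∀ i, 1 ≤ d i) (hG : ∀ i, Rel 1 (restrictTotalDegree (Fin c) K 1) (d i) (G i) (X i ^ d i)) (m : ℕ) :
    U1 G (∑ i, (d i - 1)) * (restrictTotalDegree (Fin c) K 1 ⊔ U1 G (∑ i, (d i - 1))) ^ m ≤
      U1 G (∑ i, (d i - 1)) * (1 ⊔ U1 G (∑ i, (d i - 1))) ^ m := by
  have h0 := W_mul_U1 G d hd hG
  set U := U1 G (∑ i, (d i - 1)) with hU
  set W := restrictTotalDegree (Fin c) K 1
  have h1 : U * (W ⊔ U) ≤ U * (1 ⊔ U) := by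
    rw [Submodule.mul_sup]
    refine sup_le ?_ ?_
    · rw [mul_comm]; exact h0
    · exact mul_le_mul_right le_sup_right _
  induction m with
  | zero => simp
  | succ m ih =>
    calc U * (W ⊔ U) ^ (m + 1) = (U * (W ⊔ U) ^ m) * (W ⊔ U) := by rw [pow_succ]; ring
      _ ≤ (U * (1 ⊔ U) ^ m) * (W ⊔ U) := mul_le_mul_left ih _
      _ = (U * (W ⊔ U)) * (1 ⊔ U) ^ m := by ring
      _ ≤ (U * (1 ⊔ U)) * (1 ⊔ U) ^ m := mul_le_mul_left h1 _
      _ = U * (1 ⊔ U) ^ (m + 1) := by rw [pow_succ]; ring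

theorem U1_le_rtd {A E : ℕ} (hG : ∀ i, (G i).totalDegree ≤ E) : U1 G A ≤ restrictTotalDegree (Fin c) K (A + E) := by
  rw [U1, ← rtd_pow K c (A + E), pow_add, rtd_pow, rtd_pow]
  refine mul_le_mul_right ?_ _
  rw [Submodule.span_le]
  rintro _ ⟨i, rfl⟩
  rw [SetLike.mem_coe, mem_restrictTotalDegree]
  exact hG i

end alg
end HR

open MvPolynomial
namespace HR
set_option linter.unusedSectionVars false
open scoped BigOperators

theorem GG_self {K : Type*} [Field K] {c n : ℕ} (γ : Fin n → MvPolynomial (Fin c) K) (y : Fin n → K) (P : MvPolynomial (Fin n) K) :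
    GG γ y P = aeval (fun j => γ j + C (y j)) P := by
  unfold GG
  have : (fun j => map (algebraMap K K) (γ j) + C (y j)) = fun j => γ j + C (y j) := by
    funext j
    rw [Algebra.algebraMap_self, map_id]
  rw [this]

theorem aeval_congr_ideal {K R : Type*} [Field K] [CommRing R] [Algebra K R] {n : ℕ} (I : Ideal R) (z u : Fin n → R)
    (hu : ∀ j, u j ∈ I) (Q : MvPolynomial (Fin n) K) : aeval (fun j => z j + u j) Q - aeval z Q ∈ I := by
  rw [← Ideal.Quotient.eq]
  have h1 := comp_aeval_apply (R := K) (fun j => z j + u j) (Ideal.Quotient.mkₐ K I) Q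
  have h2 := comp_aeval_apply (R := K) z (Ideal.Quotient.mkₐ K I) Q
  have h3 : (fun j => Ideal.Quotient.mkₐ K I (z j + u j)) = fun j => Ideal.Quotient.mkₐ K I (z j) := by
    funext j
    rw [map_add]
    have : Ideal.Quotient.mkₐ K I (u j) = 0 := Ideal.Quotient.eq_zero_iff_mem.mpr (hu j)
    rw [this, add_zero]
  rw [h3, ← h2] at h1
  exact h1

theorem count {E s L : ℕ} (hL : EQP E s L) {K : Type} [Field K] [Fintype K] [DecidableEq K] {c n : ℕ}
    (P : Fin c → MvPolynomial (Fin n) K) (d : Fin c → ℕ) (hd1 : ∀ i, 1 ≤ d i) (hdE : ∀ i, d i ≤ E)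
    (hdeg : ∀ i, (P i).totalDegree ≤ d i) (hP : Adapted P d L)
    (γ : Fin n → MvPolynomial (Fin c) K) (hγ : ∀ j, (γ j).totalDegree ≤ 1)
    (Q : MvPolynomial (Fin n) K) (S : Finset (Fin n → K))
    (hS : ∀ x, (∀ i, eval x (P i) = 0) → eval x Q ≠ 0 → x ∈ S)
    (G : Fin c → MvPolynomial (Fin c) K)
    (hG : ∀ i, Rel 1 (restrictTotalDegree (Fin c) K 1) (d i) (G i) (X i ^ d i))
    (Good : Finset (Fin n → K))
    (hGood : ∀ y ∈ Good, (∀ i, GG γ y (P i) = G i) ∧ GG γ y Q ∉ Ideal.span (Set.range G))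
    (T : ℕ) (hT : ∑ i, (d i - 1) + E + 1 ≤ T) (hTQ : Q.totalDegree * T < Fintype.card K) :
    Fintype.card K ^ s * Good.card ≤ Fintype.card K ^ (s + c + ∑ i, (c + 1) ^ (T * d i)) * S.card +
      Fintype.card K ^ (∑ i, (c + 1) ^ (T * d i)) * Fintype.card K ^ n := by
  classical
  set A := ∑ i, (d i - 1) with hA
  set q := Fintype.card K with hq
  have hq0 : 0 < q := Fintype.card_pos
  set V1 := U1 G A with hV1
  set U : Submodule K (MvPolynomial (Fin c) K) := 1 ⊔ V1 with hU
  have hGdeg : ∀ i, (G i).totalDegree ≤ E := fun i => by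
    have := (hG i).1
    rw [rtd_pow, mem_restrictTotalDegree] at this
    exact this.trans (hdE i)
  have hV1T : V1 ≤ restrictTotalDegree (Fin c) K T := (U1_le_rtd G hGdeg).trans (rtd_mono (by omega))
  have hUT : U ≤ restrictTotalDegree (Fin c) K T := sup_le (Submodule.one_le.mpr (one_mem_rtd T)) hV1T
  have h1U : (1 : MvPolynomial (Fin c) K) ∈ U := Submodule.mem_sup_left (Submodule.one_le.mp le_rfl)
  have hCU : ∀ t : K, C t ∈ U := fun t => Submodule.mem_sup_left (Submodule.mem_one.mpr ⟨t, rfl⟩)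
  have finT : ∀ m, Finite (restrictTotalDegree (Fin c) K m) := fun m => (rtd_finite K c m).1
  have : Finite U := (card_le_of_le hUT).1
  have : Finite V1 := (card_le_of_le hV1T).1
  let _ : Fintype U := Fintype.ofFinite U
  let _ : Fintype V1 := Fintype.ofFinite V1
  have hH : ∀ i, V1 * U ^ (d i - 1) ≤ restrictTotalDegree (Fin c) K (T * d i) := by
    intro i
    calc V1 * U ^ (d i - 1) ≤ U * U ^ (d i - 1) := mul_le_mul_left le_sup_right _
      _ = U ^ (d i) := by rw [← pow_succ', Nat.sub_add_cancel (hd1 i)]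
      _ ≤ (restrictTotalDegree (Fin c) K T) ^ d i := pow_le_pow_left' hUT _
      _ = _ := by rw [← rtd_pow K c T, ← pow_mul, rtd_pow]
  have hHf : ∀ i, Finite ↥(V1 * U ^ (d i - 1)) := fun i => (card_le_of_le (hH i)).1
  -- the set Y
  let emb : (Fin n → K) × (Fin n → V1) → (Fin n → U) := fun p j =>
    ⟨C (p.1 j) + (p.2 j : MvPolynomial (Fin c) K), U.add_mem (hCU _) (Submodule.mem_sup_right (p.2 j).2)⟩
  let Y : Finset (Fin n → U) := (Good ×ˢ Finset.univ).image emb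
  have hinj : Function.Injective emb := by
    intro p p' h
    have h1 : ∀ j, C (p.1 j) + (p.2 j : MvPolynomial (Fin c) K) = C (p'.1 j) + (p'.2 j : MvPolynomial (Fin c) K) :=
      fun j => congrArg Subtype.val (congrFun h j)
    have h2 : p.1 = p'.1 := by
      funext j
      have h3 : C (p.1 j - p'.1 j) = (p'.2 j : MvPolynomial (Fin c) K) - (p.2 j : MvPolynomial (Fin c) K) := by
        rw [C_sub]
        linear_combination h1 j
      have h4 : (C (p.1 j - p'.1 j) : MvPolynomial (Fin c) K) ∈ Ideal.span (Set.range G) := by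
        rw [h3]
        exact U1_le_ideal G A _ (V1.sub_mem (p'.2 j).2 (p.2 j).2)
      have h5 := box_not_mem G d hd1 hG _ (by
        intro α hα i
        rw [mem_support_iff, coeff_C] at hα
        have : α = 0 := by
          by_contra hne
          exact hα (if_neg (Ne.symm hne))
        rw [this]; exact hd1 i) h4
      rw [map_eq_zero_iff _ (C_injective _ _)] at h5
      exact sub_eq_zero.mp h5
    refine Prod.ext h2 ?_
    funext j
    apply Subtype.ext
    have := h1 j
    rw [h2] at this
    exact add_left_cancel this
  have hYcard : Y.card = Good.card * Fintype.card V1 ^ n := by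
    rw [Finset.card_image_of_injective _ hinj, Finset.card_product, Finset.card_univ, Fintype.card_fun, Fintype.card_fin]
  have hUcard : Fintype.card U ≤ q * Fintype.card V1 := by
    rw [hq, ← Fintype.card_prod]
    refine Fintype.card_le_of_surjective (fun p : K × V1 => (⟨C p.1 + (p.2 : MvPolynomial (Fin c) K), U.add_mem (hCU _) (Submodule.mem_sup_right p.2.2)⟩ : U)) ?_
    rintro ⟨x, hx⟩
    obtain ⟨a, ha, b, hb, rfl⟩ := Submodule.mem_sup.mp hx
    obtain ⟨t, rfl⟩ := Submodule.mem_one.mp ha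
    exact ⟨(t, ⟨b, hb⟩), rfl⟩
  let Y' : Finset (Fin n → U) := Finset.univ.filter fun γ' => ∃ x0 : Fin c → K,
    (fun j => eval x0 (γ j + (γ' j : MvPolynomial (Fin c) K))) ∈ S
  have hY'card : Y'.card ≤ q ^ c * S.card * Fintype.card V1 ^ n := by
    have hx : ∀ x0 : Fin c → K, (Finset.univ.filter fun γ' : Fin n → U =>
        (fun j => eval x0 (γ j + (γ' j : MvPolynomial (Fin c) K))) ∈ S).card * q ^ n ≤ S.card * Fintype.card U ^ n := by
      intro x0
      let Φ : (Fin n → U) →+ (Fin n → K) :=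
        { toFun := fun γ' j => eval x0 (γ' j : MvPolynomial (Fin c) K)
          map_zero' := by funext j; simp
          map_add' := by intro a b; funext j; simp }
      have hΦ : Function.Surjective Φ := by
        intro t
        refine ⟨fun j => ⟨C (t j), hCU _⟩, ?_⟩
        funext j
        exact eval_C _
      have h := fibre_card Φ hΦ (S.image fun x j => x j - eval x0 (γ j))
      rw [Fintype.card_fun, Fintype.card_fun, Fintype.card_fin] at h
      calc _ ≤ (Finset.univ.filter fun γ' : Fin n → U => Φ γ' ∈ S.image fun x j => x j - eval x0 (γ j)).card * q ^ n := by
            refine Nat.mul_le_mul_right _ (Finset.card_le_card ?_)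
            intro γ' hγ'
            rw [Finset.mem_filter] at hγ' ⊢
            refine ⟨hγ'.1, Finset.mem_image.mpr ⟨_, hγ'.2, ?_⟩⟩
            funext j
            rw [map_add, add_sub_cancel_left]
            rfl
        _ ≤ _ := by
            rw [h]
            exact Nat.mul_le_mul_right _ Finset.card_image_le
    have h2 : Y'.card * q ^ n ≤ q ^ c * (S.card * Fintype.card U ^ n) := by
      have h3 : Y' ⊆ Finset.univ.biUnion fun x0 : Fin c → K => Finset.univ.filter fun γ' : Fin n → U =>
          (fun j => eval x0 (γ j + (γ' j : MvPolynomial (Fin c) K))) ∈ S := by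
        intro γ' hγ'
        obtain ⟨x0, hx0⟩ := (Finset.mem_filter.mp hγ').2
        exact Finset.mem_biUnion.mpr ⟨x0, Finset.mem_univ _, Finset.mem_filter.mpr ⟨Finset.mem_univ _, hx0⟩⟩
      refine (Nat.mul_le_mul_right _ ((Finset.card_le_card h3).trans Finset.card_biUnion_le)).trans ?_
      rw [Finset.sum_mul]
      refine (Finset.sum_le_sum fun x0 _ => hx x0).trans ?_
      rw [Finset.sum_const, Finset.card_univ, Fintype.card_fun, Fintype.card_fin, smul_eq_mul]
    have h4 : Y'.card * q ^ n ≤ q ^ c * S.card * Fintype.card V1 ^ n * q ^ n := by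
      refine h2.trans ?_
      rw [mul_assoc, mul_assoc]
      refine Nat.mul_le_mul_left _ (Nat.mul_le_mul_left _ ?_)
      refine (Nat.pow_le_pow_left hUcard n).trans ?_
      rw [mul_pow, mul_comm]
    exact Nat.le_of_mul_le_mul_right h4 (pow_pos hq0 n)
  have hdecomp : ∀ γ' ∈ Y, ∃ y ∈ Good, ∃ u : Fin n → MvPolynomial (Fin c) K, (∀ j, u j ∈ V1) ∧
      (fun j => γ j + (γ' j : MvPolynomial (Fin c) K)) = fun j => (γ j + C (y j)) + u j := by
    intro γ' hγ'
    obtain ⟨p, hp, rfl⟩ := Finset.mem_image.mp hγ'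
    refine ⟨p.1, (Finset.mem_product.mp hp).1, fun j => p.2 j, fun j => (p.2 j).2, ?_⟩
    funext j
    simp only [emb]
    ring
  have main := hL K c n P d hd1 hdE hdeg hP (MvPolynomial (Fin c) K) V1 U γ 0 (fun i => V1 * U ^ (d i - 1)) Y
    le_sup_right (fun i => le_rfl)
    (by
      intro γ' hγ' δ hδ
      obtain ⟨p, hp, rfl⟩ := Finset.mem_image.mp hγ'
      refine Finset.mem_image.mpr ⟨(p.1, fun j => p.2 j + ⟨δ j, hδ j⟩), ?_, ?_⟩
      · exact Finset.mem_product.mpr ⟨(Finset.mem_product.mp hp).1, Finset.mem_univ _⟩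
      · funext j
        apply Subtype.ext
        simp only [emb, Pi.add_apply, Submodule.coe_add]
        ring)
    (by
      intro γ' hγ' i
      obtain ⟨y, hy, u, hu, e⟩ := hdecomp γ' hγ'
      rw [e, Pi.zero_apply, sub_zero]
      have h1 : aeval (fun j => γ j + C (y j)) (P i) = G i := by
        rw [← GG_self]; exact (hGood y hy).1 i
      have h2 := diff_mem (k := K) (U1 := V1) (V := restrictTotalDegree (Fin c) K 1 ⊔ V1)
        (Submodule.mem_sup_left (one_mem_rtd 1)) le_sup_right (fun j => γ j + C (y j)) u
        (fun j => Submodule.mem_sup_left ((mem_restrictTotalDegree _ _ _).mpr (by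
          refine (totalDegree_add _ _).trans (max_le (hγ j) ?_)
          simp))) hu (P i) (hdeg i)
      rw [h1] at h2
      obtain ⟨D, hD⟩ : ∃ D, d i = D + 1 := ⟨d i - 1, by have := hd1 i; omega⟩
      rw [hD] at h2 ⊢
      simp only [Dif] at h2
      rw [Nat.add_sub_cancel]
      have h3 := U1_mul_V G d hd1 hG D h2
      rw [← hA, ← hV1, ← hU] at h3
      have h4 : G i ∈ V1 * U ^ D := by
        have := Submodule.mul_mem_mul (span_le_U1 G A (Submodule.subset_span ⟨i, rfl⟩)) (Submodule.pow_mem_pow U h1U D)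
        rwa [one_pow, mul_one] at this
      have := Submodule.add_mem _ h3 h4
      rwa [sub_add_cancel] at this)
    Y'
    (by
      intro γ' hγ' hsol
      obtain ⟨y, hy, u, hu, e⟩ := hdecomp γ' hγ'
      by_contra hcon
      have hno : ∀ x0 : Fin c → K, (fun j => eval x0 (γ j + (γ' j : MvPolynomial (Fin c) K))) ∉ S := by
        intro x0 hx0
        exact hcon (Finset.mem_filter.mpr ⟨Finset.mem_univ _, x0, hx0⟩)
      have hev : ∀ (x0 : Fin c → K) (F : MvPolynomial (Fin n) K),
          eval x0 (aeval (fun j => γ j + (γ' j : MvPolynomial (Fin c) K)) F) =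
            eval (fun j => eval x0 (γ j + (γ' j : MvPolynomial (Fin c) K))) F := by
        intro x0 F
        exact comp_aeval_apply (R := K) (fun j => γ j + (γ' j : MvPolynomial (Fin c) K)) (aeval x0 : MvPolynomial (Fin c) K →ₐ[K] K) F
      have hz : aeval (fun j => γ j + (γ' j : MvPolynomial (Fin c) K)) Q = 0 := by
        apply eq_zero_of_vanish
        · refine lt_of_le_of_lt (totalDegree_aeval_le _ T (fun j => ?_) Q) hTQ
          refine (totalDegree_add _ _).trans (max_le ((hγ j).trans (by omega)) ?_)
          exact (mem_restrictTotalDegree _ _ _).mp (hUT (γ' j).2)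
        · intro x0
          rw [hev]
          by_contra hne
          refine hno x0 (hS _ (fun i => ?_) hne)
          rw [← hev, hsol i, Pi.zero_apply, map_zero]
      rw [e] at hz
      have h1 := aeval_congr_ideal (Ideal.span (Set.range G)) (fun j => γ j + C (y j)) u (fun j => U1_le_ideal G A _ (hu j)) Q
      rw [hz, zero_sub, ← GG_self] at h1
      exact (hGood y hy).2 ((Ideal.neg_mem_iff _).mp h1))
  have hprod : ∏ i, Nat.card ↥(V1 * U ^ (d i - 1)) ≤ q ^ (∑ i, (c + 1) ^ (T * d i)) := by
    rw [← Finset.prod_pow_eq_pow_sum]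
    refine Finset.prod_le_prod' fun i _ => ?_
    have := finT (T * d i)
    exact (card_le_of_le (hH i)).2.trans (rtd_finite K c _).2
  set C3 := ∑ i, (c + 1) ^ (T * d i)
  have hVpos : 0 < Fintype.card V1 ^ n := pow_pos Fintype.card_pos n
  refine Nat.le_of_mul_le_mul_right ?_ hVpos
  calc q ^ s * Good.card * Fintype.card V1 ^ n = q ^ s * Y.card := by rw [hYcard]; ring
    _ ≤ _ := main
    _ ≤ q ^ s * (q ^ c * S.card * Fintype.card V1 ^ n) * q ^ C3 + q ^ C3 * (q * Fintype.card V1) ^ n := by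
        refine add_le_add (Nat.mul_le_mul (Nat.mul_le_mul_left _ hY'card) hprod) (Nat.mul_le_mul hprod (Nat.pow_le_pow_left hUcard n))
    _ = _ := by rw [mul_pow, pow_add, pow_add]; ring

end HR

open MvPolynomial
namespace HR
set_option linter.unusedSectionVars false
open scoped BigOperators

theorem multiDiff_sum {k : Type*} [CommRing k] {σ : Type*} {c : ℕ} (e : ℕ) (b : Fin c → k) (P : Fin c → MvPolynomial σ k) :
    multiDiff e (∑ i, C (b i) * P i) = ∑ i, C (b i) * multiDiff e (P i) := by
  simp only [multiDiff, map_sum, map_mul, Finset.mul_sum, Finset.smul_sum]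
  rw [Finset.sum_comm]
  refine Finset.sum_congr rfl fun i _ => Finset.sum_congr rfl fun S _ => ?_
  rw [mul_smul_comm]
  have : aeval (fun j : σ => ∑ i ∈ S, (X (i, j) : MvPolynomial (Fin e × σ) k)) (C (b i)) = C (b i) := aeval_C _ _
  rw [this]

theorem multiDiff_map {k K : Type*} [CommRing k] [CommRing K] [Algebra k K] {σ : Type*} (e : ℕ) (P : MvPolynomial σ k) :
    multiDiff e (map (algebraMap k K) P) = map (algebraMap k K) (multiDiff e P) := by
  simp only [multiDiff, map_sum]
  refine Finset.sum_congr rfl fun S _ => ?_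
  rw [aeval_map_algebraMap, smul_eq_C_mul, smul_eq_C_mul, map_mul, map_C]
  have h1 : algebraMap k K ((-1) ^ (e - S.card)) = (-1) ^ (e - S.card) := by simp
  rw [h1]
  have h := comp_aeval_apply (R := k) (fun j : σ => ∑ i ∈ S, (X (i, j) : MvPolynomial (Fin e × σ) k))
    (mapAlgHom (σ := Fin e × σ) (Algebra.ofId k K)) P
  have h2 : (fun j : σ => (mapAlgHom (σ := Fin e × σ) (Algebra.ofId k K)) (∑ i ∈ S, (X (i, j) : MvPolynomial (Fin e × σ) k))) =
      fun j : σ => ∑ i ∈ S, X (i, j) := by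
    funext j
    rw [map_sum]
    refine Finset.sum_congr rfl fun i _ => ?_
    rw [mapAlgHom_apply]
    exact map_X _ _
  rw [h2] at h
  rw [← h]
  rfl

theorem Adapted.mono {k : Type} [Field k] {n c : ℕ} {P : Fin c → MvPolynomial (Fin n) k} {d : Fin c → ℕ} {L L' : ℕ}
    (hd1 : ∀ i, 1 ≤ d i) (h : Adapted P d L') (hL : L ≤ L') : Adapted P d L := by
  intro b e h1 h2 h3
  refine h b e h1 h2 (h3.mono hL ?_)
  obtain ⟨i, _, rfl⟩ := h1
  rw [totalDegree_zero]
  exact hd1 i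

theorem Adapted.ext {k : Type} [Field k] {n c : ℕ} {P : Fin c → MvPolynomial (Fin n) k} {d : Fin c → ℕ} {L N : ℕ}
    {K : Type} [Field K] [Algebra k K] (β : Module.Basis (Fin N) k K)
    (h : Adapted P d (L * N)) : Adapted (fun i => map (algebraMap k K) (P i)) d L := by
  intro b e h1 h2 h3
  obtain ⟨i0, hi0, he⟩ := h1
  obtain ⟨τ, hτ⟩ := exists_functional' (k := k) (b i0) hi0
  have h4 := descent β τ h3
  refine h (fun i => τ (b i)) e ⟨i0, by rw [hτ]; exact one_ne_zero, he⟩ (fun i hi => h2 i fun hb => hi (by rw [hb, map_zero])) ?_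
  rw [multiDiff_sum] at h4 ⊢
  rw [lmap_sum] at h4
  have e1 : ∀ i, lmap τ (C (b i) * multiDiff e (map (algebraMap k K) (P i))) = C (τ (b i)) * multiDiff e (P i) := by
    intro i
    rw [multiDiff_map, lmap_C_map]
  simp only [e1] at h4
  exact h4

theorem ideal_descent {k : Type*} [Field k] {n c : ℕ} (P : Fin c → MvPolynomial (Fin n) k) (Q : MvPolynomial (Fin n) k)
    {K : Type*} [Field K] [Algebra k K]
    (h : map (algebraMap k K) Q ∈ Ideal.span (Set.range fun i => map (algebraMap k K) (P i))) : Q ∈ Ideal.span (Set.range P) := by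
  obtain ⟨τ, hτ⟩ := exists_functional (k := k) (K := K)
  rw [Ideal.mem_span_range_iff_exists_fun] at h ⊢
  obtain ⟨f, hf⟩ := h
  refine ⟨fun i => lmap τ (f i), ?_⟩
  have h1 := congrArg (lmap τ) hf
  rw [lmap_sum] at h1
  have h2 : lmap τ (map (algebraMap k K) Q) = Q := by
    have := lmap_C_map τ 1 Q
    rwa [C_1, one_mul, hτ, C_1, one_mul] at this
  rw [h2] at h1
  rw [← h1]
  refine Finset.sum_congr rfl fun i _ => ?_
  rw [mul_comm (f i), lmap_map_mul, mul_comm]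

theorem pigeon {α β : Type*} [Fintype β] [Nonempty β] [DecidableEq β] (s : Finset α) (f : α → β) :
    ∃ b, s.card ≤ Fintype.card β * (s.filter fun a => f a = b).card := by
  obtain ⟨b, _, hb⟩ := Finset.exists_max_image (Finset.univ : Finset β) (fun b => (s.filter fun a => f a = b).card) Finset.univ_nonempty
  refine ⟨b, ?_⟩
  rw [Finset.card_eq_sum_card_fiberwise (f := f) (t := Finset.univ) (by simp)]
  refine (Finset.sum_le_card_nsmul _ _ _ fun b' hb' => hb b' hb').trans ?_
  rw [Finset.card_univ, smul_eq_mul]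

theorem arith (B g S n c C2 C3 : ℕ) (hB : 2 ≤ B) (h1 : B ^ n ≤ 2 * (B ^ C2 * g))
    (h2 : B ^ (C2 + C3 + 3) * g ≤ B ^ (C2 + C3 + 3 + c + C3) * S + B ^ C3 * B ^ n)
    (h3 : B ^ (C2 + C3 + c + 3) * S ≤ B ^ n) : False := by
  have hB0 : 0 < B := by omega
  have hX : 0 < B ^ (C2 + C3 + 3) * B ^ n := by positivity
  have h4 : B ^ (C2 + C3 + 3) * B ^ n ≤ 2 * B ^ C2 * (B ^ (C2 + C3 + 3 + c + C3) * S + B ^ C3 * B ^ n) := by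
    calc B ^ (C2 + C3 + 3) * B ^ n ≤ B ^ (C2 + C3 + 3) * (2 * (B ^ C2 * g)) := Nat.mul_le_mul_left _ h1
      _ = 2 * B ^ C2 * (B ^ (C2 + C3 + 3) * g) := by ring
      _ ≤ _ := Nat.mul_le_mul_left _ h2
  have h5 : B ^ 3 * (B ^ (C2 + C3 + 3) * B ^ n) ≤ 4 * (B ^ (C2 + C3 + 3) * B ^ n) := by
    calc B ^ 3 * (B ^ (C2 + C3 + 3) * B ^ n) ≤ B ^ 3 * (2 * B ^ C2 * (B ^ (C2 + C3 + 3 + c + C3) * S + B ^ C3 * B ^ n)) :=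
          Nat.mul_le_mul_left _ h4
      _ = 2 * B ^ (C2 + C3 + 3) * (B ^ (C2 + C3 + c + 3) * S) + 2 * (B ^ (C2 + C3 + 3) * B ^ n) := by ring
      _ ≤ 2 * B ^ (C2 + C3 + 3) * B ^ n + 2 * (B ^ (C2 + C3 + 3) * B ^ n) :=
          Nat.add_le_add_right (Nat.mul_le_mul_left _ h3) _
      _ = _ := by ring
  have h6 := Nat.le_of_mul_le_mul_right h5 hX
  have h7 : 2 ^ 3 ≤ B ^ 3 := Nat.pow_le_pow_left hB 3
  omega

theorem sum_pow_le {c : ℕ} (b E : ℕ) (hb : 1 ≤ b) (f : Fin c → ℕ) (hf : ∀ i, f i ≤ E) : ∑ i, b ^ f i ≤ c * b ^ E := by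
  refine (Finset.sum_le_card_nsmul _ _ (b ^ E) fun i _ => Nat.pow_le_pow_right hb (hf i)).trans ?_
  simp

theorem adapted_main (c E : ℕ) : ∃ r : ℕ, ∀ (k : Type) [Field k] [Fintype k] (n : ℕ) (P : Fin c → MvPolynomial (Fin n) k)
    (d : Fin c → ℕ), (∀ i, 1 ≤ d i) → (∀ i, d i ≤ E) → (∀ i, (P i).totalDegree ≤ d i) → Adapted P d r →
    ∀ j, 1 ≤ j → j ≤ 2 → (2 ≤ j ∨ ∀ i, d i = 1) → ∀ Q : MvPolynomial (Fin n) k, j * Q.totalDegree < Fintype.card k →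
    (∀ x : Fin n → k, (∀ i, eval x (P i) = 0) → eval x Q = 0) → Q ∈ Ideal.span (Set.range P) := by
  classical
  let T := c * E + E + 1
  let N := T + 1
  let C2 := c * (c + 1) ^ E
  let C3 := c * (c + 1) ^ (T * E)
  let C1 := c * (N + 1) ^ (2 * E)
  obtain ⟨L', hL'⟩ := EQ E (C2 + C3 + 3)
  obtain ⟨L, hL⟩ := EQ E (C1 + N * (C2 + C3 + c + 3))
  refine ⟨max L (L' * N), ?_⟩
  intro k _ _ n P d hd1 hdE hdeg hP j hj hj2 hjd Q hQ hvan
  set q := Fintype.card k with hq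
  have hq2 : 2 ≤ q := Fintype.one_lt_card
  obtain ⟨K, _, _, _, β, hK⟩ := exists_ext k N (by simp [N])
  have hPK : Adapted (fun i => map (algebraMap k K) (P i)) d L' := Adapted.ext β (hP.mono hd1 (le_max_right _ _))
  have hdegK : ∀ i, (map (algebraMap k K) (P i)).totalDegree ≤ d i :=
    fun i => (Finset.sup_mono (support_map_subset _ _)).trans (hdeg i)
  have hC2 : ∑ i, (c + 1) ^ d i ≤ C2 := sum_pow_le _ _ (by omega) _ hdE
  have hC3 : ∑ i, (c + 1) ^ (T * d i) ≤ C3 := sum_pow_le _ _ (by omega) _ fun i => Nat.mul_le_mul_left _ (hdE i)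
  have hC1 : ∑ i, (N + 1) ^ (j * d i) ≤ C1 := sum_pow_le _ _ (by omega) _ fun i => Nat.mul_le_mul hj2 (hdE i)
  obtain ⟨γ, hγ, hγP⟩ := exists_v hL' _ d hd1 hdE hdegK hPK (by omega)
  apply ideal_descent (K := K)
  rcases generic γ hγ _ d hd1 hdegK hγP (map (algebraMap k K) Q) with hgood | ⟨h, h0, hhd, hh⟩
  · exact hgood
  exfalso
  set B := Fintype.card K with hB
  have hB2 : 2 ≤ B := Fintype.one_lt_card
  have hQq : Q.totalDegree < q := lt_of_le_of_lt (Nat.le_mul_of_pos_left _ hj) hQ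
  have hQdeg : (map (algebraMap k K) Q).totalDegree ≤ Q.totalDegree := Finset.sup_mono (support_map_subset _ _)
  have hTq : T < q ^ T := Nat.lt_pow_self hq2
  have hBq : B = q * q ^ T := by rw [hK]; simp only [N]; rw [pow_succ']
  have hT1 : 1 ≤ T := by simp only [T]; omega
  have hbig : Q.totalDegree * T < B := by
    rw [hBq]
    calc Q.totalDegree * T ≤ Q.totalDegree * q ^ T := Nat.mul_le_mul_left _ hTq.le
      _ < _ := Nat.mul_lt_mul_of_pos_right hQq (by positivity)
  have hbig2 : 2 * Q.totalDegree ≤ B := by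
    rw [hBq, mul_comm]
    exact Nat.mul_le_mul hQq.le (by omega)
  have hcnt := sz_count h h0 (by rw [← hB]; omega)
  rw [← hB] at hcnt
  set Good0 := Finset.univ.filter fun y : Fin n → K => eval y h ≠ 0 with hGood0
  have hrel : ∀ (y : Fin n → K) i, Rel 1 (restrictTotalDegree (Fin c) K 1) (d i) (GG γ y (map (algebraMap k K) (P i))) (X i ^ d i) :=
    fun y i => GG_rel γ y hγ _ (hdegK i) i (hγP i)
  have : ∀ i, Finite (restrictTotalDegree (Fin c) K (d i)) := fun i => (rtd_finite K c (d i)).1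
  let _ : ∀ i, Fintype (restrictTotalDegree (Fin c) K (d i)) := fun i => Fintype.ofFinite _
  obtain ⟨G, hGp⟩ := pigeon Good0 (fun y i => (⟨GG γ y (map (algebraMap k K) (P i)), by
    rw [← rtd_pow]; exact (hrel y i).1⟩ : restrictTotalDegree (Fin c) K (d i)))
  set Good := Good0.filter fun y => (fun i => (⟨GG γ y (map (algebraMap k K) (P i)), by
    rw [← rtd_pow]; exact (hrel y i).1⟩ : restrictTotalDegree (Fin c) K (d i))) = G with hGood
  have hcardH : Fintype.card (∀ i, restrictTotalDegree (Fin c) K (d i)) ≤ B ^ C2 := by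
    rw [Fintype.card_pi]
    refine le_trans (Finset.prod_le_prod' fun i _ => ?_) ((Finset.prod_pow_eq_pow_sum _ _ _).le.trans
      (Nat.pow_le_pow_right (by omega) hC2))
    rw [← Nat.card_eq_fintype_card]
    exact (rtd_finite K c (d i)).2
  have hmem : ∀ y ∈ Good, ∀ i, GG γ y (map (algebraMap k K) (P i)) = (G i : MvPolynomial (Fin c) K) := by
    intro y hy i
    have := (Finset.mem_filter.mp hy).2
    exact congrArg Subtype.val (congrFun this i)
  have h1 : B ^ n ≤ 2 * (B ^ C2 * Good.card) :=
    hcnt.trans (Nat.mul_le_mul_left _ (hGp.trans (Nat.mul_le_mul_right _ hcardH)))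
  have hne : Good.Nonempty := by
    rw [← Finset.card_pos]
    by_contra h0
    have : Good.card = 0 := by omega
    rw [this, mul_zero, mul_zero] at h1
    have : 0 < B ^ n := by positivity
    omega
  obtain ⟨y0, hy0⟩ := hne
  set S := Finset.univ.filter fun x : Fin n → K => (∀ i, aeval x (P i) = 0) ∧ aeval x Q ≠ 0 with hS
  have hev : ∀ (x : Fin n → K) (F : MvPolynomial (Fin n) k), eval x (map (algebraMap k K) F) = aeval x F := by
    intro x F
    rw [eval_map, aeval_def]
  have h2 := count hL' _ d hd1 hdE hdegK hPK γ hγ (map (algebraMap k K) Q) S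
    (by
      intro x hx hxQ
      rw [hS, Finset.mem_filter]
      refine ⟨Finset.mem_univ _, fun i => ?_, ?_⟩
      · rw [← hev]; exact hx i
      · rw [← hev]; exact hxQ) (fun i => (G i : MvPolynomial (Fin c) K))
    (fun i => by rw [← hmem y0 hy0 i]; exact hrel y0 i) Good
    (by
      intro y hy
      refine ⟨hmem y hy, ?_⟩
      have h3 := hh y (Finset.mem_filter.mp (Finset.mem_filter.mp hy).1).2
      have e : (fun i => GG γ y (map (algebraMap k K) (P i))) = fun i => (G i : MvPolynomial (Fin c) K) := funext (hmem y hy)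
      rw [e] at h3
      exact h3) T
    (by
      have : ∑ i, (d i - 1) ≤ c * E := by
        refine (Finset.sum_le_card_nsmul _ _ E fun i _ => (Nat.sub_le _ _).trans (hdE i)).trans ?_
        simp
      simp only [T]
      omega)
    (lt_of_le_of_lt (Nat.mul_le_mul_right _ hQdeg) hbig)
  rw [← hB] at h2
  have h3 := stepD hL P d hd1 hdE hdeg (hP.mono hd1 (le_max_left _ _)) j hj hjd Q hQ hvan β S
    (fun x hx => (Finset.mem_filter.mp hx).2)
  rw [← hq, ← hB] at h3
  have h3' : B ^ (C2 + C3 + c + 3) * S.card ≤ B ^ n := by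
    have h4 := h3.trans (Nat.mul_le_mul_right _ (Nat.pow_le_pow_right (by omega) hC1))
    rw [pow_add, mul_assoc, pow_mul q N, ← hK] at h4
    exact Nat.le_of_mul_le_mul_left h4 (by positivity)
  refine arith B Good.card S.card n c C2 C3 hB2 h1 (h2.trans ?_) h3'
  refine Nat.add_le_add (Nat.mul_le_mul_right _ (Nat.pow_le_pow_right (by omega) (by omega)))
    (Nat.mul_le_mul_right _ (Nat.pow_le_pow_right (by omega) hC3))

end HR

open MvPolynomial
namespace HR
set_option linter.unusedSectionVars false
open scoped BigOperators

/-- admissible replacement of a collection -/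
def Repl {K : Type*} [Field K] {c n : ℕ} (d : Fin c → ℕ) (P P' : Fin c → MvPolynomial (Fin n) K) : Prop :=
  Ideal.span (Set.range P') = Ideal.span (Set.range P) ∧ (∀ i, (P' i).totalDegree ≤ d i) ∧
    ∀ b : Fin c → K, b ≠ 0 → ∃ a : Fin c → K, a ≠ 0 ∧ ∑ i, C (b i) * P' i = ∑ i, C (a i) * P i

theorem Repl.update {K : Type*} [Field K] {c n : ℕ} {d : Fin c → ℕ} {P P' : Fin c → MvPolynomial (Fin n) K} (h : Repl d P P')
    (b : Fin c → K) (i0 : Fin c) (hb : b i0 ≠ 0) (hdeg : (∑ i, C (b i) * P' i).totalDegree ≤ d i0) :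
    Repl d P (Function.update P' i0 (∑ i, C (b i) * P' i)) := by
  obtain ⟨h1, h2, h3⟩ := h
  set R := ∑ i, C (b i) * P' i with hR
  have hRs : R = C (b i0) * P' i0 + ∑ i ∈ Finset.univ.erase i0, C (b i) * P' i := by
    rw [hR]
    exact (Finset.add_sum_erase _ (fun i => C (b i) * P' i) (Finset.mem_univ i0)).symm
  refine ⟨?_, ?_, ?_⟩
  · rw [← h1]
    apply le_antisymm
    · rw [Ideal.span_le]
      rintro _ ⟨i, rfl⟩
      by_cases hi : i = i0
      · subst hi
        rw [Function.update_self]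
        exact Ideal.sum_mem _ fun j _ => Ideal.mul_mem_left _ _ (Ideal.subset_span ⟨j, rfl⟩)
      · rw [Function.update_of_ne hi]
        exact Ideal.subset_span ⟨i, rfl⟩
    · rw [Ideal.span_le]
      rintro _ ⟨i, rfl⟩
      by_cases hi : i = i0
      · subst hi
        have e : P' i = C (b i)⁻¹ * (R - ∑ j ∈ Finset.univ.erase i, C (b j) * P' j) := by
          rw [hRs, add_sub_cancel_right, ← mul_assoc, ← C_mul, inv_mul_cancel₀ hb, C_1, one_mul]
        rw [SetLike.mem_coe, e]
        refine Ideal.mul_mem_left _ _ (Ideal.sub_mem _ (Ideal.subset_span ⟨i, Function.update_self _ _ _⟩)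
          (Ideal.sum_mem _ fun j hj => Ideal.mul_mem_left _ _ (Ideal.subset_span ⟨j, Function.update_of_ne (Finset.ne_of_mem_erase hj) _ _⟩)))
      · exact Ideal.subset_span ⟨i, Function.update_of_ne hi _ _⟩
  · intro i
    by_cases hi : i = i0
    · subst hi; rw [Function.update_self]; exact hdeg
    · rw [Function.update_of_ne hi]; exact h2 i
  · intro b' hb'
    obtain ⟨a, ha, hae⟩ := h3 (fun i => (if i = i0 then 0 else b' i) + b' i0 * b i) (by
      intro h0
      have h4 := congrFun h0 i0
      simp only [if_true, zero_add, Pi.zero_apply] at h4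
      have h5 : b' i0 = 0 := by
        rcases mul_eq_zero.mp h4 with h | h
        · exact h
        · exact absurd h hb
      apply hb'
      funext i
      by_cases hi : i = i0
      · subst hi; exact h5
      · have := congrFun h0 i
        simpa [hi, h5] using this)
    refine ⟨a, ha, ?_⟩
    rw [← hae]
    have e1 : ∑ i, C (b' i) * Function.update P' i0 R i = C (b' i0) * R + ∑ i ∈ Finset.univ.erase i0, C (b' i) * P' i := by
      rw [← Finset.add_sum_erase _ _ (Finset.mem_univ i0), Function.update_self]
      refine congrArg (C (b' i0) * R + ·) (Finset.sum_congr rfl fun i hi => ?_)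
      rw [Function.update_of_ne (Finset.ne_of_mem_erase hi)]
    have e2 : ∑ i, C ((if i = i0 then 0 else b' i) + b' i0 * b i) * P' i =
        ∑ i, C (if i = i0 then 0 else b' i) * P' i + C (b' i0) * R := by
      rw [hR, Finset.mul_sum, ← Finset.sum_add_distrib]
      refine Finset.sum_congr rfl fun i _ => ?_
      rw [C_add, C_mul]; ring
    have e3 : ∑ i, C (if i = i0 then 0 else b' i) * P' i = ∑ i ∈ Finset.univ.erase i0, C (b' i) * P' i := by
      rw [← Finset.add_sum_erase _ _ (Finset.mem_univ i0)]
      simp only [if_true, C_0, zero_mul, zero_add]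
      refine Finset.sum_congr rfl fun i hi => ?_
      rw [if_neg (Finset.ne_of_mem_erase hi)]
    rw [e1, e2, e3, add_comm]

theorem exists_min_repl {K : Type*} [Field K] {c n : ℕ} (d : Fin c → ℕ) (P : Fin c → MvPolynomial (Fin n) K)
    (hdeg : ∀ i, (P i).totalDegree ≤ d i) : ∃ P', Repl d P P' ∧ ∀ (b : Fin c → K) (e : ℕ),
      (∃ i, b i ≠ 0 ∧ (P' i).totalDegree = e) → (∀ i, b i ≠ 0 → (P' i).totalDegree ≤ e) →
      (∑ i, C (b i) * P' i).totalDegree = e := by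
  classical
  have hex : ∃ m : ℕ, ∃ P', Repl d P P' ∧ ∑ i, (P' i).totalDegree = m :=
    ⟨_, P, ⟨rfl, hdeg, fun b hb => ⟨b, hb, rfl⟩⟩, rfl⟩
  obtain ⟨P', hP', hm⟩ := Nat.find_spec hex
  refine ⟨P', hP', ?_⟩
  rintro b e ⟨i0, hb0, rfl⟩ hle
  have h1 : (∑ i, C (b i) * P' i).totalDegree ≤ (P' i0).totalDegree := by
    refine totalDegree_finsetSum_le fun i _ => ?_
    by_cases hb : b i = 0
    · simp [hb]
    · refine (totalDegree_mul _ _).trans ?_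
      rw [totalDegree_C, zero_add]
      exact hle i hb
  by_contra hne
  have hlt := lt_of_le_of_ne h1 hne
  refine Nat.find_min hex (m := ∑ i, (Function.update P' i0 (∑ i, C (b i) * P' i) i).totalDegree) ?_
    ⟨_, hP'.update b i0 hb0 (h1.trans (hP'.2.1 i0)), rfl⟩
  rw [← hm]
  refine Finset.sum_lt_sum (fun i _ => ?_) ⟨i0, Finset.mem_univ _, by rw [Function.update_self]; exact hlt⟩
  by_cases hi : i = i0
  · subst hi; rw [Function.update_self]; exact h1
  · rw [Function.update_of_ne hi]

theorem final (c : ℕ) (d : Fin c → ℕ) :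
    ∃ r : ℕ, 0 < r ∧ ∀ (K : Type) [Field K] [Fintype K],
      ∀ (n : ℕ) (P : Fin c → MvPolynomial (Fin n) K),
        (∀ i, (P i).totalDegree ≤ d i) → ncRankCollGE P r →
        ∀ a : ℕ, (a : ℝ) < (Fintype.card K : ℝ) / (∏ i, d i : ℕ) →
          ∀ Q : MvPolynomial (Fin n) K, Q.totalDegree = a →
            (∀ x : Fin n → K, (∀ i, eval x (P i) = 0) → eval x Q = 0) →
            Q ∈ Ideal.span (Set.range P) := by
  classical
  obtain ⟨r, hr⟩ := adapted_main c (∑ i, d i)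
  refine ⟨r + 1, Nat.succ_pos _, ?_⟩
  intro K _ _ n P hdeg hrank a ha Q hQa hvan
  have hD : 0 < ∏ i, d i := by
    rcases Nat.eq_zero_or_pos (∏ i, d i) with h | h
    · rw [h] at ha
      simp only [Nat.cast_zero, div_zero] at ha
      exact absurd ha (not_lt.mpr (Nat.cast_nonneg a))
    · exact h
  have haD : a * ∏ i, d i < Fintype.card K := by
    rw [lt_div_iff₀ (by exact_mod_cast hD)] at ha
    exact_mod_cast ha
  obtain ⟨P', ⟨h1, h2, h3⟩, hmin⟩ := exists_min_repl d P hdeg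
  rw [← h1]
  by_cases hz : ∃ i, (P' i).totalDegree = 0
  · obtain ⟨i, hi⟩ := hz
    rw [totalDegree_eq_zero_iff_eq_C] at hi
    by_cases ht : coeff 0 (P' i) = 0
    · exfalso
      rw [ht, C_0] at hi
      obtain ⟨α, hα, he⟩ := h3 (Pi.single i 1) (by
        intro h
        have := congrFun h i
        simp at this)
      have h0 : ∑ j, C ((Pi.single i 1 : Fin c → K) j) * P' j = 0 := by
        refine Finset.sum_eq_zero fun j _ => ?_
        by_cases hj : j = i
        · subst hj; rw [hi, mul_zero]
        · rw [Pi.single_eq_of_ne hj, C_0, zero_mul]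
      have h4 := hrank α hα
      rw [← he, h0] at h4
      unfold ncRankGE at h4
      have h5 := h4 0 Fin.elim0 Fin.elim0 (fun i => i.elim0) (fun i => i.elim0) (by simp [multiDiff])
      omega
    · have : Ideal.span (Set.range P') = ⊤ := by
        refine Ideal.eq_top_of_isUnit_mem _ (Ideal.subset_span ⟨i, rfl⟩) ?_
        rw [hi]
        exact (IsUnit.mk0 _ ht).map C
      rw [this]
      exact Submodule.mem_top
  · push Not at hz
    have hd1 : ∀ i, 1 ≤ (P' i).totalDegree := fun i => Nat.one_le_iff_ne_zero.mpr (hz i)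
    have hA : Adapted P' (fun i => (P' i).totalDegree) r := by
      intro b e he hle hRk
      have hb : b ≠ 0 := by
        obtain ⟨i, hi, _⟩ := he
        intro h; exact hi (congrFun h i)
      have hde := hmin b e he hle
      obtain ⟨α, hα, hae⟩ := h3 b hb
      have h4 := hrank α hα
      rw [← hae] at h4
      unfold ncRankGE at h4
      rw [hde] at h4
      obtain ⟨f, g, hf, hg, hfg⟩ := hRk
      have := h4 r f g hf hg hfg
      omega
    have hvan' : ∀ x : Fin n → K, (∀ i, eval x (P' i) = 0) → eval x Q = 0 := by
      intro x hx
      apply hvan x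
      have hle : Ideal.span (Set.range P') ≤ RingHom.ker (eval x) := by
        rw [Ideal.span_le]
        rintro _ ⟨i, rfl⟩
        exact hx i
      rw [h1] at hle
      intro i
      exact hle (Ideal.subset_span ⟨i, rfl⟩)
    have hE : ∀ i, (P' i).totalDegree ≤ ∑ i, d i := fun i =>
      (h2 i).trans (Finset.single_le_sum (f := d) (fun _ _ => Nat.zero_le _) (Finset.mem_univ i))
    by_cases hall : ∀ i, (P' i).totalDegree = 1
    · refine hr K n P' _ hd1 hE (fun _ => le_rfl) hA 1 le_rfl (by norm_num) (Or.inr hall) Q ?_ hvan'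
      rw [hQa, one_mul]
      exact lt_of_le_of_lt (Nat.le_mul_of_pos_right _ hD) haD
    · push Not at hall
      obtain ⟨i, hi⟩ := hall
      refine hr K n P' _ hd1 hE (fun _ => le_rfl) hA 2 (by norm_num) le_rfl (Or.inl le_rfl) Q ?_ hvan'
      rw [hQa]
      refine lt_of_le_of_lt ?_ haD
      rw [mul_comm]
      refine Nat.mul_le_mul_left _ ?_
      have h5 : d i ≤ ∏ i, d i := Nat.le_of_dvd hD (Finset.dvd_prod_of_mem d (Finset.mem_univ i))
      have := hd1 i
      have := h2 i
      omega

end HR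

/-- For every degree vector `d̄ = (d_1,...,d_c)` there is a constant
`r(d̄) > 0` such that: for every finite field `k = F_q`, with `D = ∏ d_i`, every `a < q/D`,
and every collection `P̄ = (P_1,...,P_c)` of polynomials in `F_q[x_1,...,x_n]` with
`deg P_i ≤ d_i` and nc-rank `≥ r(d̄)`, any polynomial `Q` of degree `a` vanishing at every
common zero of `P_1,...,P_c` in `F_q^n` lies in the ideal generated by `P_1,...,P_c`. -/
theorem stmt13 (c : ℕ) (hc : 1 ≤ c) (d : Fin c → ℕ) :
    ∃ r : ℕ, 0 < r ∧ ∀ (K : Type) [Field K] [Fintype K],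
      ∀ (n : ℕ) (P : Fin c → MvPolynomial (Fin n) K),
        (∀ i, (P i).totalDegree ≤ d i) → ncRankCollGE P r →
        ∀ a : ℕ, (a : ℝ) < (Fintype.card K : ℝ) / (∏ i, d i : ℕ) →
          ∀ Q : MvPolynomial (Fin n) K, Q.totalDegree = a →
            (∀ x : Fin n → K, (∀ i, eval x (P i) = 0) → eval x Q = 0) →
            Q ∈ Ideal.span (Set.range P) := by
  exact HR.final c d
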